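/- Let 1 ≤ l < m be integers, let ω be a Pólya weight of order l, and let a ∈ ℝ^m have pairwise distinct nonzero entries. Let a' be a random vector in (0,∞)^l with probability density p_ω and let v ∈ U(m) be an independent Haar-distributed unitary matrix. Let G(a', v) = D · B(v) · D, where D = diag(√a'_1,…,√a'_l) and B(v) is the top-left l×l block of v diag(a) v*. Then for every bounded measurable permutation-symmetric function f: ℝ^l → ℝ: ∫_{U(m)} ∫_{(0,∞)^l} f( eig( G(a', v) ) ) p_ω(a') da' dv = ∫_{ℝ^l} f(ã) p(ã|a) dã, where p(ã|a) = (1/l!) · ( ∏_{j=1}^{l} (m−j)! / ((m−l)!(l−j)!·Mω(l−j+1)) ) · ( Δ_l(ã)/Δ_m(a) ) · det M, and M is the m×m matrix with entries M_{b,c} = a_c^{b−1} for 1 ≤ b ≤ m−l and M_{m−l+d, c} = ω̃_<(ã_d | a_c) for 1 ≤ d ≤ l, with ω̃_<(ã|a) = 1{ã·a > 0} · a^{m−l} · ∫_0^1 (m−l)(1−u)^{m−l−1} ω(ã/(a·u)) du/(|a|·u). -/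

import Mathlib

open MeasureTheory Matrix Finset Filter Set
open scoped Classical

noncomputable section

namespace RMT

instance matMS (l m : ℕ) : MeasurableSpace (Matrix (Fin l) (Fin m) ℂ) :=
  inferInstanceAs (MeasurableSpace (Fin l → Fin m → ℂ))

/-- `μ` is the normalized Haar probability measure of `U(l)`, viewed as a measure on the
space of `l × l` complex matrices: it is a probability measure, it is carried by the
unitary group, and it is invariant under left translation by every unitary matrix.
(These properties determine `μ` uniquely.) -/
def IsHaarUnitary (l : ℕ) (μ : Measure (Matrix (Fin l) (Fin l) ℂ)) : Prop :=
  IsProbabilityMeasure μ ∧ μ {A | A ∈ Matrix.unitaryGroup (Fin l) ℂ}ᶜ = 0 ∧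
    ∀ U ∈ Matrix.unitaryGroup (Fin l) ℂ, μ.map (fun A => U * A) = μ

/-- The eigenvalues (with multiplicity, in a fixed order) of a Hermitian matrix;
junk value `0` on non-Hermitian matrices. -/
def eigs {n : ℕ} (y : Matrix (Fin n) (Fin n) ℂ) : Fin n → ℝ :=
  if h : y.IsHermitian then h.eigenvalues else 0

/-- The operator `f ↦ x·f'`. -/
def xdOp (f : ℝ → ℝ) : ℝ → ℝ := fun x => x * deriv f x

/-- The operator `f ↦ -x·f'`. -/
def negxdOp (f : ℝ → ℝ) : ℝ → ℝ := fun x => -(x * deriv f x)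

/-- The Mellin transform `Mω(j) = ∫_0^∞ x^{j-1} ω(x) dx` at a positive integer `j`. -/
def MellinNat (ω : ℝ → ℝ) (j : ℕ) : ℝ := ∫ x in Set.Ioi (0 : ℝ), x ^ (j - 1) * ω x

/-- The Vandermonde determinant `Δ_n(a) = ∏_{c>d} (a_c - a_d)`. -/
def VdmF {n : ℕ} (a : Fin n → ℝ) : ℝ := ∏ c : Fin n, ∏ d ∈ Finset.Iio c, (a c - a d)

/-- The density `p_ω` of the Pólya ensemble associated with the weight `ω`. -/
def polyaDensity (n : ℕ) (ω : ℝ → ℝ) (a' : Fin n → ℝ) : ℝ :=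
  VdmF a' * Matrix.det (Matrix.of fun b c : Fin n => (negxdOp^[(b : ℕ)] ω) (a' c)) /
    ∏ j ∈ Finset.range n, ((Nat.factorial (j + 1) : ℝ) * MellinNat ω (j + 1))

/-- `ω` is a Pólya weight of order `n`. -/
def IsPolyaWeight (n : ℕ) (ω : ℝ → ℝ) : Prop :=
  (∀ x ∈ Set.Ioi (0 : ℝ), 0 ≤ ω x) ∧
  ContDiffOn ℝ ((n - 1 : ℕ) : ℕ∞) ω (Set.Ioi 0) ∧
  (∀ j < n, ∀ k : ℕ, 1 ≤ k → k ≤ n + 1 →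
    Tendsto (fun x : ℝ => x ^ k * (xdOp^[j] ω) x) (nhdsWithin 0 (Set.Ioi 0)) (nhds 0) ∧
    Tendsto (fun x : ℝ => x ^ k * (xdOp^[j] ω) x) atTop (nhds 0)) ∧
  (∀ j < n, ∀ k : ℕ, 1 ≤ k → k ≤ n + 1 →
    IntegrableOn (fun x : ℝ => x ^ (k - 1) * |(xdOp^[j] ω) x|) (Set.Ioi 0)) ∧
  (∀ j : ℕ, 1 ≤ j → j ≤ n → 0 < MellinNat ω j) ∧
  (∀ a' : Fin n → ℝ, (∀ i, 0 < a' i) → 0 ≤ polyaDensity n ω a')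

/-- The diagonal matrix `diag(√a'_1, …, √a'_n)` as a complex matrix. -/
def sqrtDiag {n : ℕ} (a' : Fin n → ℝ) : Matrix (Fin n) (Fin n) ℂ :=
  Matrix.diagonal fun i => ((Real.sqrt (a' i) : ℝ) : ℂ)

/-- A real diagonal matrix as a complex matrix. -/
def realDiag {n : ℕ} (a : Fin n → ℝ) : Matrix (Fin n) (Fin n) ℂ :=
  Matrix.diagonal fun i => ((a i : ℝ) : ℂ)

end RMT

namespace RMT

/-- The weight `ω̃_<(t|av)` (projection case `l < m`). -/
def omegaTildeLt (m l : ℕ) (ω : ℝ → ℝ) (t av : ℝ) : ℝ :=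
  (if 0 < t * av then 1 else 0) * av ^ (m - l) *
    ∫ u in Set.Ioo (0 : ℝ) 1,
      (((m - l : ℕ) : ℝ) * (1 - u) ^ (m - l - 1) * ω (t / (av * u))) / (|av| * u)

/-- The top-left `l × l` block of an `m × m` matrix. -/
def blockLL (l m : ℕ) (h : l ≤ m) (y : Matrix (Fin m) (Fin m) ℂ) :
    Matrix (Fin l) (Fin l) ℂ :=
  Matrix.of fun i j => y (Fin.castLE h i) (Fin.castLE h j)

/-- The joint eigenvalue density `p(ã|a)` in the projection case `l < m`. -/
def projDensity (l m : ℕ) (hlm : l < m) (ω : ℝ → ℝ) (a : Fin m → ℝ) (t : Fin l → ℝ) : ℝ :=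
  (1 / (Nat.factorial l : ℝ)) *
    (∏ j ∈ Finset.range l,
      (Nat.factorial (m - (j + 1)) : ℝ) /
        ((Nat.factorial (m - l) : ℝ) * (Nat.factorial (l - (j + 1)) : ℝ) *
          MellinNat ω (l - j))) *
    (VdmF t / VdmF a) *
    Matrix.det (Matrix.of fun b c : Fin m =>
      if hb : (b : ℕ) < m - l then a c ^ (b : ℕ)
      else omegaTildeLt m l ω (t ⟨(b : ℕ) - (m - l), by have h2 := b.isLt; omega⟩) (a c))


instance matBorel (l m : ℕ) : BorelSpace (Matrix (Fin l) (Fin m) ℂ) :=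
  inferInstanceAs (BorelSpace (Fin l → Fin m → ℂ))

instance matSCT (l m : ℕ) : SecondCountableTopology (Matrix (Fin l) (Fin m) ℂ) :=
  inferInstanceAs (SecondCountableTopology (Fin l → Fin m → ℂ))

/-- The unitary group as a type. -/
abbrev UG (n : ℕ) := Matrix.unitaryGroup (Fin n) ℂ

theorem isClosed_UG (n : ℕ) : IsClosed {A : Matrix (Fin n) (Fin n) ℂ | A ∈ UG n} := by
  have : {A : Matrix (Fin n) (Fin n) ℂ | A ∈ UG n} = {A | A * star A = 1} := by
    ext A; exact Matrix.mem_unitaryGroup_iff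
  rw [this]
  exact isClosed_eq (continuous_id.mul continuous_star) continuous_const

theorem isCompact_UG (n : ℕ) : IsCompact {A : Matrix (Fin n) (Fin n) ℂ | A ∈ UG n} := by
  have h1 : IsCompact (Set.pi Set.univ fun _ : Fin n => Set.pi Set.univ
      fun _ : Fin n => Metric.closedBall (0 : ℂ) 1) :=
    isCompact_univ_pi fun _ => isCompact_univ_pi fun _ => isCompact_closedBall _ _
  refine IsCompact.of_isClosed_subset h1 (isClosed_UG n) ?_
  intro A hA i _ j _
  simpa using entry_norm_bound_of_unitary hA i j

instance compactUG (n : ℕ) : CompactSpace (UG n) := isCompact_iff_compactSpace.1 (isCompact_UG n)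

/-- Normalized Haar measure on the unitary group. -/
def hU (n : ℕ) : Measure (UG n) := Measure.haarMeasure ⊤

instance hU_haar (n : ℕ) : (hU n).IsHaarMeasure := by unfold hU; infer_instance

instance hU_prob (n : ℕ) : IsProbabilityMeasure (hU n) :=
  ⟨by have := Measure.haarMeasure_self (G := UG n) (K₀ := ⊤); simpa [hU] using this⟩

instance hU_right (n : ℕ) : (hU n).IsMulRightInvariant := ⟨fun g => by
  have : IsProbabilityMeasure ((hU n).map (· * g)) :=
    Measure.isProbabilityMeasure_map (measurable_mul_const g).aemeasurable
  exact Measure.isHaarMeasure_eq_of_isProbabilityMeasure _ _⟩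

theorem haar_eq {n : ℕ} (μ : Measure (Matrix (Fin n) (Fin n) ℂ)) (hμ : IsHaarUnitary n μ) :
    μ = (hU n).map (fun v : UG n => (v : Matrix (Fin n) (Fin n) ℂ)) := by
  obtain ⟨hp, h0, hinv⟩ := hμ
  have hmeas : MeasurableSet {A : Matrix (Fin n) (Fin n) ℂ | A ∈ UG n} :=
    (isClosed_UG n).measurableSet
  have hemb : MeasurableEmbedding (fun v : UG n => (v : Matrix (Fin n) (Fin n) ℂ)) :=
    MeasurableEmbedding.subtype_coe hmeas
  set ν : Measure (UG n) := μ.comap (fun v => (v : Matrix (Fin n) (Fin n) ℂ)) with hν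
  have hmap : ν.map (fun v : UG n => (v : Matrix (Fin n) (Fin n) ℂ)) = μ := by
    rw [hν, hemb.map_comap]
    refine Measure.restrict_eq_self_of_ae_mem ?_
    have hr : Set.range (fun v : UG n => (v : Matrix (Fin n) (Fin n) ℂ)) = {A | A ∈ UG n} :=
      Subtype.range_coe
    rw [hr]
    exact h0
  have hprob : IsProbabilityMeasure ν := by
    constructor
    have := congrArg (fun m => m Set.univ) hmap
    rw [hemb.map_apply] at this
    simpa using this
  have hleft : ν.IsMulLeftInvariant := by
    constructor
    intro g
    have h1 : (ν.map (fun x => g * x)).map (fun v : UG n => (v : Matrix (Fin n) (Fin n) ℂ)) =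
        ν.map (fun v : UG n => (v : Matrix (Fin n) (Fin n) ℂ)) := by
      rw [Measure.map_map hemb.measurable (measurable_const_mul g)]
      conv_rhs => rw [hmap, ← hinv g g.2, ← hmap]
      rw [Measure.map_map _ hemb.measurable]
      · rfl
      · exact (continuous_const.mul continuous_id).measurable
    ext s hs
    have h2 := congrArg (fun m => m ((fun v : UG n => (v : Matrix (Fin n) (Fin n) ℂ)) '' s)) h1
    rw [hemb.map_apply, hemb.map_apply, Set.preimage_image_eq _ hemb.injective] at h2
    exact h2
  have hH : ν.IsHaarMeasure := by
    refine Measure.isHaarMeasure_of_isCompact_nonempty_interior ν Set.univ isCompact_univ ?_ ?_ ?_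
    · simp
    · simp
    · simp
  rw [← hmap]
  congr 1
  exact Measure.isHaarMeasure_eq_of_isProbabilityMeasure _ _

/-- leading principal submatrix with indices `≤ j` -/
def lead {n : ℕ} (M : Matrix (Fin n) (Fin n) ℂ) (j : Fin n) :
    Matrix {i : Fin n // i ≤ j} {i : Fin n // i ≤ j} ℂ :=
  M.submatrix Subtype.val Subtype.val

/-- power function: product of powers of leading principal minors -/
def fN {n : ℕ} (N : Fin n → ℕ) (M : Matrix (Fin n) (Fin n) ℂ) : ℂ :=
  ∏ j, (lead M j).det ^ N j

theorem lead_triang {n : ℕ} (T M : Matrix (Fin n) (Fin n) ℂ) (hT : ∀ i k, i < k → T i k = 0)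
    (j : Fin n) : lead (T * M * Tᴴ) j = lead T j * lead M j * (lead T j)ᴴ := by
  have key : ∀ (i : Fin n), i ≤ j → ∀ g : Fin n → ℂ,
      ∑ k, T i k * g k = ∑ k : {k : Fin n // k ≤ j}, T i k * g k := by
    intro i hi g
    have h0 : ∑ k ∈ Finset.univ.filter (· ≤ j), T i k * g k =
        ∑ k : {k : Fin n // k ≤ j}, T i k * g k :=
      Finset.sum_subtype (F := inferInstance) _ (by simp) _
    refine Eq.trans ?_ h0
    rw [Finset.sum_filter]
    refine Finset.sum_congr rfl fun k _ => ?_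
    split_ifs with h
    · rfl
    · rw [hT i k (lt_of_le_of_lt hi (not_le.1 h)), zero_mul]
  ext ⟨i, hi⟩ ⟨k, hk⟩
  simp only [lead, submatrix_apply, Matrix.mul_apply, conjTranspose_apply]
  have h2 : ∀ g : Fin n → ℂ,
      ∑ p, g p * star (T k p) = ∑ p : {p : Fin n // p ≤ j}, g p * star (T k p) := by
    intro g
    have := congrArg star (key k hk (fun p => star (g p)))
    simp only [star_sum, star_mul, star_star] at this
    exact this
  rw [h2]
  refine Finset.sum_congr rfl fun p _ => ?_
  rw [key i hi]

theorem fN_triang {n : ℕ} (N : Fin n → ℕ) (T M : Matrix (Fin n) (Fin n) ℂ)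
    (hT : ∀ i k, i < k → T i k = 0) : fN N (T * M * Tᴴ) = fN N (T * Tᴴ) * fN N M := by
  unfold fN
  rw [← Finset.prod_mul_distrib]
  refine Finset.prod_congr rfl fun j _ => ?_
  rw [← mul_pow, lead_triang T M hT]
  have h1 := lead_triang T 1 hT j
  rw [mul_one] at h1
  have h2 : lead (1 : Matrix (Fin n) (Fin n) ℂ) j = 1 := by
    unfold lead; exact submatrix_one _ Subtype.val_injective
  rw [h1, h2]
  simp only [det_mul, det_one]
  ring

theorem fN_one {n : ℕ} (N : Fin n → ℕ) : fN N (1 : Matrix (Fin n) (Fin n) ℂ) = 1 := by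
  unfold fN
  refine Finset.prod_eq_one fun j _ => ?_
  have h2 : lead (1 : Matrix (Fin n) (Fin n) ℂ) j = 1 := by
    unfold lead; exact submatrix_one _ Subtype.val_injective
  rw [h2, det_one, one_pow]

theorem exists_QR {n : ℕ} (K : Matrix (Fin n) (Fin n) ℂ) :
    ∃ (T : Matrix (Fin n) (Fin n) ℂ) (k : UG n), (∀ i j, i < j → T i j = 0) ∧
      K = T * (k : Matrix (Fin n) (Fin n) ℂ) := by
  let r : Fin n → EuclideanSpace ℂ (Fin n) := fun i => WithLp.toLp 2 (K i)
  have hfr : Module.finrank ℂ (EuclideanSpace ℂ (Fin n)) = Fintype.card (Fin n) := by simp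
  let b := InnerProductSpace.gramSchmidtOrthonormalBasis hfr r
  refine ⟨Matrix.of fun i j => inner ℂ (b j) (r i), ⟨Matrix.of fun i c => b i c, ?_⟩, ?_, ?_⟩
  · rw [Matrix.mem_unitaryGroup_iff]
    ext i j
    have h := b.orthonormal
    rw [orthonormal_iff_ite] at h
    have h2 := h j i
    rw [Matrix.mul_apply]
    simp only [Matrix.star_apply, Matrix.of_apply, Matrix.one_apply]
    simp only [PiLp.inner_apply, RCLike.inner_apply] at h2
    rw [show (if i = j then (1:ℂ) else 0) = if j = i then 1 else 0 by simp [eq_comm], ← h2]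
    rfl
  · intro i j hij
    exact InnerProductSpace.gramSchmidtOrthonormalBasis_inv_triangular hfr r hij
  · ext i c
    have h := congrArg (fun x => x c) (b.sum_repr' (r i))
    simp only [Matrix.mul_apply, Matrix.of_apply]
    rw [show K i c = r i c from rfl, ← h]
    simp

theorem continuous_lead {n : ℕ} (j : Fin n) :
    Continuous fun M : Matrix (Fin n) (Fin n) ℂ => lead M j := by
  unfold lead
  exact continuous_id.matrix_submatrix _ _

theorem continuous_fN {n : ℕ} (N : Fin n → ℕ) : Continuous (fN N) := by
  unfold fN
  exact continuous_finsetProd _ fun j _ => ((continuous_lead j).matrix_det).pow _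

/-- `φ(M) = ∫ f_N(v M v*) dv` -/
def phi {n : ℕ} (N : Fin n → ℕ) (M : Matrix (Fin n) (Fin n) ℂ) : ℂ :=
  ∫ v : UG n, fN N ((v : Matrix (Fin n) (Fin n) ℂ) * M * (v : Matrix (Fin n) (Fin n) ℂ)ᴴ) ∂(hU n)

theorem phi_one {n : ℕ} (N : Fin n → ℕ) : phi N (1 : Matrix (Fin n) (Fin n) ℂ) = 1 := by
  unfold phi
  have : ∀ v : UG n, (v : Matrix (Fin n) (Fin n) ℂ) * 1 * (v : Matrix (Fin n) (Fin n) ℂ)ᴴ = 1 := by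
    intro v
    rw [mul_one]
    exact Matrix.mem_unitaryGroup_iff.1 v.2
  simp only [this, fN_one]
  simp

theorem phi_conj {n : ℕ} (N : Fin n → ℕ) (k : UG n) (M : Matrix (Fin n) (Fin n) ℂ) :
    phi N ((k : Matrix (Fin n) (Fin n) ℂ) * M * (k : Matrix (Fin n) (Fin n) ℂ)ᴴ) = phi N M := by
  unfold phi
  rw [← integral_mul_right_eq_self (μ := hU n) (fun v : UG n =>
    fN N ((v : Matrix (Fin n) (Fin n) ℂ) * M * (v : Matrix (Fin n) (Fin n) ℂ)ᴴ)) k]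
  refine integral_congr_ae (Eventually.of_forall fun v => ?_)
  simp only [Submonoid.coe_mul, conjTranspose_mul, Matrix.mul_assoc]

/-- the equivalence splitting `Fin m` -/
def splitE (l m : ℕ) (h : l ≤ m) : Fin l ⊕ Fin (m - l) ≃ Fin m :=
  finSumFinEquiv.trans (finCongr (by omega))

@[simp] theorem splitE_inl (l m : ℕ) (h : l ≤ m) (i : Fin l) :
    splitE l m h (Sum.inl i) = Fin.castLE h i := by
  ext; simp [splitE]

@[simp] theorem splitE_inr (l m : ℕ) (h : l ≤ m) (i : Fin (m - l)) :
    ((splitE l m h (Sum.inr i) : Fin m) : ℕ) = l + i := by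
  simp [splitE]

theorem exists_block_unitary (l m : ℕ) (h : l ≤ m) (k : UG l) : ∃ k' : UG m,
    ∀ M : Matrix (Fin m) (Fin m) ℂ,
      blockLL l m h ((k' : Matrix (Fin m) (Fin m) ℂ) * M * (k' : Matrix (Fin m) (Fin m) ℂ)ᴴ) =
      (k : Matrix (Fin l) (Fin l) ℂ) * blockLL l m h M * (k : Matrix (Fin l) (Fin l) ℂ)ᴴ := by
  let e := splitE l m h
  let kb : Matrix (Fin l ⊕ Fin (m - l)) (Fin l ⊕ Fin (m - l)) ℂ :=
    Matrix.fromBlocks (k : Matrix (Fin l) (Fin l) ℂ) 0 0 1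
  have hk : (k : Matrix (Fin l) (Fin l) ℂ) * (k : Matrix (Fin l) (Fin l) ℂ)ᴴ = 1 :=
    Matrix.mem_unitaryGroup_iff.1 k.2
  have hkb : kb * kbᴴ = 1 := by
    simp only [kb, fromBlocks_conjTranspose, fromBlocks_multiply]
    simp [hk]
  refine ⟨⟨kb.submatrix e.symm e.symm, ?_⟩, ?_⟩
  · rw [Matrix.mem_unitaryGroup_iff, star_eq_conjTranspose, conjTranspose_submatrix,
      submatrix_mul_equiv, hkb]
    simp
  · intro M
    let Mb := M.submatrix e e
    have hM : M = Mb.submatrix e.symm e.symm := by simp [Mb]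
    have h1 : blockLL l m h M = Mb.toBlocks₁₁ := by
      ext i j
      simp [blockLL, Mb, toBlocks₁₁, e]
    have h2 : ∀ X : Matrix (Fin l ⊕ Fin (m - l)) (Fin l ⊕ Fin (m - l)) ℂ,
        blockLL l m h (X.submatrix e.symm e.symm) = X.toBlocks₁₁ := by
      intro X
      ext i j
      simp only [blockLL, Matrix.of_apply, submatrix_apply, toBlocks₁₁]
      have h3 : ∀ i : Fin l, e.symm (Fin.castLE h i) = Sum.inl i := by
        intro i
        rw [Equiv.symm_apply_eq]
        exact (splitE_inl l m h i).symm
      rw [h3, h3]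
    rw [h1]
    conv_lhs => rw [hM]
    simp only
    rw [conjTranspose_submatrix, submatrix_mul_equiv, submatrix_mul_equiv, h2]
    rw [← fromBlocks_toBlocks Mb]
    simp only [kb, fromBlocks_conjTranspose, fromBlocks_multiply]
    simp [toBlocks₁₁]
    rfl

/-- extend exponents by zero -/
def extN (l m : ℕ) (N : Fin l → ℕ) : Fin m → ℕ := fun i => if h : (i : ℕ) < l then N ⟨i, h⟩ else 0

theorem fN_block (l m : ℕ) (h : l ≤ m) (N : Fin l → ℕ) (M : Matrix (Fin m) (Fin m) ℂ) :
    fN N (blockLL l m h M) = fN (extN l m N) M := by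
  unfold fN
  rw [← Equiv.prod_comp (splitE l m h) (fun j => (lead M j).det ^ extN l m N j),
    Fintype.prod_sum_type]
  have h2 : ∀ j : Fin (m - l), (lead M (splitE l m h (Sum.inr j))).det ^
      extN l m N (splitE l m h (Sum.inr j)) = 1 := by
    intro j
    have : extN l m N (splitE l m h (Sum.inr j)) = 0 := by
      unfold extN; rw [dif_neg]; simp
    rw [this, pow_zero]
  rw [Finset.prod_congr rfl fun j _ => h2 j, Finset.prod_const_one, mul_one]
  refine Finset.prod_congr rfl fun j _ => ?_
  have h3 : extN l m N (splitE l m h (Sum.inl j)) = N j := by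
    unfold extN; rw [dif_pos (by simp)]; simp
  rw [h3]
  congr 1
  rw [splitE_inl]
  let e : {i : Fin l // i ≤ j} ≃ {i : Fin m // i ≤ Fin.castLE h j} :=
    { toFun := fun i => ⟨Fin.castLE h i.1, by simpa using i.2⟩
      invFun := fun i => ⟨⟨i.1, lt_of_le_of_lt (Fin.le_def.1 i.2) j.2⟩, Fin.le_def.2 (Fin.le_def.1 i.2)⟩
      left_inv := fun i => by simp
      right_inv := fun i => by ext; simp }
  rw [← det_submatrix_equiv_self e]
  rfl

theorem cont_conjU {n : ℕ} (A : Matrix (Fin n) (Fin n) ℂ) : Continuous fun v : UG n =>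
    (v : Matrix (Fin n) (Fin n) ℂ) * A * (v : Matrix (Fin n) (Fin n) ℂ)ᴴ :=
  (continuous_subtype_val.mul continuous_const).mul
    (Continuous.matrix_conjTranspose continuous_subtype_val)

theorem continuous_blockLL (l m : ℕ) (h : l ≤ m) : Continuous (blockLL l m h) := by
  have : blockLL l m h = fun M => M.submatrix (Fin.castLE h) (Fin.castLE h) := rfl
  rw [this]
  exact continuous_id.matrix_submatrix _ _

theorem integrable_UG {n : ℕ} {E : Type*} [NormedAddCommGroup E]
    {F : UG n → E} (hF : Continuous F) : Integrable F (hU n) :=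
  hF.integrable_of_hasCompactSupport (HasCompactSupport.of_compactSpace F)

theorem int_fN_block (l m : ℕ) (h : l ≤ m) (N : Fin l → ℕ) (K : Matrix (Fin l) (Fin l) ℂ)
    (A : Matrix (Fin m) (Fin m) ℂ) :
    ∫ v : UG m, fN N (K * blockLL l m h ((v : Matrix (Fin m) (Fin m) ℂ) * A *
      (v : Matrix (Fin m) (Fin m) ℂ)ᴴ) * Kᴴ) ∂(hU m) =
    fN N (K * Kᴴ) * phi (extN l m N) A := by
  obtain ⟨T, k, hT, rfl⟩ := exists_QR K
  obtain ⟨k', hk'⟩ := exists_block_unitary l m h k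
  have h1 : ∀ v : UG m, fN N (T * (k : Matrix (Fin l) (Fin l) ℂ) *
      blockLL l m h ((v : Matrix (Fin m) (Fin m) ℂ) * A *
      (v : Matrix (Fin m) (Fin m) ℂ)ᴴ) * (T * (k : Matrix (Fin l) (Fin l) ℂ))ᴴ) =
      fN N (T * Tᴴ) * fN (extN l m N) (((k' * v : UG m) : Matrix (Fin m) (Fin m) ℂ) * A *
      ((k' * v : UG m) : Matrix (Fin m) (Fin m) ℂ)ᴴ) := by
    intro v
    have : ((k' * v : UG m) : Matrix (Fin m) (Fin m) ℂ) * A *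
      ((k' * v : UG m) : Matrix (Fin m) (Fin m) ℂ)ᴴ = (k' : Matrix (Fin m) (Fin m) ℂ) *
        ((v : Matrix (Fin m) (Fin m) ℂ) * A * (v : Matrix (Fin m) (Fin m) ℂ)ᴴ) *
        (k' : Matrix (Fin m) (Fin m) ℂ)ᴴ := by
      simp only [Submonoid.coe_mul, conjTranspose_mul, Matrix.mul_assoc]
    rw [this, ← fN_block l m h, hk', ← fN_triang N T _ hT]
    simp only [conjTranspose_mul, Matrix.mul_assoc]
  simp_rw [h1]
  rw [integral_const_mul, integral_mul_left_eq_self (μ := hU m) (fun v : UG m =>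
    fN (extN l m N) ((v : Matrix (Fin m) (Fin m) ℂ) * A * (v : Matrix (Fin m) (Fin m) ℂ)ᴴ)) k']
  have hk : (k : Matrix (Fin l) (Fin l) ℂ) * (k : Matrix (Fin l) (Fin l) ℂ)ᴴ = 1 :=
    Matrix.mem_unitaryGroup_iff.1 k.2
  have h3 : T * (k : Matrix (Fin l) (Fin l) ℂ) * (T * (k : Matrix (Fin l) (Fin l) ℂ))ᴴ = T * Tᴴ := by
    rw [conjTranspose_mul, Matrix.mul_assoc, ← Matrix.mul_assoc _ _ (Tᴴ), hk, Matrix.one_mul]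
  rw [h3]
  rfl

instance sctUG (n : ℕ) : SecondCountableTopology (UG n) :=
  TopologicalSpace.Subtype.secondCountableTopology _

/-- The product formula. -/
theorem phi_product (l m : ℕ) (h : l ≤ m) (N : Fin l → ℕ) (D : Matrix (Fin l) (Fin l) ℂ)
    (A : Matrix (Fin m) (Fin m) ℂ) :
    ∫ v : UG m, phi N (D * blockLL l m h ((v : Matrix (Fin m) (Fin m) ℂ) * A *
      (v : Matrix (Fin m) (Fin m) ℂ)ᴴ) * Dᴴ) ∂(hU m) =
    phi N (D * Dᴴ) * phi (extN l m N) A := by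
  unfold phi
  rw [integral_integral_swap]
  · rw [← integral_mul_const]
    refine integral_congr_ae (Eventually.of_forall fun u => ?_)
    have := int_fN_block l m h N ((u : Matrix (Fin l) (Fin l) ℂ) * D) A
    unfold phi at this
    simp only [conjTranspose_mul, Matrix.mul_assoc] at this ⊢
    exact this
  · have : Continuous (Function.uncurry fun (v : UG m) (u : UG l) =>
        fN N ((u : Matrix (Fin l) (Fin l) ℂ) * (D * blockLL l m h ((v : Matrix (Fin m) (Fin m) ℂ) * A *
      (v : Matrix (Fin m) (Fin m) ℂ)ᴴ) * Dᴴ) * (u : Matrix (Fin l) (Fin l) ℂ)ᴴ)) := by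
      refine (continuous_fN N).comp ?_
      have hu : Continuous fun p : UG m × UG l => (p.2 : Matrix (Fin l) (Fin l) ℂ) :=
        continuous_subtype_val.comp continuous_snd
      have hv := (continuous_blockLL l m h).comp ((cont_conjU A).comp
        (continuous_fst : Continuous fun p : UG m × UG l => p.1))
      exact (hu.mul ((continuous_const.mul hv).mul continuous_const)).mul hu.matrix_conjTranspose
    exact this.integrable_of_hasCompactSupport (HasCompactSupport.of_compactSpace _)

/-- monic polynomial with given roots -/
def rootPoly {n : ℕ} (μ : Fin n → ℝ) : Polynomial ℝ := ∏ j, (Polynomial.X - Polynomial.C (μ j))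

theorem rootPoly_monic {n : ℕ} (μ : Fin n → ℝ) : (rootPoly μ).Monic :=
  Polynomial.monic_prod_of_monic _ _ fun _ _ => Polynomial.monic_X_sub_C _

theorem rootPoly_natDegree {n : ℕ} (μ : Fin n → ℝ) : (rootPoly μ).natDegree = n := by
  unfold rootPoly
  rw [Polynomial.natDegree_prod_of_monic _ _ fun _ _ => Polynomial.monic_X_sub_C _]
  simp

theorem rootPoly_eval {n : ℕ} (μ : Fin n → ℝ) (t : ℝ) : (rootPoly μ).eval t = ∏ j, (t - μ j) := by
  simp [rootPoly, Polynomial.eval_prod]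

theorem rootPoly_roots {n : ℕ} (μ : Fin n → ℝ) :
    (rootPoly μ).roots = Finset.univ.val.map μ := by
  have h := Polynomial.roots_multiset_prod_X_sub_C (Finset.univ.val.map μ)
  rw [Multiset.map_map] at h
  exact h

theorem perm_of_ms {n : ℕ} (x y : Fin n → ℝ)
    (h : Finset.univ.val.map x = Finset.univ.val.map y) : ∃ σ : Equiv.Perm (Fin n), y = x ∘ σ := by
  have h2 : ((List.ofFn x : List ℝ) : Multiset ℝ) = List.ofFn y := by
    have e : ∀ z : Fin n → ℝ, ((List.ofFn z : List ℝ) : Multiset ℝ) = Finset.univ.val.map z := by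
      intro z
      rw [Fin.univ_val_map]
    rw [e, e, h]
  have h3 := Multiset.coe_eq_coe.1 h2
  have h4 : x ∘ Tuple.sort x = y ∘ Tuple.sort y := by
    apply List.ofFn_injective
    exact ((((Tuple.sort x).ofFn_comp_perm x).trans h3).trans
      ((Tuple.sort y).ofFn_comp_perm y).symm).eq_of_pairwise'
      (Tuple.monotone_sort x).sortedLE_ofFn.pairwise (Tuple.monotone_sort y).sortedLE_ofFn.pairwise
  refine ⟨(Tuple.sort y).symm.trans (Tuple.sort x), ?_⟩
  ext i
  have := congrFun h4 ((Tuple.sort y).symm i)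
  simpa using this.symm

theorem perm_of_rootPoly {n : ℕ} (x y : Fin n → ℝ) (h : rootPoly x = rootPoly y) :
    ∃ σ : Equiv.Perm (Fin n), y = x ∘ σ := by
  apply perm_of_ms
  rw [← rootPoly_roots, ← rootPoly_roots, h]

/-- values of the root polynomial at `0, …, n` -/
def EV (n : ℕ) (μ : Fin n → ℝ) : Fin (n + 1) → ℝ := fun k => ∏ j, (((k : ℕ) : ℝ) - μ j)

theorem perm_of_EV {n : ℕ} (x y : Fin n → ℝ) (h : EV n x = EV n y) :
    ∃ σ : Equiv.Perm (Fin n), y = x ∘ σ := by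
  apply perm_of_rootPoly
  have hd : ∀ z : Fin n → ℝ, (rootPoly z).degree < ((Finset.univ : Finset (Fin (n+1))).card : ℕ) := by
    intro z
    rw [Polynomial.degree_eq_natDegree (rootPoly_monic z).ne_zero, rootPoly_natDegree]
    simp
    exact_mod_cast Nat.lt_succ_self n
  refine Polynomial.eq_of_degrees_lt_of_eval_index_eq (v := fun k : Fin (n+1) => ((k : ℕ) : ℝ))
    Finset.univ ?_ (hd x) (hd y) ?_
  · intro i _ j _ hij
    exact Fin.ext (Nat.cast_injective (R := ℝ) hij)
  · intro i _
    rw [rootPoly_eval, rootPoly_eval]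
    exact congrFun h i

theorem continuous_EV (n : ℕ) : Continuous (EV n) := by
  unfold EV
  fun_prop

theorem exists_RR (n : ℕ) : ∃ R : (Fin (n + 1) → ℝ) → (Fin n → ℝ), Measurable R ∧
    ∀ μ : Fin n → ℝ, ∃ σ : Equiv.Perm (Fin n), R (EV n μ) = μ ∘ σ := by
  have hK : MeasurableSet {μ : Fin n → ℝ | Monotone μ} := by
    have : IsClosed {μ : Fin n → ℝ | Monotone μ} := by
      have : {μ : Fin n → ℝ | Monotone μ} = ⋂ i, ⋂ j, ⋂ (_ : i ≤ j), {μ | μ i ≤ μ j} := by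
        ext μ; simp [Monotone]
      rw [this]
      exact isClosed_iInter fun i => isClosed_iInter fun j => isClosed_iInter fun _ =>
        isClosed_le (continuous_apply i) (continuous_apply j)
    exact this.measurableSet
  have hinj : Set.InjOn (EV n) {μ : Fin n → ℝ | Monotone μ} := by
    intro x hx y hy h
    obtain ⟨σ, hσ⟩ := perm_of_EV x y h
    have h1 : Monotone (x ∘ σ) := hσ ▸ hy
    have h2 : Monotone (x ∘ (1 : Equiv.Perm (Fin n))) := hx
    have := Tuple.unique_monotone h1 h2
    rw [hσ, this]; rfl
  have hemb := ContinuousOn.measurableEmbedding hK (continuous_EV n).continuousOn hinj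
  obtain ⟨g, hg, hgE⟩ := hemb.exists_measurable_extend (measurable_subtype_coe) (fun _ => ⟨0⟩)
  refine ⟨g, hg, fun μ => ⟨Tuple.sort μ, ?_⟩⟩
  have hm : Monotone (μ ∘ Tuple.sort μ) := Tuple.monotone_sort μ
  have h1 := congrFun hgE ⟨μ ∘ Tuple.sort μ, hm⟩
  have h2 : EV n (μ ∘ Tuple.sort μ) = EV n μ := by
    ext k
    exact Equiv.prod_comp (Tuple.sort μ) (fun j => ((k : ℕ) : ℝ) - μ j)
  simp only [Function.comp_apply] at h1
  rw [← h2]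
  exact h1

/-- measurable root extraction -/
def RR (n : ℕ) : (Fin (n + 1) → ℝ) → (Fin n → ℝ) := (exists_RR n).choose

theorem measurable_RR (n : ℕ) : Measurable (RR n) := (exists_RR n).choose_spec.1

theorem RR_EV (n : ℕ) (μ : Fin n → ℝ) : ∃ σ : Equiv.Perm (Fin n), RR n (EV n μ) = μ ∘ σ :=
  (exists_RR n).choose_spec.2 μ

theorem eigs_det {n : ℕ} (y : Matrix (Fin n) (Fin n) ℂ) (hy : y.IsHermitian) (t : ℝ) :
    ((∏ j, (t - eigs y j) : ℝ) : ℂ) = ((t : ℂ) • (1 : Matrix (Fin n) (Fin n) ℂ) - y).det := by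
  have h := hy.charpoly_eq
  have h2 := congrArg (Polynomial.eval (t : ℂ)) h
  rw [Matrix.eval_charpoly] at h2
  rw [Matrix.smul_one_eq_diagonal]
  have h3 : Matrix.scalar (Fin n) (t : ℂ) = Matrix.diagonal fun _ => (t : ℂ) := rfl
  rw [← h3, h2, Polynomial.eval_prod]
  simp [eigs, hy]

theorem eigs_spectral {n : ℕ} (y : Matrix (Fin n) (Fin n) ℂ) (hy : y.IsHermitian) :
    ∃ k : UG n, y = (k : Matrix (Fin n) (Fin n) ℂ) * realDiag (eigs y) *
      (k : Matrix (Fin n) (Fin n) ℂ)ᴴ := by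
  refine ⟨hy.eigenvectorUnitary, ?_⟩
  have := hy.spectral_theorem
  simp only [Unitary.conjStarAlgAut_apply] at this
  conv_lhs => rw [this]
  simp [eigs, hy, realDiag]
  rfl

theorem phi_eigs {n : ℕ} (N : Fin n → ℕ) (y : Matrix (Fin n) (Fin n) ℂ) (hy : y.IsHermitian) :
    phi N y = phi N (realDiag (eigs y)) := by
  obtain ⟨k, hk⟩ := eigs_spectral y hy
  conv_lhs => rw [hk]
  rw [phi_conj]

theorem phi_perm {n : ℕ} (N : Fin n → ℕ) (x : Fin n → ℝ) (σ : Equiv.Perm (Fin n)) :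
    phi N (realDiag (x ∘ σ)) = phi N (realDiag x) := by
  have hk : (Equiv.Perm.permMatrix ℂ σ) ∈ UG n := by
    rw [Matrix.mem_unitaryGroup_iff, star_eq_conjTranspose, Matrix.conjTranspose_permMatrix,
      ← Matrix.permMatrix_mul]
    simp
  rw [← phi_conj N ⟨_, hk⟩ (realDiag x)]
  congr 1
  simp only [Matrix.conjTranspose_permMatrix]
  unfold Equiv.Perm.permMatrix
  rw [PEquiv.toMatrix_toPEquiv_mul, PEquiv.mul_toMatrix_toPEquiv]
  ext i j
  have h5 : (σ i = (Equiv.symm σ⁻¹) j) ↔ i = j := by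
    have : (Equiv.symm σ⁻¹) j = σ j := rfl
    rw [this, σ.injective.eq_iff]
  simp [realDiag, Matrix.diagonal_apply, h5]

theorem isHermitian_realDiag {n : ℕ} (x : Fin n → ℝ) : (realDiag x).IsHermitian := by
  unfold realDiag
  rw [Matrix.isHermitian_diagonal_iff]
  intro i
  simp [IsSelfAdjoint]

theorem isHermitian_conj {n m : ℕ} (K : Matrix (Fin m) (Fin n) ℂ) (A : Matrix (Fin n) (Fin n) ℂ)
    (hA : A.IsHermitian) : (K * A * Kᴴ).IsHermitian :=
  Matrix.isHermitian_mul_mul_conjTranspose _ hA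

theorem isHermitian_block (l m : ℕ) (h : l ≤ m) (A : Matrix (Fin m) (Fin m) ℂ)
    (hA : A.IsHermitian) : (blockLL l m h A).IsHermitian :=
  hA.submatrix _

/-- characteristic polynomial of a corner -/
theorem corner_det {n : ℕ} (v : UG (n + 1)) (x : Fin (n + 1) → ℝ) (t : ℝ) :
    ((t : ℂ) • (1 : Matrix (Fin n) (Fin n) ℂ) - blockLL n (n + 1) (Nat.le_succ n)
      ((v : Matrix (Fin (n+1)) (Fin (n+1)) ℂ) * realDiag x * (v : Matrix (Fin (n+1)) (Fin (n+1)) ℂ)ᴴ)).det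
    = ((∑ i, ‖(v : Matrix (Fin (n+1)) (Fin (n+1)) ℂ) (Fin.last n) i‖ ^ 2 *
        ∏ k ∈ Finset.univ.erase i, (t - x k) : ℝ) : ℂ) := by
  set V := (v : Matrix (Fin (n+1)) (Fin (n+1)) ℂ) with hV
  have hv1 : V * Vᴴ = 1 := Matrix.mem_unitaryGroup_iff.1 v.2
  have hv2 : Vᴴ * V = 1 := Matrix.mem_unitaryGroup_iff'.1 v.2
  set B := (t : ℂ) • (1 : Matrix (Fin (n+1)) (Fin (n+1)) ℂ) - V * realDiag x * Vᴴ with hB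
  have h1 : ((t : ℂ) • (1 : Matrix (Fin n) (Fin n) ℂ) - blockLL n (n + 1) (Nat.le_succ n)
      (V * realDiag x * Vᴴ)) = B.submatrix (Fin.last n).succAbove (Fin.last n).succAbove := by
    ext i j
    simp [hB, blockLL, Matrix.one_apply]
    rfl
  have h2 := Matrix.adjugate_fin_succ_eq_det_submatrix B (Fin.last n) (Fin.last n)
  rw [h1]
  have h3 : (-1 : ℂ) ^ ((Fin.last n : ℕ) + (Fin.last n : ℕ)) = 1 := by
    rw [← two_mul, pow_mul]; simp
  rw [h3, one_mul] at h2
  rw [← h2]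
  have h4 : B = V * (Matrix.diagonal fun i => ((t - x i : ℝ) : ℂ)) * Vᴴ := by
    have : (Matrix.diagonal fun i => ((t - x i : ℝ) : ℂ)) =
      (t : ℂ) • (1 : Matrix (Fin (n+1)) (Fin (n+1)) ℂ) - realDiag x := by
      rw [Matrix.smul_one_eq_diagonal, realDiag, Matrix.diagonal_sub]
      simp
    rw [this, Matrix.mul_sub, Matrix.sub_mul, hB]
    simp [hv1]
  have hdet : V.det * Vᴴ.det = 1 := by rw [← det_mul, hv1, det_one]
  have ha1 : V.adjugate = V.det • Vᴴ := by
    calc V.adjugate = V.adjugate * (V * Vᴴ) := by rw [hv1, mul_one]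
      _ = _ := by rw [← Matrix.mul_assoc, Matrix.adjugate_mul]; simp
  have ha2 : Vᴴ.adjugate = Vᴴ.det • V := by
    calc Vᴴ.adjugate = Vᴴ.adjugate * (Vᴴ * V) := by rw [hv2, mul_one]
      _ = _ := by rw [← Matrix.mul_assoc, Matrix.adjugate_mul]; simp
  rw [h4, Matrix.adjugate_mul_distrib, Matrix.adjugate_mul_distrib, ha1, ha2,
    Matrix.adjugate_diagonal]
  simp only [Matrix.smul_mul, Matrix.mul_smul, smul_smul]
  rw [hdet, one_smul, ← Matrix.mul_assoc, Matrix.mul_apply]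
  push_cast
  refine Finset.sum_congr rfl fun i _ => ?_
  rw [Matrix.mul_diagonal, conjTranspose_apply]
  have : (‖V (Fin.last n) i‖ : ℂ) ^ 2 = V (Fin.last n) i * star (V (Fin.last n) i) := by
    rw [← Complex.mul_conj']; rfl
  rw [this]; ring

/-- normalized Lebesgue measure on the complex plane -/
def lamC : Measure ℂ := (ENNReal.ofReal Real.pi)⁻¹ • volume

instance lamC_haar : lamC.IsAddHaarMeasure := by
  unfold lamC
  exact Measure.IsAddHaarMeasure.smul _ (by simp) (by simp [Real.pi_pos])

theorem lamC_map : lamC.map (fun z : ℂ => ‖z‖ ^ 2) = volume.restrict (Set.Ioi (0 : ℝ)) := by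
  symm
  apply Real.measure_ext_Ioo_rat
  intro a b
  have hm : Measurable (fun z : ℂ => ‖z‖ ^ 2) := by fun_prop
  rw [Measure.map_apply hm measurableSet_Ioo, Measure.restrict_apply measurableSet_Ioo]
  set a' : ℝ := max (a : ℝ) 0 with ha'
  have h1 : Set.Ioo (a : ℝ) b ∩ Set.Ioi 0 = Set.Ioo a' b := by
    ext x; simp [a']; tauto
  rw [h1, Real.volume_Ioo]
  rcases le_or_gt (b : ℝ) a' with hab | hab
  · have h2 : (fun z : ℂ => ‖z‖ ^ 2) ⁻¹' Set.Ioo (a : ℝ) b ⊆ {0} := by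
      intro z hz
      by_contra hz0
      have : 0 < ‖z‖ ^ 2 := by
        have : z ≠ 0 := hz0
        positivity
      have h3 : ‖z‖ ^ 2 ∈ Set.Ioo a' b := h1 ▸ ⟨hz, this⟩
      exact absurd (h3.1.trans h3.2) (not_lt.2 hab)
    rw [measure_mono_null h2 (by simp [lamC]), ENNReal.ofReal_of_nonpos (by linarith)]
  · have ha0 : 0 ≤ a' := le_max_right _ _
    have hb0 : (0 : ℝ) < b := lt_of_le_of_lt ha0 hab
    have h2 : (fun z : ℂ => ‖z‖ ^ 2) ⁻¹' Set.Ioo (a : ℝ) b =ᵐ[lamC]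
        (Metric.ball (0 : ℂ) (Real.sqrt b) \ Metric.closedBall 0 (Real.sqrt a') : Set ℂ) := by
      have h0 : ∀ᵐ z ∂lamC, z ≠ 0 := by
        rw [ae_iff]; simp [lamC]
      filter_upwards [h0] with z hz
      have hpos : 0 < ‖z‖ ^ 2 := by positivity
      have h3 : ‖z‖ ^ 2 ∈ Set.Ioo (a : ℝ) b ↔ ‖z‖ ^ 2 ∈ Set.Ioo a' b := by
        rw [← h1]; simp [hpos]
      have h4 : z ∈ (Metric.ball (0 : ℂ) (Real.sqrt b) \ Metric.closedBall 0 (Real.sqrt a')) ↔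
          ‖z‖ ^ 2 ∈ Set.Ioo a' b := by
        simp only [Set.mem_sdiff, Metric.mem_ball, Metric.mem_closedBall, dist_zero_right, not_le,
          Set.mem_Ioo]
        rw [Real.lt_sqrt (norm_nonneg z), Real.sqrt_lt' (by positivity)]
        tauto
      exact propext (h3.trans h4.symm)
    rw [measure_congr h2, measure_sdiff]
    · simp only [lamC, Measure.smul_apply, Complex.volume_ball, Complex.volume_closedBall, smul_eq_mul]
      have hpi : (NNReal.pi : ENNReal) = ENNReal.ofReal Real.pi := by
        rw [ENNReal.ofReal, ← NNReal.coe_real_pi, Real.toNNReal_coe]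
      have hp0 : ENNReal.ofReal Real.pi ≠ 0 := by simp [Real.pi_pos]
      have hpt : ENNReal.ofReal Real.pi ≠ ⊤ := by simp
      rw [hpi, mul_comm (_ ^ 2), mul_comm (_ ^ 2), ENNReal.inv_mul_cancel_left hp0 hpt,
        ENNReal.inv_mul_cancel_left hp0 hpt,
        ← ENNReal.ofReal_pow (by positivity), ← ENNReal.ofReal_pow (by positivity),
        Real.sq_sqrt hb0.le, Real.sq_sqrt ha0, ENNReal.ofReal_sub _ ha0]
    · intro z hz
      simp only [Metric.mem_ball, Metric.mem_closedBall, dist_zero_right] at *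
      exact lt_of_le_of_lt hz (Real.sqrt_lt_sqrt ha0 hab)
    · exact measurableSet_closedBall.nullMeasurableSet
    · exact (isCompact_closedBall _ _).measure_lt_top.ne

/-- Haar measure on complex vectors -/
def rhoC (n : ℕ) : Measure (Fin n → ℂ) := Measure.pi fun _ => lamC

instance rhoC_haar (n : ℕ) : (rhoC n).IsAddHaarMeasure := by unfold rhoC; infer_instance

theorem rhoC_map (n : ℕ) : (rhoC n).map (fun z i => ‖z i‖ ^ 2) =
    volume.restrict (Set.pi Set.univ fun _ : Fin n => Set.Ioi (0 : ℝ)) := by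
  have hs : SigmaFinite (lamC.map (fun z : ℂ => ‖z‖ ^ 2)) := by rw [lamC_map]; infer_instance
  have := Measure.pi_map_pi (ι := Fin n) (μ := fun _ => lamC) (f := fun _ (z : ℂ) => ‖z‖ ^ 2)
    (fun _ => by fun_prop)
  unfold rhoC
  rw [this, volume_pi, Measure.restrict_pi_pi]
  simp_rw [lamC_map]

/-- complex unit ball -/
def cBall (n : ℕ) : Set (Fin n → ℂ) := {z | ∑ i, ‖z i‖ ^ 2 < 1}

theorem isOpen_cBall (n : ℕ) : IsOpen (cBall n) :=
  isOpen_lt (by fun_prop) continuous_const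

/-- the open simplex (with apex 0) -/
def Simp (n : ℕ) : Set (Fin n → ℝ) := {ξ | (∀ i, 0 < ξ i) ∧ ∑ i, ξ i < 1}

theorem Simp_eq (n : ℕ) : Simp n = {ξ | ∑ i, ξ i < 1} ∩
    (Set.pi Set.univ fun _ : Fin n => Set.Ioi (0 : ℝ)) := by
  ext ξ; simp [Simp, and_comm]

theorem isOpen_Simp (n : ℕ) : IsOpen (Simp n) := by
  rw [Simp_eq]
  exact (isOpen_lt (by fun_prop) continuous_const).inter
    (isOpen_set_pi Set.finite_univ fun _ _ => isOpen_Ioi)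

theorem norm_sq_eq (z : ℂ) : ((‖z‖ ^ 2 : ℝ) : ℂ) = z * star z := by
  rw [Complex.ofReal_pow, ← Complex.mul_conj']; rfl

theorem vecMul_normsq {n : ℕ} (v : UG n) (z : Fin n → ℂ) :
    ∑ i, ‖(z ᵥ* (v : Matrix (Fin n) (Fin n) ℂ)) i‖ ^ 2 = ∑ i, ‖z i‖ ^ 2 := by
  have hv : (v : Matrix (Fin n) (Fin n) ℂ) * (v : Matrix (Fin n) (Fin n) ℂ)ᴴ = 1 :=
    Matrix.mem_unitaryGroup_iff.1 v.2
  have key : ∀ w : Fin n → ℂ, ((∑ i, ‖w i‖ ^ 2 : ℝ) : ℂ) = w ⬝ᵥ star w := by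
    intro w
    simp only [Complex.ofReal_sum, norm_sq_eq, dotProduct, Pi.star_apply]
  have : ((∑ i, ‖(z ᵥ* (v : Matrix (Fin n) (Fin n) ℂ)) i‖ ^ 2 : ℝ) : ℂ) =
      ((∑ i, ‖z i‖ ^ 2 : ℝ) : ℂ) := by
    rw [key, key, Matrix.star_vecMul, ← Matrix.dotProduct_mulVec, Matrix.mulVec_mulVec, hv,
      Matrix.one_mulVec]
  exact_mod_cast this

theorem rhoC_invariant {n : ℕ} (v : UG n) :
    (rhoC n).map (fun z => z ᵥ* (v : Matrix (Fin n) (Fin n) ℂ)) = rhoC n := by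
  have hv : (v : Matrix (Fin n) (Fin n) ℂ) * (v : Matrix (Fin n) (Fin n) ℂ)ᴴ = 1 :=
    Matrix.mem_unitaryGroup_iff.1 v.2
  have hv2 : (v : Matrix (Fin n) (Fin n) ℂ)ᴴ * (v : Matrix (Fin n) (Fin n) ℂ) = 1 :=
    Matrix.mem_unitaryGroup_iff'.1 v.2
  have hc : ∀ M : Matrix (Fin n) (Fin n) ℂ, Continuous fun z : Fin n → ℂ => z ᵥ* M := fun M =>
    Continuous.matrix_vecMul continuous_id continuous_const
  let e : (Fin n → ℂ) ≃+ (Fin n → ℂ) :=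
    { toFun := fun z => z ᵥ* (v : Matrix (Fin n) (Fin n) ℂ)
      invFun := fun z => z ᵥ* (v : Matrix (Fin n) (Fin n) ℂ)ᴴ
      left_inv := fun z => by simp [hv]
      right_inv := fun z => by simp [hv2]
      map_add' := fun x y => Matrix.add_vecMul _ _ _ }
  have hH : ((rhoC n).map e).IsAddHaarMeasure :=
    AddEquiv.isAddHaarMeasure_map (rhoC n) e (hc _) (hc _)
  have h1 := Measure.isAddLeftInvariant_eq_smul ((rhoC n).map e) (rhoC n)
  have h2 : (rhoC n).map e (cBall n) = rhoC n (cBall n) := by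
    have hce : Continuous e := hc _
    rw [Measure.map_apply hce.measurable (isOpen_cBall n).measurableSet]
    congr 1
    ext z
    change (∑ i, ‖(z ᵥ* (v : Matrix (Fin n) (Fin n) ℂ)) i‖ ^ 2 < 1) ↔ _
    rw [vecMul_normsq]; rfl
  have h3 : rhoC n (cBall n) ≠ 0 :=
    ((isOpen_cBall n).measure_pos _ ⟨0, by simp [cBall]⟩).ne'
  have h4 : rhoC n (cBall n) ≠ ⊤ := by
    have hsub : cBall n ⊆ Set.pi Set.univ fun _ : Fin n => Metric.closedBall (0 : ℂ) 1 := by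
      intro z hz i _
      simp only [Metric.mem_closedBall, dist_zero_right]
      have h5 : ‖z i‖ ^ 2 ≤ ∑ i, ‖z i‖ ^ 2 :=
        Finset.single_le_sum (f := fun i => ‖z i‖ ^ 2) (fun _ _ => by positivity) (Finset.mem_univ i)
      have h6 : ∑ i, ‖z i‖ ^ 2 < 1 := hz
      nlinarith [norm_nonneg (z i)]
    exact ((measure_mono hsub).trans_lt
      (isCompact_univ_pi fun _ => isCompact_closedBall _ _).measure_lt_top).ne
  have h5 : ((Measure.addHaarScalarFactor ((rhoC n).map e) (rhoC n) : NNReal) : ENNReal) = 1 := by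
    have h6 := congrArg (fun m => m (cBall n)) h1
    simp only [Measure.smul_apply] at h6
    rw [h2] at h6
    have h7 : (1 : ENNReal) * rhoC n (cBall n) =
      ((Measure.addHaarScalarFactor ((rhoC n).map e) (rhoC n) : NNReal) : ENNReal) *
        rhoC n (cBall n) := by rw [one_mul]; exact h6
    exact ((ENNReal.mul_left_inj h3 h4).1 h7).symm
  have h8 : Measure.addHaarScalarFactor ((rhoC n).map e) (rhoC n) = 1 := by exact_mod_cast h5
  rw [h8, one_smul] at h1
  exact h1

theorem exists_row {n : ℕ} (i₀ : Fin n) (u : Fin n → ℂ) (hu : ∑ i, ‖u i‖ ^ 2 = 1) :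
    ∃ k : UG n, (k : Matrix (Fin n) (Fin n) ℂ) i₀ = u := by
  have hfr : Module.finrank ℂ (EuclideanSpace ℂ (Fin n)) = Fintype.card (Fin n) := by simp
  have hon : Orthonormal ℂ (Set.domRestrict ({i₀} : Set (Fin n))
      (fun _ : Fin n => (WithLp.toLp 2 u : EuclideanSpace ℂ (Fin n)))) := by
    constructor
    · intro i
      have : ‖(WithLp.toLp 2 u : EuclideanSpace ℂ (Fin n))‖ ^ 2 = 1 := by
        rw [EuclideanSpace.norm_sq_eq]; exact hu
      exact (pow_eq_one_iff_of_nonneg (norm_nonneg _) two_ne_zero).1 this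
    · intro i j hij
      exact absurd (Subtype.ext (i.2.trans j.2.symm)) hij
  obtain ⟨b, hb⟩ := hon.exists_orthonormalBasis_extension_of_card_eq hfr
  refine ⟨⟨Matrix.of fun i c => b i c, ?_⟩, ?_⟩
  · rw [Matrix.mem_unitaryGroup_iff]
    ext i j
    have h := b.orthonormal
    rw [orthonormal_iff_ite] at h
    have h2 := h j i
    rw [Matrix.mul_apply]
    simp only [Matrix.star_apply, Matrix.of_apply, Matrix.one_apply]
    simp only [PiLp.inner_apply, RCLike.inner_apply] at h2
    rw [show (if i = j then (1:ℂ) else 0) = if j = i then 1 else 0 by simp [eq_comm], ← h2]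
    rfl
  · ext c
    have := hb i₀ rfl
    simp only [Matrix.of_apply]
    rw [this]

theorem rhoC_simp {n : ℕ} (g : (Fin n → ℝ) → ENNReal) (hg : Measurable g) :
    ∫⁻ z in cBall n, g (fun i => ‖z i‖ ^ 2) ∂(rhoC n) = ∫⁻ ξ in Simp n, g ξ := by
  have hms : MeasurableSet {ξ : Fin n → ℝ | ∑ i, ξ i < 1} :=
    (isOpen_lt (by fun_prop) continuous_const).measurableSet
  have hmm : Measurable (fun (z : Fin n → ℂ) i => ‖z i‖ ^ 2) := by fun_prop
  have h1 : cBall n = (fun (z : Fin n → ℂ) i => ‖z i‖ ^ 2) ⁻¹' {ξ : Fin n → ℝ | ∑ i, ξ i < 1} := rfl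
  rw [h1, ← setLIntegral_map hms hg hmm, rhoC_map, Measure.restrict_restrict hms, Simp_eq]

theorem vol_Simp_ne_zero (n : ℕ) : volume (Simp n) ≠ 0 := by
  refine ((isOpen_Simp n).measure_pos _ ⟨fun _ => 1 / (n + 1 : ℝ), fun i => by positivity, ?_⟩).ne'
  simp
  rw [← div_eq_mul_inv, div_lt_one (by positivity)]
  linarith

theorem vol_Simp_ne_top (n : ℕ) : volume (Simp n) ≠ ⊤ := by
  have hsub : Simp n ⊆ Set.pi Set.univ fun _ : Fin n => Set.Icc (0 : ℝ) 1 := by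
    intro z hz i _
    exact ⟨(hz.1 i).le, (Finset.single_le_sum (fun j _ => (hz.1 j).le) (Finset.mem_univ i)).trans hz.2.le⟩
  exact ((measure_mono hsub).trans_lt
      (isCompact_univ_pi fun _ => isCompact_Icc).measure_lt_top).ne

theorem simplex_law {n : ℕ} (i₀ : Fin n) (g : (Fin n → ℝ) → ENNReal) (hg : Measurable g) :
    (∫⁻ v : UG n, g (fun i => ‖(v : Matrix (Fin n) (Fin n) ℂ) i₀ i‖ ^ 2) ∂(hU n)) *
      volume (Simp n) = ∫⁻ ξ in Simp n, g (fun i => ξ i / ∑ j, ξ j) := by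
  have hg' : Measurable fun ξ : Fin n → ℝ => g (fun i => ξ i / ∑ j, ξ j) := by
    refine hg.comp ?_
    fun_prop
  rw [← rhoC_simp _ hg']
  have hmB := (isOpen_cBall n).measurableSet
  have hcv : Continuous fun p : UG n × (Fin n → ℂ) => p.2 ᵥ* (p.1 : Matrix (Fin n) (Fin n) ℂ) :=
    Continuous.matrix_vecMul continuous_snd (continuous_subtype_val.comp continuous_fst)
  have h1 : ∀ v : UG n,
      ∫⁻ z in cBall n, g (fun i => ‖z i‖ ^ 2 / ∑ j, ‖z j‖ ^ 2) ∂(rhoC n) =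
      ∫⁻ z in cBall n, g (fun i => ‖(z ᵥ* (v : Matrix (Fin n) (Fin n) ℂ)) i‖ ^ 2 /
        ∑ j, ‖z j‖ ^ 2) ∂(rhoC n) := by
    intro v
    conv_lhs => rw [← rhoC_invariant v]
    have hmv : Measurable fun z : Fin n → ℂ => z ᵥ* (v : Matrix (Fin n) (Fin n) ℂ) :=
      (hcv.comp (Continuous.prodMk_right v)).measurable
    rw [setLIntegral_map hmB _ hmv]
    · have h2 : (fun z : Fin n → ℂ => z ᵥ* (v : Matrix (Fin n) (Fin n) ℂ)) ⁻¹' cBall n = cBall n := by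
        ext z
        change (∑ i, ‖(z ᵥ* (v : Matrix (Fin n) (Fin n) ℂ)) i‖ ^ 2 < 1) ↔ _
        rw [vecMul_normsq]; rfl
      rw [h2]
      simp only [vecMul_normsq]
    · exact hg.comp (by fun_prop)
  have h2 : ∫⁻ z in cBall n, g (fun i => ‖z i‖ ^ 2 / ∑ j, ‖z j‖ ^ 2) ∂(rhoC n) =
      ∫⁻ v : UG n, ∫⁻ z in cBall n, g (fun i => ‖(z ᵥ* (v : Matrix (Fin n) (Fin n) ℂ)) i‖ ^ 2 /
        ∑ j, ‖z j‖ ^ 2) ∂(rhoC n) ∂(hU n) := by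
    simp_rw [← h1]
    simp
  rw [h2, lintegral_lintegral_swap]
  · have h3 : ∀ᵐ z ∂((rhoC n).restrict (cBall n)),
        ∫⁻ v : UG n, g (fun i => ‖(z ᵥ* (v : Matrix (Fin n) (Fin n) ℂ)) i‖ ^ 2 /
        ∑ j, ‖z j‖ ^ 2) ∂(hU n) =
        ∫⁻ v : UG n, g (fun i => ‖(v : Matrix (Fin n) (Fin n) ℂ) i₀ i‖ ^ 2) ∂(hU n) := by
      have h0 : ∀ᵐ z ∂(rhoC n), z ≠ 0 := by
        have : Nonempty (Fin n) := ⟨i₀⟩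
        rw [ae_iff]; simp
      filter_upwards [ae_restrict_of_ae h0] with z hz
      set s := ∑ j, ‖z j‖ ^ 2 with hs
      have hs0 : 0 < s := by
        obtain ⟨j, hj⟩ := Function.ne_iff.1 hz
        refine Finset.sum_pos' (fun _ _ => by positivity) ⟨j, Finset.mem_univ j, ?_⟩
        have : z j ≠ 0 := hj
        positivity
      have hss : (Real.sqrt s) ≠ 0 := (Real.sqrt_pos.2 hs0).ne'
      obtain ⟨k, hk⟩ := exists_row i₀ (fun i => ((Real.sqrt s)⁻¹ : ℝ) * z i) (by
        simp only [norm_mul, mul_pow, ← Finset.mul_sum, ← hs]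
        simp
        rw [Real.sq_sqrt hs0.le]
        field_simp)
      rw [← lintegral_mul_left_eq_self (μ := hU n)
        (fun v : UG n => g (fun i => ‖(v : Matrix (Fin n) (Fin n) ℂ) i₀ i‖ ^ 2)) k]
      refine lintegral_congr fun v => ?_
      congr 1
      ext i
      have h5 : ((k * v : UG n) : Matrix (Fin n) (Fin n) ℂ) i₀ i =
          ((Real.sqrt s)⁻¹ : ℝ) * (z ᵥ* (v : Matrix (Fin n) (Fin n) ℂ)) i := by
        rw [Submonoid.coe_mul, Matrix.mul_apply, hk]
        simp only [vecMul, dotProduct, Finset.mul_sum]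
        refine Finset.sum_congr rfl fun j _ => by ring
      rw [h5, norm_mul, mul_pow]
      simp
      rw [Real.sq_sqrt hs0.le]
      ring
    rw [lintegral_congr_ae h3, lintegral_const]
    congr 1
    have := rhoC_simp (n := n) (fun _ => 1) measurable_const
    simpa using this.symm
  · refine (hg.comp ?_).aemeasurable
    have h6 : Measurable fun p : UG n × (Fin n → ℂ) => p.2 ᵥ* (p.1 : Matrix (Fin n) (Fin n) ℂ) :=
      hcv.measurable
    refine measurable_pi_lambda _ fun i => ?_
    have h7 := (measurable_pi_apply i).comp h6
    refine (h7.norm.pow_const 2).div ?_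
    fun_prop

theorem VdmF_eq_det {n : ℕ} (a : Fin n → ℝ) : VdmF a = (Matrix.vandermonde a).det := by
  rw [Matrix.det_vandermonde, VdmF]
  exact Finset.prod_comm' (by simp)

theorem absprod {n : ℕ} (x : Fin n → ℝ) :
    ∏ i, ∏ k ∈ Finset.univ.erase i, |x i - x k| = |VdmF x| ^ 2 := by
  have h1 : ∀ i : Fin n, ∏ k ∈ Finset.univ.erase i, |x i - x k| =
      (∏ k ∈ Finset.Iio i, |x i - x k|) * ∏ k ∈ Finset.Ioi i, |x i - x k| := by
    intro i
    rw [← Finset.prod_union]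
    · congr 1
      ext k; simp [lt_or_lt_iff_ne]
    · rw [Finset.disjoint_left]
      intro k hk hk2
      simp at hk hk2
      exact absurd (hk.trans hk2) (lt_irrefl _)
  simp_rw [h1]
  rw [Finset.prod_mul_distrib, sq]
  congr 1
  · simp [VdmF, Finset.abs_prod]
  · simp only [VdmF, Finset.abs_prod]
    rw [Finset.prod_comm' (t' := Finset.univ) (s' := fun k => Finset.Iio k) (by simp)]
    refine Finset.prod_congr rfl fun i _ => Finset.prod_congr rfl fun j _ => abs_sub_comm _ _

theorem VdmF_pos {n : ℕ} (x : Fin n → ℝ) (hx : StrictMono x) : 0 < VdmF x :=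
  Finset.prod_pos fun i _ => Finset.prod_pos fun j hj => by
    have := hx (Finset.mem_Iio.1 hj); linarith

theorem det_of_polys {n : ℕ} (f : Fin n → Polynomial ℝ) (hf : ∀ j, (f j).natDegree < n)
    (y : Fin n → ℝ) : (Matrix.of fun i j => (f j).eval (y i)).det =
      (Matrix.vandermonde y).det * (Matrix.of fun k j : Fin n => (f j).coeff k).det := by
  rw [← det_mul]
  congr 1
  ext i j
  rw [Matrix.mul_apply, Matrix.of_apply, Polynomial.eval_eq_sum_range' (hf j), Finset.sum_range]
  refine Finset.sum_congr rfl fun k _ => ?_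
  simp [vandermonde, mul_comm, Matrix.vandermonde_apply]

/-- interlacing box times unit interval -/
def Om {n : ℕ} (x : Fin (n + 1) → ℝ) : Set (Fin (n + 1) → ℝ) :=
  {w | (0 < w 0 ∧ w 0 < 1) ∧ ∀ j : Fin n, x j.castSucc < w j.succ ∧ w j.succ < x j.succ}

/-- denominators -/
def DD {n : ℕ} (x : Fin (n + 1) → ℝ) (i : Fin (n + 1)) : ℝ :=
  ∏ k ∈ Finset.univ.erase i, (x i - x k)

/-- the change of variables -/
def Xi {n : ℕ} (x : Fin (n + 1) → ℝ) (w : Fin (n + 1) → ℝ) : Fin (n + 1) → ℝ :=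
  fun i => w 0 * (∏ j : Fin n, (x i - w j.succ)) / DD x i

/-- its Jacobian matrix -/
def XiJ {n : ℕ} (x : Fin (n + 1) → ℝ) (w : Fin (n + 1) → ℝ) : Matrix (Fin (n + 1)) (Fin (n + 1)) ℝ :=
  Matrix.of fun i k => (Fin.cons (∏ j : Fin n, (x i - w j.succ))
    (fun j => - w 0 * ∏ k ∈ Finset.univ.erase j, (x i - w (Fin.succ k))) : Fin (n + 1) → ℝ) k / DD x i

theorem DD_ne {n : ℕ} (x : Fin (n + 1) → ℝ) (hx : Function.Injective x) (i) : DD x i ≠ 0 := by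
  unfold DD
  rw [Finset.prod_ne_zero_iff]
  intro k hk
  rw [sub_ne_zero]
  exact fun h => (Finset.ne_of_mem_erase hk) (hx h).symm

theorem DD_eq {n : ℕ} (x : Fin (n + 1) → ℝ) (i) : DD x i = ∏ j : Fin n, (x i - x (i.succAbove j)) := by
  unfold DD
  have h := Fin.prod_univ_succAbove (fun k => if k = i then 1 else x i - x k) i
  have h2 : ∏ k, (if k = i then 1 else x i - x k) = ∏ k ∈ Finset.univ.erase i, (x i - x k) := by
    rw [← Finset.mul_prod_erase Finset.univ _ (Finset.mem_univ i)]
    simp only [if_true, one_mul]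
    refine Finset.prod_congr rfl fun k hk => ?_
    rw [if_neg (Finset.ne_of_mem_erase hk)]
  rw [← h2, h]
  simp [Fin.succAbove_ne]

theorem hasFDerivAt_Xi {n : ℕ} (x w : Fin (n + 1) → ℝ) :
    HasFDerivAt (Xi x) (LinearMap.toContinuousLinearMap (Matrix.toLin' (XiJ x w))) w := by
  rw [hasFDerivAt_pi']
  intro i
  have h0 : ∀ k : Fin (n + 1), HasFDerivAt (fun w : Fin (n + 1) → ℝ => w k)
      (ContinuousLinearMap.proj k : (Fin (n + 1) → ℝ) →L[ℝ] ℝ) w := fun k => hasFDerivAt_apply k w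
  have h1 := HasFDerivAt.finsetProd (u := (Finset.univ : Finset (Fin n)))
    (g := fun j (w : Fin (n + 1) → ℝ) => x i - w j.succ)
    (g' := fun j => -(ContinuousLinearMap.proj j.succ : (Fin (n + 1) → ℝ) →L[ℝ] ℝ)) (x := w)
    (fun j _ => by simpa using (h0 j.succ).const_sub (x i))
  have h2 := ((h0 0).mul h1).mul_const (DD x i)⁻¹
  have h3 : (fun w : Fin (n + 1) → ℝ => Xi x w i) = fun w : Fin (n + 1) → ℝ =>
    (w 0 * ∏ j : Fin n, (x i - w j.succ)) * (DD x i)⁻¹ := by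
    ext w; simp [Xi, div_eq_mul_inv]
  rw [h3]
  refine h2.congr_fderiv ?_
  ext z
  simp only [ContinuousLinearMap.smul_apply, ContinuousLinearMap.add_apply, ContinuousLinearMap.coe_comp',
    Function.comp_apply, ContinuousLinearMap.proj_apply, LinearMap.coe_toContinuousLinearMap',
    Matrix.toLin'_apply, Matrix.mulVec, dotProduct, XiJ, Matrix.of_apply, Fin.sum_univ_succ,
    Fin.cons_zero, Fin.cons_succ, ContinuousLinearMap.sum_apply, ContinuousLinearMap.neg_apply,
    smul_eq_mul, Finset.mul_sum, mul_add]
  rw [add_comm]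
  congr 1
  · ring
  · refine Finset.sum_congr rfl fun j _ => ?_
    ring

theorem det_XiJ {n : ℕ} (x w : Fin (n + 1) → ℝ) (hx : Function.Injective x)
    (hw : Function.Injective fun j : Fin n => w j.succ) :
    |(XiJ x w).det| = |w 0| ^ n * |VdmF fun j : Fin n => w j.succ| / |VdmF x| := by
  set μ : Fin n → ℝ := fun j => w j.succ with hμ
  let f : Fin (n + 1) → Polynomial ℝ := Fin.cons (rootPoly μ)
    (fun j => Polynomial.C (- w 0) * ∏ k ∈ Finset.univ.erase j, (Polynomial.X - Polynomial.C (μ k)))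
  have hf : ∀ j, (f j).natDegree < n + 1 := by
    intro j
    refine Fin.cases ?_ (fun j => ?_) j
    · simp [f, rootPoly_natDegree]
    · simp only [f, Fin.cons_succ]
      refine Nat.lt_succ_of_le ((Polynomial.natDegree_C_mul_le _ _).trans ?_)
      rw [Polynomial.natDegree_prod_of_monic _ _ fun _ _ => Polynomial.monic_X_sub_C _]
      simp
  have hev0 : ∀ y, (f 0).eval y = ∏ j, (y - μ j) := fun y => by
    simp only [f, Fin.cons_zero, rootPoly_eval]
  have hevs : ∀ y j, (f (Fin.succ j)).eval y = - w 0 * ∏ k ∈ Finset.univ.erase j, (y - μ k) :=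
    fun y j => by simp [f, Polynomial.eval_prod]
  -- Jacobian as product
  have h1 : XiJ x w = Matrix.diagonal (fun i => (DD x i)⁻¹) * Matrix.of fun i j => (f j).eval (x i) := by
    ext i j
    rw [Matrix.diagonal_mul]
    refine Fin.cases ?_ (fun j => ?_) j
    · rw [Matrix.of_apply, hev0]; simp [XiJ, μ]; ring
    · rw [Matrix.of_apply, hevs]; simp [XiJ, μ]; ring
  obtain ⟨y0, hy0⟩ : ∃ y0 : ℝ, ∀ j, y0 ≠ μ j := by
    obtain ⟨y, hy⟩ := (Set.finite_range μ).exists_notMem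
    exact ⟨y, fun j h => hy ⟨j, h.symm⟩⟩
  let y : Fin (n + 1) → ℝ := Fin.cons y0 μ
  have h2 := det_of_polys f hf y
  have h3 : (Matrix.of fun i j => (f j).eval (y i)).det =
      (∏ j, (y0 - μ j)) * ∏ j, (- w 0 * ∏ k ∈ Finset.univ.erase j, (μ j - μ k)) := by
    rw [Matrix.det_of_isUpperTriangular]
    · rw [Fin.prod_univ_succ]
      simp only [Matrix.of_apply, hev0, hevs, y, Fin.cons_zero, Fin.cons_succ]
    · intro i j hij
      obtain ⟨i, rfl⟩ := Fin.exists_succ_eq.2 (Fin.pos_iff_ne_zero.1 ((Fin.zero_le j).trans_lt hij))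
      simp only [Matrix.of_apply, y, Fin.cons_succ]
      revert hij
      refine Fin.cases ?_ (fun j => ?_) j
      · intro _
        rw [hev0]
        exact Finset.prod_eq_zero (Finset.mem_univ i) (sub_self _)
      · intro hij
        rw [hevs]
        have hne : i ≠ j := fun h => by subst h; exact lt_irrefl _ hij
        rw [Finset.prod_eq_zero (Finset.mem_erase.2 ⟨hne, Finset.mem_univ i⟩) (sub_self _), mul_zero]
  have h4 : (Matrix.vandermonde y).det = (∏ j, (μ j - y0)) * VdmF μ := by
    rw [VdmF_eq_det, Matrix.det_vandermonde, Matrix.det_vandermonde, Fin.prod_univ_succ]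
    congr 1
    · rw [Fin.prod_Ioi_zero]
      simp [y]
    · refine Finset.prod_congr rfl fun i _ => ?_
      rw [Fin.prod_Ioi_succ]
      simp [y]
  rw [h3, h4] at h2
  have h5 := congrArg abs h2
  have hA : (∏ j, |y0 - μ j|) ≠ 0 := by
    rw [Finset.prod_ne_zero_iff]
    intro j _
    exact abs_ne_zero.2 (sub_ne_zero.2 (hy0 j))
  have hV : |VdmF μ| ≠ 0 := by
    rw [abs_ne_zero, VdmF_eq_det, Matrix.det_vandermonde_ne_zero_iff]
    exact hw
  simp only [abs_mul, Finset.abs_prod, Finset.prod_mul_distrib, Finset.prod_const,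
    Finset.card_univ, Fintype.card_fin] at h5
  rw [absprod, Finset.prod_congr rfl fun j _ => abs_sub_comm (μ j) y0, mul_assoc,
    mul_right_inj' hA] at h5
  have h6 : |(Matrix.of fun k j : Fin (n + 1) => (f j).coeff k).det| = |w 0| ^ n * |VdmF μ| := by
    apply mul_left_cancel₀ hV
    rw [← h5, abs_pow, abs_neg]; ring
  have hVx : |VdmF x| ≠ 0 := by
    rw [abs_ne_zero, VdmF_eq_det, Matrix.det_vandermonde_ne_zero_iff]
    exact hx
  rw [h1, det_mul, det_diagonal, det_of_polys f hf x, abs_mul, abs_mul, h6, Finset.abs_prod,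
    ← VdmF_eq_det]
  simp only [abs_inv, DD, Finset.abs_prod]
  rw [Finset.prod_inv_distrib, absprod]
  field_simp

/-- the secular polynomial -/
def qpoly {n : ℕ} (x ξ : Fin (n + 1) → ℝ) : Polynomial ℝ :=
  ∑ i, Polynomial.C (ξ i) * ∏ k ∈ Finset.univ.erase i, (Polynomial.X - Polynomial.C (x k))

theorem qpoly_eval {n : ℕ} (x ξ : Fin (n + 1) → ℝ) (t : ℝ) :
    (qpoly x ξ).eval t = ∑ i, ξ i * ∏ k ∈ Finset.univ.erase i, (t - x k) := by
  simp [qpoly, Polynomial.eval_finsetSum, Polynomial.eval_prod]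

theorem qpoly_eval_node {n : ℕ} (x ξ : Fin (n + 1) → ℝ) (i : Fin (n + 1)) :
    (qpoly x ξ).eval (x i) = ξ i * DD x i := by
  rw [qpoly_eval, Finset.sum_eq_single i]
  · rfl
  · intro j _ hj
    rw [Finset.prod_eq_zero (Finset.mem_erase.2 ⟨hj.symm, Finset.mem_univ i⟩) (sub_self _), mul_zero]
  · simp

theorem monic_nodes {n : ℕ} (x : Fin (n + 1) → ℝ) (i : Fin (n + 1)) :
    (∏ k ∈ Finset.univ.erase i, (Polynomial.X - Polynomial.C (x k))).Monic ∧
    (∏ k ∈ Finset.univ.erase i, (Polynomial.X - Polynomial.C (x k))).natDegree = n := by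
  constructor
  · exact Polynomial.monic_prod_of_monic _ _ fun _ _ => Polynomial.monic_X_sub_C _
  · rw [Polynomial.natDegree_prod_of_monic _ _ fun _ _ => Polynomial.monic_X_sub_C _]
    simp

theorem qpoly_coeff {n : ℕ} (x ξ : Fin (n + 1) → ℝ) : (qpoly x ξ).coeff n = ∑ i, ξ i := by
  rw [qpoly, Polynomial.finsetSum_coeff]
  refine Finset.sum_congr rfl fun i _ => ?_
  rw [Polynomial.coeff_C_mul]
  have h := monic_nodes x i
  have : (∏ k ∈ Finset.univ.erase i, (Polynomial.X - Polynomial.C (x k))).coeff n = 1 := by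
    have h2 := h.1.coeff_natDegree
    rwa [h.2] at h2
  rw [this, mul_one]

theorem qpoly_natDegree {n : ℕ} (x ξ : Fin (n + 1) → ℝ) : (qpoly x ξ).natDegree ≤ n := by
  refine Polynomial.natDegree_sum_le_of_forall_le _ _ fun i _ => ?_
  exact (Polynomial.natDegree_C_mul_le _ _).trans (monic_nodes x i).2.le

theorem qpoly_Xi {n : ℕ} (x w : Fin (n + 1) → ℝ) (hx : Function.Injective x) :
    qpoly x (Xi x w) = Polynomial.C (w 0) * rootPoly (fun j : Fin n => w j.succ) := by
  refine Polynomial.eq_of_degrees_lt_of_eval_index_eq (s := Finset.univ) (v := x) hx.injOn ?_ ?_ ?_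
  · refine (Polynomial.degree_le_of_natDegree_le (qpoly_natDegree x _)).trans_lt ?_
    simp only [Finset.card_univ, Fintype.card_fin]
    exact_mod_cast Nat.lt_succ_self n
  · refine (Polynomial.degree_le_of_natDegree_le ((Polynomial.natDegree_C_mul_le _ _).trans
      (rootPoly_natDegree _).le)).trans_lt ?_
    simp only [Finset.card_univ, Fintype.card_fin]
    exact_mod_cast Nat.lt_succ_self n
  · intro i _
    rw [qpoly_eval_node, Polynomial.eval_mul, Polynomial.eval_C, rootPoly_eval, Xi]
    exact div_mul_cancel₀ _ (DD_ne x hx i)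

theorem sum_Xi {n : ℕ} (x w : Fin (n + 1) → ℝ) (hx : Function.Injective x) :
    ∑ i, Xi x w i = w 0 := by
  rw [← qpoly_coeff x, qpoly_Xi x w hx, Polynomial.coeff_C_mul]
  have h2 := (rootPoly_monic (fun j : Fin n => w j.succ)).coeff_natDegree
  rw [rootPoly_natDegree] at h2
  rw [h2, mul_one]

theorem Xi_mem {n : ℕ} (x : Fin (n + 1) → ℝ) (hx : StrictMono x) (w) (hw : w ∈ Om x) :
    Xi x w ∈ Simp (n + 1) := by
  refine ⟨fun i => ?_, ?_⟩
  · rw [Xi, DD_eq, mul_div_assoc, ← Finset.prod_div_distrib]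
    refine mul_pos hw.1.1 (Finset.prod_pos fun j _ => ?_)
    have h := hw.2 j
    by_cases hj : j.castSucc < i
    · rw [Fin.succAbove_of_castSucc_lt _ _ hj]
      have h1 : x j.succ ≤ x i := hx.monotone (Fin.castSucc_lt_iff_succ_le.1 hj)
      apply div_pos <;> linarith
    · push Not at hj
      rw [Fin.succAbove_of_le_castSucc _ _ hj]
      have h1 : x i ≤ x j.castSucc := hx.monotone hj
      apply div_pos_of_neg_of_neg <;> linarith
  · rw [sum_Xi x w hx.injective]; exact hw.1.2

theorem DD_alt {n : ℕ} (x : Fin (n + 1) → ℝ) (hx : StrictMono x) (j : Fin n) :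
    DD x j.castSucc * DD x j.succ < 0 := by
  have hne : j.succ ≠ j.castSucc := (Fin.castSucc_lt_succ).ne'
  have hlt := hx (Fin.castSucc_lt_succ (i := j))
  rw [DD, DD, ← Finset.mul_prod_erase (Finset.univ.erase j.castSucc) _
      (Finset.mem_erase.2 ⟨hne, Finset.mem_univ _⟩),
    ← Finset.mul_prod_erase (Finset.univ.erase j.succ) _
      (Finset.mem_erase.2 ⟨hne.symm, Finset.mem_univ _⟩), Finset.erase_right_comm]
  set S := (Finset.univ.erase j.succ).erase j.castSucc with hS
  have h1 : 0 < (∏ k ∈ S, (x j.castSucc - x k)) * ∏ k ∈ S, (x j.succ - x k) := by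
    rw [← Finset.prod_mul_distrib]
    refine Finset.prod_pos fun k hk => ?_
    simp only [hS, Finset.mem_erase, Finset.mem_univ, and_true] at hk
    rcases lt_or_gt_of_ne hk.1 with h | h
    · have a1 := hx h
      exact mul_pos (by linarith) (by linarith)
    · have h' : j.succ < k := lt_of_le_of_ne (Fin.castSucc_lt_iff_succ_le.1 h) (Ne.symm hk.2)
      have a1 := hx h'
      exact mul_pos_of_neg_of_neg (by linarith) (by linarith)
  have : (x j.castSucc - x j.succ) * (x j.succ - x j.castSucc) < 0 :=
    mul_neg_of_neg_of_pos (by linarith) (by linarith)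
  calc _ = ((x j.castSucc - x j.succ) * (x j.succ - x j.castSucc)) *
        ((∏ k ∈ S, (x j.castSucc - x k)) * ∏ k ∈ S, (x j.succ - x k)) := by ring
    _ < 0 := mul_neg_of_neg_of_pos this h1

theorem exists_root_between (P : Polynomial ℝ) (a b : ℝ) (hab : a < b)
    (h : P.eval a * P.eval b < 0) : ∃ c, (a < c ∧ c < b) ∧ P.eval c = 0 := by
  have hc : ContinuousOn (fun t => P.eval t) (Set.Icc a b) := P.continuous.continuousOn
  rcases mul_neg_iff.1 h with h | h
  · obtain ⟨c, hc1, hc2⟩ := intermediate_value_Ioo' hab.le hc ⟨h.2, h.1⟩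
    exact ⟨c, hc1, hc2⟩
  · obtain ⟨c, hc1, hc2⟩ := intermediate_value_Ioo hab.le hc ⟨h.1, h.2⟩
    exact ⟨c, hc1, hc2⟩

theorem box_strictMono {n : ℕ} (x : Fin (n + 1) → ℝ) (hx : StrictMono x) (μ : Fin n → ℝ)
    (h : ∀ j, x j.castSucc < μ j ∧ μ j < x j.succ) : StrictMono μ := by
  intro i j hij
  have h1 : x i.succ ≤ x j.castSucc := hx.monotone (by
    rw [Fin.le_def]; simp only [Fin.val_succ, Fin.val_castSucc]; exact hij)
  linarith [(h i).2, (h j).1]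

theorem Xi_image {n : ℕ} (x : Fin (n + 1) → ℝ) (hx : StrictMono x) :
    Xi x '' Om x = Simp (n + 1) := by
  apply Set.Subset.antisymm
  · rintro _ ⟨w, hw, rfl⟩; exact Xi_mem x hx w hw
  · intro ξ hξ
    have hr : ∀ j : Fin n, ∃ c, (x j.castSucc < c ∧ c < x j.succ) ∧ (qpoly x ξ).eval c = 0 := by
      intro j
      apply exists_root_between _ _ _ (hx Fin.castSucc_lt_succ)
      rw [qpoly_eval_node, qpoly_eval_node]
      have h1 := DD_alt x hx j
      have h2 := mul_pos (hξ.1 j.castSucc) (hξ.1 j.succ)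
      calc _ = (ξ j.castSucc * ξ j.succ) * (DD x j.castSucc * DD x j.succ) := by ring
        _ < 0 := mul_neg_of_pos_of_neg h2 h1
    choose μ hμ hμ0 using hr
    have hmono := box_strictMono x hx μ hμ
    have hq : qpoly x ξ = Polynomial.C (∑ i, ξ i) * rootPoly μ := by
      rw [← sub_eq_zero]
      refine Polynomial.eq_zero_of_degree_lt_of_eval_index_eq_zero (v := μ) Finset.univ
        hmono.injective.injOn ?_ ?_
      · simp only [Finset.card_univ, Fintype.card_fin]
        rw [Polynomial.degree_lt_iff_coeff_zero]
        intro k hk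
        rcases hk.eq_or_lt with rfl | hk
        · have h2 := (rootPoly_monic μ).coeff_natDegree
          rw [rootPoly_natDegree] at h2
          rw [Polynomial.coeff_sub, qpoly_coeff, Polynomial.coeff_C_mul, h2]; ring
        · apply Polynomial.coeff_eq_zero_of_natDegree_lt
          refine lt_of_le_of_lt ?_ hk
          refine (Polynomial.natDegree_sub_le _ _).trans (max_le (qpoly_natDegree _ _) ?_)
          exact (Polynomial.natDegree_C_mul_le _ _).trans (rootPoly_natDegree _).le
      · intro j _
        rw [Polynomial.eval_sub, hμ0, Polynomial.eval_mul, rootPoly_eval,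
          Finset.prod_eq_zero (Finset.mem_univ j) (sub_self _)]
        simp
    refine ⟨Fin.cons (∑ i, ξ i) μ, ⟨⟨?_, ?_⟩, ?_⟩, ?_⟩
    · simp only [Fin.cons_zero]
      exact Finset.sum_pos (fun i _ => hξ.1 i) ⟨0, Finset.mem_univ _⟩
    · simp only [Fin.cons_zero]; exact hξ.2
    · simpa using hμ
    · ext i
      have h1 := qpoly_eval_node x ξ i
      rw [hq, Polynomial.eval_mul, Polynomial.eval_C, rootPoly_eval] at h1
      simp only [Xi, Fin.cons_zero, Fin.cons_succ]
      rw [h1, mul_div_assoc, div_self (DD_ne x hx.injective i), mul_one]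

theorem Xi_injOn {n : ℕ} (x : Fin (n + 1) → ℝ) (hx : StrictMono x) : Set.InjOn (Xi x) (Om x) := by
  intro w hw w' hw' h
  have h0 : w 0 = w' 0 := by rw [← sum_Xi x w hx.injective, h, sum_Xi x w' hx.injective]
  have hq : Polynomial.C (w 0) * rootPoly (fun j : Fin n => w j.succ) =
      Polynomial.C (w 0) * rootPoly (fun j : Fin n => w' j.succ) := by
    rw [← qpoly_Xi x w hx.injective, h, qpoly_Xi x w' hx.injective, h0]
  have hC : Polynomial.C (w 0) ≠ 0 := by
    rw [Ne, Polynomial.C_eq_zero]; exact hw.1.1.ne'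
  have hq2 := mul_left_cancel₀ hC hq
  ext i
  refine Fin.cases h0 (fun j => ?_) i
  have h1 := rootPoly_eval (fun j : Fin n => w j.succ) (w j.succ)
  rw [Finset.prod_eq_zero (Finset.mem_univ j) (sub_self _), hq2, rootPoly_eval,
    Finset.prod_eq_zero_iff] at h1
  obtain ⟨k, _, hk⟩ := h1
  have hk' : w j.succ = w' k.succ := by linarith
  have : j = k := by
    rcases lt_trichotomy j k with hjk | hjk | hjk
    · have h1 : x j.succ ≤ x k.castSucc := hx.monotone (by
        rw [Fin.le_def]; simp only [Fin.val_succ, Fin.val_castSucc]; exact hjk)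
      linarith [(hw.2 j).2, (hw'.2 k).1]
    · exact hjk
    · have h1 : x k.succ ≤ x j.castSucc := hx.monotone (by
        rw [Fin.le_def]; simp only [Fin.val_succ, Fin.val_castSucc]; exact hjk)
      linarith [(hw.2 j).1, (hw'.2 k).2]
  rw [hk', this]

/-- interlacing box -/
def Box {n : ℕ} (x : Fin (n + 1) → ℝ) : Set (Fin n → ℝ) :=
  Set.pi Set.univ fun j : Fin n => Set.Ioo (x j.castSucc) (x j.succ)

/-- row weights -/
def pv {n : ℕ} (i₀ : Fin n) (v : UG n) : Fin n → ℝ :=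
  fun i => ‖(v : Matrix (Fin n) (Fin n) ℂ) i₀ i‖ ^ 2

theorem continuous_pv {n : ℕ} (i₀ : Fin n) : Continuous (pv i₀) := by
  unfold pv
  refine continuous_pi fun i => ?_
  have : Continuous fun v : UG n => (v : Matrix (Fin n) (Fin n) ℂ) i₀ i :=
    (continuous_subtype_val.matrix_elem i₀ i)
  exact this.norm.pow 2

theorem pv_law {n : ℕ} (i₀ : Fin n) : (hU n).map (pv i₀) =
    (volume (Simp n))⁻¹ • (volume.restrict (Simp n)).map (fun ξ i => ξ i / ∑ j, ξ j) := by
  have hm : Measurable fun (ξ : Fin n → ℝ) (i : Fin n) => ξ i / ∑ j, ξ j := by fun_prop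
  ext s hs
  have h := simplex_law i₀ (s.indicator 1) (measurable_one.indicator hs)
  rw [Measure.map_apply (continuous_pv i₀).measurable hs, Measure.smul_apply,
    Measure.map_apply hm hs]
  have h1 : ∫⁻ v : UG n, s.indicator 1 (fun i => ‖(v : Matrix (Fin n) (Fin n) ℂ) i₀ i‖ ^ 2) ∂(hU n) =
      hU n (pv i₀ ⁻¹' s) := by
    rw [← lintegral_indicator_one ((continuous_pv i₀).measurable hs)]
    rfl
  have h2 : ∫⁻ ξ in Simp n, s.indicator 1 (fun i => ξ i / ∑ j, ξ j) =
      (volume.restrict (Simp n)) ((fun (ξ : Fin n → ℝ) (i : Fin n) => ξ i / ∑ j, ξ j) ⁻¹' s) := by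
    rw [← lintegral_indicator_one (hm hs)]
    rfl
  rw [h1, h2] at h
  rw [← h, smul_eq_mul, mul_comm, mul_assoc, ENNReal.mul_inv_cancel (vol_Simp_ne_zero n) (vol_Simp_ne_top n),
    mul_one]

theorem Om_eq {n : ℕ} (x : Fin (n + 1) → ℝ) : Om x =
    (MeasurableEquiv.piFinSuccAbove (fun _ : Fin (n + 1) => ℝ) 0) ⁻¹' (Set.Ioo 0 1 ×ˢ Box x) := by
  ext w
  simp [Om, Box, MeasurableEquiv.piFinSuccAbove, Fin.insertNthEquiv, Fin.tail]

theorem measurableSet_Box {n : ℕ} (x : Fin (n + 1) → ℝ) : MeasurableSet (Box x) :=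
  MeasurableSet.univ_pi fun _ => measurableSet_Ioo

theorem measurableSet_Om {n : ℕ} (x : Fin (n + 1) → ℝ) : MeasurableSet (Om x) := by
  rw [Om_eq]
  exact (MeasurableEquiv.measurable _) (measurableSet_Ioo.prod (measurableSet_Box x))

/-- normalisation constant of the corner law -/
def cC (n : ℕ) : ℝ := (volume (Simp (n + 1))).toReal⁻¹ * ∫ r in Set.Ioo (0:ℝ) 1, r ^ n

theorem corner_law {n : ℕ} (x : Fin (n + 1) → ℝ) (hx : StrictMono x) (F : (Fin n → ℝ) → ℂ)
    (hF : Measurable F) (hsym : ∀ (σ : Equiv.Perm (Fin n)) μ, F (μ ∘ σ) = F μ) :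
    (∫ v : UG (n + 1), F (eigs (blockLL n (n + 1) (Nat.le_succ n)
      ((v : Matrix (Fin (n+1)) (Fin (n+1)) ℂ) * realDiag x *
        (v : Matrix (Fin (n+1)) (Fin (n+1)) ℂ)ᴴ))) ∂(hU (n + 1))) * (VdmF x : ℂ) =
    (cC n : ℂ) * ∫ μ in Box x, (VdmF μ : ℂ) * F μ := by
  let val : (Fin (n + 1) → ℝ) → (Fin (n + 1) → ℝ) :=
    fun p k => ∑ i, p i * ∏ j ∈ Finset.univ.erase i, (((k : ℕ) : ℝ) - x j)
  have hval : Measurable val := by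
    refine measurable_pi_lambda _ fun k => ?_
    fun_prop
  let G : (Fin (n + 1) → ℝ) → ℂ := fun p => F (RR n (val p))
  have hG : Measurable G := hF.comp ((measurable_RR n).comp hval)
  have hGE : ∀ p μ, val p = EV n μ → G p = F μ := by
    intro p μ h
    obtain ⟨σ, hσ⟩ := RR_EV n μ
    simp only [G, h, hσ, hsym]
  have h1 : ∀ v : UG (n + 1), F (eigs (blockLL n (n + 1) (Nat.le_succ n)
      ((v : Matrix (Fin (n+1)) (Fin (n+1)) ℂ) * realDiag x *
        (v : Matrix (Fin (n+1)) (Fin (n+1)) ℂ)ᴴ))) = G (pv (Fin.last n) v) := by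
    intro v
    refine (hGE _ _ ?_).symm
    ext k
    have h2 := corner_det v x ((k : ℕ) : ℝ)
    rw [← eigs_det _ (isHermitian_block _ _ _ _ (isHermitian_conj _ _ (isHermitian_realDiag x)))] at h2
    exact (Complex.ofReal_injective h2).symm
  have hm : Measurable fun (ξ : Fin (n + 1) → ℝ) (i : Fin (n + 1)) => ξ i / ∑ j, ξ j := by fun_prop
  simp_rw [h1]
  rw [← integral_map (continuous_pv _).measurable.aemeasurable hG.aestronglyMeasurable, pv_law,
    integral_smul_measure, integral_map hm.aemeasurable hG.aestronglyMeasurable,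
    ← Xi_image x hx, integral_image_eq_integral_abs_det_fderiv_smul volume (measurableSet_Om x)
      (fun w _ => (hasFDerivAt_Xi x w).hasFDerivWithinAt) (Xi_injOn x hx)]
  have h2 : ∀ w ∈ Om x, |(LinearMap.toContinuousLinearMap (Matrix.toLin' (XiJ x w))).det| •
      G (fun i => Xi x w i / ∑ j, Xi x w j) =
      (VdmF x : ℂ)⁻¹ * (((w 0 : ℝ) : ℂ) ^ n * ((VdmF (fun j : Fin n => w j.succ) : ℂ) * F (fun j : Fin n => w j.succ))) := by
    intro w hw
    have hsm := box_strictMono x hx _ hw.2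
    have e1 : (LinearMap.toContinuousLinearMap (Matrix.toLin' (XiJ x w))).det = (XiJ x w).det := by
      rw [LinearMap.det_toContinuousLinearMap, LinearMap.det_toLin']
    rw [e1, det_XiJ x w hx.injective hsm.injective, abs_of_pos hw.1.1, abs_of_pos (VdmF_pos _ hsm),
      abs_of_pos (VdmF_pos x hx)]
    have e2 : G (fun i => Xi x w i / ∑ j, Xi x w j) = F (fun j : Fin n => w j.succ) := by
      apply hGE
      ext k
      simp only [val, EV]
      rw [sum_Xi x w hx.injective]
      have e3 := qpoly_eval x (Xi x w) ((k : ℕ) : ℝ)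
      rw [qpoly_Xi x w hx.injective, Polynomial.eval_mul, Polynomial.eval_C, rootPoly_eval] at e3
      have hw0 : w 0 ≠ 0 := hw.1.1.ne'
      rw [← mul_right_inj' hw0, e3, Finset.mul_sum]
      refine Finset.sum_congr rfl fun i _ => ?_
      field_simp
    rw [e2, Complex.real_smul]
    push_cast
    ring
  rw [setIntegral_congr_fun (measurableSet_Om x) h2, integral_const_mul]
  have h3 : ∫ w in Om x, (((w 0 : ℝ) : ℂ) ^ n * ((VdmF (fun j : Fin n => w j.succ) : ℂ) * F (fun j : Fin n => w j.succ)))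
      = (∫ r in Set.Ioo (0:ℝ) 1, ((r : ℂ)) ^ n) * ∫ μ in Box x, (VdmF μ : ℂ) * F μ := by
    rw [← setIntegral_prod_mul, ← Measure.volume_eq_prod, Om_eq]
    rw [← (volume_preserving_piFinSuccAbove (fun _ : Fin (n + 1) => ℝ) 0).setIntegral_preimage_emb
      (MeasurableEquiv.measurableEmbedding _)]
    rfl
  have hV : (VdmF x : ℂ) ≠ 0 := by exact_mod_cast (VdmF_pos x hx).ne'
  have h4 : (∫ r in Set.Ioo (0:ℝ) 1, ((r : ℂ)) ^ n) = ((∫ r in Set.Ioo (0:ℝ) 1, r ^ n : ℝ) : ℂ) := by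
    rw [← integral_complex_ofReal]; simp
  rw [h3, h4, cC, Xi_image x hx, ENNReal.toReal_inv, Complex.real_smul]
  push_cast
  field_simp

/-- exponents attached to a power function -/
def hN : (n : ℕ) → (Fin n → ℕ) → (Fin n → ℕ)
  | 0, _ => fun i => i.elim0
  | n + 1, N => fun i =>
    (Fin.cons 0 (fun j => hN n (fun j => N j.castSucc) j + 1) : Fin (n + 1) → ℕ) i + N (Fin.last n)

theorem fN_succ {n : ℕ} (N : Fin (n + 1) → ℕ) (M : Matrix (Fin (n + 1)) (Fin (n + 1)) ℂ) :
    fN N M = M.det ^ N (Fin.last n) *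
      fN (fun j => N j.castSucc) (blockLL n (n + 1) (Nat.le_succ n) M) := by
  rw [fN_block, fN, fN, Fin.prod_univ_castSucc, Fin.prod_univ_castSucc]
  have h1 : (lead M (Fin.last n)).det = M.det := by
    let e : {i : Fin (n + 1) // i ≤ Fin.last n} ≃ Fin (n + 1) := Equiv.subtypeUnivEquiv fun i => Fin.le_last i
    exact Matrix.det_submatrix_equiv_self e M
  have h2 : ∀ j : Fin n, extN n (n + 1) (fun j => N j.castSucc) j.castSucc = N j.castSucc := by
    intro j; simp [extN]
  have h3 : extN n (n + 1) (fun j => N j.castSucc) (Fin.last n) = 0 := by simp [extN]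
  simp only [h1, h2, h3, pow_zero, mul_one]
  ring

theorem phi_succ {n : ℕ} (N : Fin (n + 1) → ℕ) (x : Fin (n + 1) → ℝ) :
    phi N (realDiag x) = ((∏ i, x i : ℝ) : ℂ) ^ N (Fin.last n) *
      ∫ v : UG (n + 1), phi (fun j => N j.castSucc) (blockLL n (n + 1) (Nat.le_succ n)
      ((v : Matrix (Fin (n+1)) (Fin (n+1)) ℂ) * realDiag x *
        (v : Matrix (Fin (n+1)) (Fin (n+1)) ℂ)ᴴ)) ∂(hU (n + 1)) := by
  have h := phi_product n (n + 1) (Nat.le_succ n) (fun j => N j.castSucc) 1 (realDiag x)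
  simp only [one_mul, Matrix.conjTranspose_one, mul_one, phi_one] at h
  rw [h]
  have hd : ∀ v : UG (n + 1), ((v : Matrix (Fin (n+1)) (Fin (n+1)) ℂ) * realDiag x *
        (v : Matrix (Fin (n+1)) (Fin (n+1)) ℂ)ᴴ).det = ((∏ i, x i : ℝ) : ℂ) := by
    intro v
    have hv : (v : Matrix (Fin (n+1)) (Fin (n+1)) ℂ) * (v : Matrix (Fin (n+1)) (Fin (n+1)) ℂ)ᴴ = 1 :=
      Matrix.mem_unitaryGroup_iff.1 v.2
    have hv' := congrArg Matrix.det hv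
    rw [det_mul, det_one] at hv'
    rw [det_mul, det_mul, mul_right_comm, hv', one_mul, realDiag, det_diagonal]
    simp
  unfold phi
  rw [← integral_const_mul]
  refine integral_congr_ae (Eventually.of_forall fun v => ?_)
  simp only
  rw [fN_succ N, hd, fN_block]

theorem continuous_realDiag {n : ℕ} : Continuous (realDiag (n := n)) := by
  unfold realDiag
  exact Continuous.matrix_diagonal (continuous_pi fun i => Complex.continuous_ofReal.comp (continuous_apply i))

theorem continuous_phi {n : ℕ} (N : Fin n → ℕ) : Continuous fun x : Fin n → ℝ => phi N (realDiag x) := by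
  have h := continuous_parametric_integral_of_continuous (X := Fin n → ℝ) (μ := hU n) (f := fun x v => fN N
    ((v : Matrix (Fin n) (Fin n) ℂ) * realDiag x * (v : Matrix (Fin n) (Fin n) ℂ)ᴴ)) ?_
    (s := Set.univ) isCompact_univ
  · simpa [phi] using h
  · have h2 : Continuous fun p : (Fin n → ℝ) × UG n => (p.2 : Matrix (Fin n) (Fin n) ℂ) :=
      continuous_subtype_val.comp continuous_snd
    exact (continuous_fN N).comp ((h2.mul (continuous_realDiag.comp continuous_fst)).mul
      h2.matrix_conjTranspose)

/-- integration of a determinant with one function per row, one measure per column -/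
theorem integral_det {n : ℕ} (ν : Fin n → Measure ℝ) [∀ i, SigmaFinite (ν i)] (f : Fin n → ℝ → ℝ)
    (hf : ∀ i j, Integrable (f i) (ν j)) :
    ∫ μ, (Matrix.of fun i j => f i (μ j)).det ∂(Measure.pi ν) =
      (Matrix.of fun i j => ∫ t, f i t ∂(ν j)).det := by
  simp_rw [Matrix.det_apply, Matrix.of_apply]
  rw [integral_finsetSum]
  · refine Finset.sum_congr rfl fun σ _ => ?_
    simp_rw [Units.smul_def, zsmul_eq_mul]
    rw [integral_const_mul, integral_fintype_prod_eq_prod (f := fun i => f (σ i))]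
  · intro σ _
    simp_rw [Units.smul_def, zsmul_eq_mul]
    exact (Integrable.fintype_prod (f := fun i => f (σ i)) (fun i => hf (σ i) i)).const_mul _

theorem det_diff {n : ℕ} (x : Fin (n + 1) → ℝ) (h : Fin n → ℕ) :
    (Matrix.of fun i j : Fin n => x j.succ ^ (h i + 1) - x j.castSucc ^ (h i + 1)).det =
    (Matrix.of fun i j : Fin (n + 1) => x j ^ (Fin.cons 0 (fun j => h j + 1) : Fin (n + 1) → ℕ) i).det := by
  let B : Matrix (Fin (n + 1)) (Fin (n + 1)) ℝ := Matrix.of fun i j =>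
    (Fin.cons (x 0 ^ (Fin.cons 0 (fun j => h j + 1) : Fin (n + 1) → ℕ) i)
      (fun j => x j.succ ^ (Fin.cons 0 (fun j => h j + 1) : Fin (n + 1) → ℕ) i -
        x j.castSucc ^ (Fin.cons 0 (fun j => h j + 1) : Fin (n + 1) → ℕ) i) : Fin (n + 1) → ℝ) j
  rw [Matrix.det_eq_of_forall_col_eq_smul_add_pred (B := B) (fun _ => 1)]
  · rw [Matrix.det_succ_row_zero, Fin.sum_univ_succ, Finset.sum_eq_zero]
    · simp only [B, Matrix.of_apply, Fin.cons_zero, Fin.val_zero, pow_zero, one_mul, add_zero]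
      congr 1
    · intro j _
      simp [B]
  · intro i; simp [B]
  · intro i j; simp [B]

theorem box_integral {n : ℕ} (x : Fin (n + 1) → ℝ) (hx : StrictMono x) (h : Fin n → ℕ) :
    ∫ μ in Box x, (Matrix.of fun i j => μ j ^ h i).det =
    (∏ i, ((h i : ℝ) + 1))⁻¹ * (Matrix.of fun i j : Fin (n + 1) =>
      x j ^ (Fin.cons 0 (fun j => h j + 1) : Fin (n + 1) → ℕ) i).det := by
  rw [Box, volume_pi, Measure.restrict_pi_pi, integral_det _ (fun i t => t ^ h i)]
  · rw [← det_diff, ← Finset.prod_inv_distrib, ← Matrix.det_mul_column]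
    congr 1
    ext i j
    have hle := (hx (Fin.castSucc_lt_succ (i := j))).le
    simp only [Matrix.of_apply]
    rw [← integral_Ioc_eq_integral_Ioo, ← intervalIntegral.integral_of_le hle, integral_pow]
    ring
  · intro i j
    exact ((continuous_pow (h i)).integrableOn_Icc).mono_set Set.Ioo_subset_Icc_self

theorem VdmF_cons {n : ℕ} (h : Fin n → ℕ) (k : ℕ) :
    VdmF (fun i : Fin (n + 1) => (((Fin.cons 0 (fun j => h j + 1) : Fin (n + 1) → ℕ) i + k : ℕ) : ℝ)) =
    (∏ i, ((h i : ℝ) + 1)) * VdmF (fun i => (h i : ℝ)) := by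
  rw [VdmF_eq_det, VdmF_eq_det, Matrix.det_vandermonde, Matrix.det_vandermonde, Fin.prod_univ_succ]
  congr 1
  · rw [Fin.prod_Ioi_zero]; simp
  · refine Finset.prod_congr rfl fun i _ => ?_
    rw [Fin.prod_Ioi_succ]
    simp

/-- determinant of powers -/
def PD {n : ℕ} (h : Fin n → ℕ) (x : Fin n → ℝ) : ℝ := (Matrix.of fun i j => x j ^ h i).det

theorem phi_schur_mono : ∀ (n : ℕ) (N : Fin n → ℕ), ∃ c : ℝ,
    c * VdmF (fun i => (hN n N i : ℝ)) = ∏ k ∈ Finset.range n, cC k ∧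
    ∀ x : Fin n → ℝ, StrictMono x → phi N (realDiag x) * (VdmF x : ℂ) = ((c * PD (hN n N) x : ℝ) : ℂ) := by
  intro n
  induction n with
  | zero =>
    intro N
    refine ⟨1, by simp [VdmF], fun x _ => ?_⟩
    have h1 : realDiag x = 1 := Subsingleton.elim _ _
    rw [h1, phi_one]
    simp [VdmF, PD]
  | succ n ih =>
    intro N
    obtain ⟨c, hc1, hc2⟩ := ih (fun j => N j.castSucc)
    set h := hN n (fun j => N j.castSucc) with hh
    have hpos : (∏ i, ((h i : ℝ) + 1)) ≠ 0 := by
      rw [Finset.prod_ne_zero_iff]; intro i _; positivity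
    have hNs : hN (n + 1) N = fun i => (Fin.cons 0 (fun j => h j + 1) : Fin (n + 1) → ℕ) i + N (Fin.last n) := rfl
    refine ⟨c * cC n * (∏ i, ((h i : ℝ) + 1))⁻¹, ?_, fun x hx => ?_⟩
    · rw [hNs, VdmF_cons, Finset.prod_range_succ, ← hc1]
      field_simp
    · rw [phi_succ, mul_assoc]
      have h1 : ∀ v : UG (n + 1), phi (fun j => N j.castSucc) (blockLL n (n + 1) (Nat.le_succ n)
          ((v : Matrix (Fin (n+1)) (Fin (n+1)) ℂ) * realDiag x *
          (v : Matrix (Fin (n+1)) (Fin (n+1)) ℂ)ᴴ)) = phi (fun j => N j.castSucc) (realDiag (eigs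
          (blockLL n (n + 1) (Nat.le_succ n) ((v : Matrix (Fin (n+1)) (Fin (n+1)) ℂ) * realDiag x *
          (v : Matrix (Fin (n+1)) (Fin (n+1)) ℂ)ᴴ)))) := fun v =>
        phi_eigs _ _ (isHermitian_block _ _ _ _ (isHermitian_conj _ _ (isHermitian_realDiag x)))
      simp_rw [h1]
      rw [corner_law x hx (fun μ => phi (fun j => N j.castSucc) (realDiag μ)) (continuous_phi _).measurable
        (fun σ μ => phi_perm _ μ σ)]
      have h2 : ∀ μ ∈ Box x, (VdmF μ : ℂ) * phi (fun j => N j.castSucc) (realDiag μ) =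
          ((c * PD h μ : ℝ) : ℂ) := by
        intro μ hμ
        rw [mul_comm]
        exact hc2 μ (box_strictMono x hx μ fun j => hμ j (Set.mem_univ j))
      rw [setIntegral_congr_fun (measurableSet_Box x) h2, integral_complex_ofReal, integral_const_mul]
      unfold PD
      rw [box_integral x hx, hNs]
      have h3 : (Matrix.of fun i j : Fin (n + 1) => x j ^ ((Fin.cons 0 (fun j => h j + 1) : Fin (n + 1) → ℕ) i
          + N (Fin.last n))).det = (∏ i, x i) ^ N (Fin.last n) * (Matrix.of fun i j : Fin (n + 1) =>
          x j ^ (Fin.cons 0 (fun j => h j + 1) : Fin (n + 1) → ℕ) i).det := by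
        rw [← Finset.prod_pow, ← Matrix.det_mul_row]
        congr 1
        ext i j
        simp [pow_add, mul_comm]
      rw [h3]
      push_cast
      ring

theorem VdmF_perm {n : ℕ} (x : Fin n → ℝ) (σ : Equiv.Perm (Fin n)) :
    VdmF (x ∘ σ) = (Equiv.Perm.sign σ : ℤ) * VdmF x := by
  rw [VdmF_eq_det, VdmF_eq_det, ← Matrix.det_permute]
  congr 1

theorem PD_perm {n : ℕ} (h : Fin n → ℕ) (x : Fin n → ℝ) (σ : Equiv.Perm (Fin n)) :
    PD h (x ∘ σ) = (Equiv.Perm.sign σ : ℤ) * PD h x := by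
  unfold PD
  rw [← Matrix.det_permute']
  congr 1

theorem phi_schur (n : ℕ) (N : Fin n → ℕ) : ∃ c : ℝ,
    c * VdmF (fun i => (hN n N i : ℝ)) = ∏ k ∈ Finset.range n, cC k ∧
    ∀ x : Fin n → ℝ, phi N (realDiag x) * (VdmF x : ℂ) = ((c * PD (hN n N) x : ℝ) : ℂ) := by
  obtain ⟨c, hc1, hc2⟩ := phi_schur_mono n N
  refine ⟨c, hc1, fun x => ?_⟩
  by_cases hx : Function.Injective x
  · have hm : StrictMono (x ∘ Tuple.sort x) :=
      (Tuple.monotone_sort x).strictMono_of_injective (hx.comp (Tuple.sort x).injective)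
    have h := hc2 _ hm
    rw [phi_perm, VdmF_perm, PD_perm] at h
    have hs : ((Equiv.Perm.sign (Tuple.sort x) : ℤ) : ℂ) ≠ 0 := by
      rcases Int.units_eq_one_or (Equiv.Perm.sign (Tuple.sort x)) with h | h <;> simp [h]
    apply mul_left_cancel₀ hs
    push_cast at h ⊢
    linear_combination h
  · have h1 : VdmF x = 0 := by
      rw [VdmF_eq_det]
      by_contra h
      exact hx (Matrix.det_vandermonde_ne_zero_iff.1 h)
    have h2 : PD (hN n N) x = 0 := by
      rw [Function.Injective] at hx
      push Not at hx
      obtain ⟨i, j, hij, hne⟩ := hx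
      exact Matrix.det_zero_of_column_eq hne fun k => by simp [hij]
    rw [h1, h2]; simp

theorem hN_zero : ∀ (n : ℕ) (i : Fin n), hN n (fun _ => 0) i = i := by
  intro n
  induction n with
  | zero => intro i; exact i.elim0
  | succ n ih =>
    intro i
    refine Fin.cases ?_ (fun j => ?_) i
    · simp [hN]
    · simp [hN, ih]

theorem VdmF_id_pos (n : ℕ) : 0 < VdmF (fun i : Fin n => ((i : ℕ) : ℝ)) :=
  VdmF_pos _ fun i j h => by simpa using h

theorem cC_prod (n : ℕ) : ∏ k ∈ Finset.range n, cC k = VdmF (fun i : Fin n => ((i : ℕ) : ℝ)) := by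
  obtain ⟨c, h1, h2⟩ := phi_schur n (fun _ => 0)
  simp only [hN_zero] at h1
  have h3 := h2 (fun i : Fin n => ((i : ℕ) : ℝ))
  have h4 : ∀ M : Matrix (Fin n) (Fin n) ℂ, phi (fun _ => 0) M = 1 := by
    intro M; simp [phi, fN]
  have h5 : PD (hN n (fun _ => 0)) (fun i : Fin n => ((i : ℕ) : ℝ)) =
      VdmF (fun i : Fin n => ((i : ℕ) : ℝ)) := by
    rw [VdmF_eq_det, PD, ← Matrix.det_transpose]
    congr 1
    ext i j
    simp [hN_zero, Matrix.vandermonde_apply]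
  rw [h4, h5, one_mul] at h3
  have h6 : c = 1 := by
    have := Complex.ofReal_injective h3
    have hp := VdmF_id_pos n
    have h7 : (c - 1) * VdmF (fun i : Fin n => ((i : ℕ) : ℝ)) = 0 := by rw [sub_mul, ← this]; ring
    rcases mul_eq_zero.1 h7 with h | h
    · linarith
    · exact absurd h hp.ne'
  rw [← h1, h6, one_mul]

theorem hN_surj : ∀ (n : ℕ) (h : Fin n → ℕ), StrictMono h → ∃ N, hN n N = h := by
  intro n
  induction n with
  | zero => intro h _; exact ⟨fun _ => 0, Subsingleton.elim _ _⟩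
  | succ n ih =>
    intro h hh
    have hlt : ∀ j : Fin n, h 0 + 1 ≤ h j.succ := fun j => hh (Fin.succ_pos j)
    obtain ⟨N, hN'⟩ := ih (fun j => h j.succ - h 0 - 1) (by
      intro i j hij
      have h1 := hlt i
      have h2 := hh (Fin.succ_lt_succ_iff.2 hij)
      simp only
      omega)
    refine ⟨Fin.snoc N (h 0), ?_⟩
    have e : (fun j : Fin n => (Fin.snoc N (h 0) : Fin (n + 1) → ℕ) j.castSucc) = N := by
      ext j; simp
    ext i
    simp only [hN]
    rw [e, hN', Fin.snoc_last]
    refine Fin.cases ?_ (fun j => ?_) i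
    · simp
    · have := hlt j
      simp only [Fin.cons_succ]; omega

theorem hN_extN (l : ℕ) (N : Fin l → ℕ) : ∀ (d m : ℕ) (hm : m = d + l) (i : Fin m),
    hN m (extN l m N) i = if h : (i : ℕ) < d then (i : ℕ) else
      hN l N ⟨(i : ℕ) - d, by have := i.isLt; omega⟩ + d := by
  intro d
  induction d with
  | zero =>
    intro m hm i
    have : m = l := by omega
    subst this
    have e : extN m m N = N := by ext j; simp [extN]
    simp [e]
  | succ d ih =>
    intro m hm i
    obtain ⟨n, rfl⟩ : ∃ n, m = n + 1 := ⟨d + l, by omega⟩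
    have hn : n = d + l := by omega
    have e1 : (fun j : Fin n => extN l (n + 1) N j.castSucc) = extN l n N := by
      ext j; simp [extN]
    have e2 : extN l (n + 1) N (Fin.last n) = 0 := by
      simp [extN]; omega
    simp only [hN, e1, e2]
    refine Fin.cases ?_ (fun j => ?_) i
    · simp
    · simp only [Fin.cons_succ, ih n hn j, Fin.val_succ]
      split_ifs with h1 h2 h2
      · omega
      · omega
      · omega
      · have e3 : (⟨(j : ℕ) - d, by have := j.isLt; omega⟩ : Fin l) = ⟨(j : ℕ) + 1 - (d + 1), by have := j.isLt; omega⟩ := by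
          ext; simp
        rw [e3]; omega

/-- shifted exponents -/
def hExt (l m : ℕ) (hlm : l < m) (h : Fin l → ℕ) : Fin m → ℕ := fun i =>
  if hi : (i : ℕ) < m - l then (i : ℕ) else h ⟨(i : ℕ) - (m - l), by have := i.isLt; omega⟩ + (m - l)

theorem continuous_phi_mat {n : ℕ} (N : Fin n → ℕ) : Continuous (phi N) := by
  have i1 : LocallyCompactSpace (Matrix (Fin n) (Fin n) ℂ) :=
    inferInstanceAs (LocallyCompactSpace (Fin n → Fin n → ℂ))
  have i2 : FirstCountableTopology (Matrix (Fin n) (Fin n) ℂ) :=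
    inferInstanceAs (FirstCountableTopology (Fin n → Fin n → ℂ))
  have h := continuous_parametric_integral_of_continuous (X := Matrix (Fin n) (Fin n) ℂ) (μ := hU n) (f := fun x v => fN N
    ((v : Matrix (Fin n) (Fin n) ℂ) * x * (v : Matrix (Fin n) (Fin n) ℂ)ᴴ)) ?_
    (s := Set.univ) isCompact_univ
  · simp only [Measure.restrict_univ] at h; exact h
  · have h2 : Continuous fun p : (Matrix (Fin n) (Fin n) ℂ) × UG n => (p.2 : Matrix (Fin n) (Fin n) ℂ) :=
      continuous_subtype_val.comp continuous_snd
    exact (continuous_fN N).comp ((h2.mul continuous_fst).mul h2.matrix_conjTranspose)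

/-- the matrix `G` -/
def GG (l m : ℕ) (hlm : l < m) (a : Fin m → ℝ) (x : Fin l → ℝ) (v : Matrix (Fin m) (Fin m) ℂ) :
    Matrix (Fin l) (Fin l) ℂ :=
  sqrtDiag x * blockLL l m hlm.le (v * realDiag a * vᴴ) * sqrtDiag x

theorem sqrtDiag_H {l : ℕ} (x : Fin l → ℝ) : (sqrtDiag x)ᴴ = sqrtDiag x := by
  unfold sqrtDiag
  rw [Matrix.diagonal_conjTranspose]
  congr 1
  ext i
  simp

theorem sqrtDiag_sq {l : ℕ} (x : Fin l → ℝ) (hx : ∀ i, 0 ≤ x i) : sqrtDiag x * sqrtDiag x = realDiag x := by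
  unfold sqrtDiag realDiag
  rw [Matrix.diagonal_mul_diagonal]
  congr 1
  ext i
  rw [← Complex.ofReal_mul, Real.mul_self_sqrt (hx i)]

theorem GG_herm (l m : ℕ) (hlm : l < m) (a : Fin m → ℝ) (x : Fin l → ℝ) (v : Matrix (Fin m) (Fin m) ℂ) :
    (GG l m hlm a x v).IsHermitian := by
  have h := isHermitian_conj (sqrtDiag x) _ (isHermitian_block l m hlm.le _ (isHermitian_conj v _ (isHermitian_realDiag a)))
  rw [sqrtDiag_H] at h
  exact h

theorem continuous_sqrtDiag {n : ℕ} : Continuous (sqrtDiag (n := n)) := by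
  unfold sqrtDiag
  exact Continuous.matrix_diagonal (continuous_pi fun i => Complex.continuous_ofReal.comp
    (Real.continuous_sqrt.comp (continuous_apply i)))

theorem continuous_GG (l m : ℕ) (hlm : l < m) (a : Fin m → ℝ) :
    Continuous fun p : (Fin l → ℝ) × Matrix (Fin m) (Fin m) ℂ => GG l m hlm a p.1 p.2 := by
  unfold GG
  have h1 : Continuous fun p : (Fin l → ℝ) × Matrix (Fin m) (Fin m) ℂ => sqrtDiag p.1 :=
    continuous_sqrtDiag.comp continuous_fst
  have h2 : Continuous fun p : (Fin l → ℝ) × Matrix (Fin m) (Fin m) ℂ => p.2 * realDiag a * p.2ᴴ :=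
    (continuous_snd.mul continuous_const).mul (Continuous.matrix_conjTranspose continuous_snd)
  exact (h1.mul ((continuous_blockLL l m hlm.le).comp h2)).mul h1

theorem continuous_GG_v (l m : ℕ) (hlm : l < m) (a : Fin m → ℝ) (x : Fin l → ℝ) :
    Continuous fun v : UG m => GG l m hlm a x (v : Matrix (Fin m) (Fin m) ℂ) := by
  unfold GG
  exact (continuous_const.mul ((continuous_blockLL l m hlm.le).comp (cont_conjU (realDiag a)))).mul
    continuous_const

theorem schur_avg (l m : ℕ) (hlm : l < m) (h : Fin l → ℕ) (hh : StrictMono h) :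
    ∃ S : (Fin l → ℝ) → ℝ, Continuous S ∧ (∀ (σ : Equiv.Perm (Fin l)) y, S (y ∘ σ) = S y) ∧
      (∀ y, S y * VdmF y = PD h y) ∧
      ∀ (a : Fin m → ℝ) (x : Fin l → ℝ), Function.Injective a → (∀ i, 0 ≤ x i) →
      (∫ v : UG m, S (eigs (GG l m hlm a x (v : Matrix (Fin m) (Fin m) ℂ))) ∂(hU m)) * VdmF a *
        VdmF (fun i => (hExt l m hlm h i : ℝ)) =
      S x * VdmF (fun i : Fin m => ((i : ℕ) : ℝ)) * PD (hExt l m hlm h) a := by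
  obtain ⟨N, rfl⟩ := hN_surj l h hh
  obtain ⟨c, h1, h2⟩ := phi_schur l N
  obtain ⟨c', h1', h2'⟩ := phi_schur m (extN l m N)
  rw [cC_prod] at h1 h1'
  have hE : hN m (extN l m N) = hExt l m hlm (hN l N) := by
    ext i
    rw [hN_extN l N (m - l) m (by omega) i, hExt]
  rw [hE] at h1' h2'
  have hc : c ≠ 0 := by
    rintro rfl
    have := VdmF_id_pos l
    rw [← h1] at this; simp at this
  refine ⟨fun y => c⁻¹ * (phi N (realDiag y)).re, ?_, ?_, ?_, ?_⟩
  · exact continuous_const.mul (Complex.continuous_re.comp (continuous_phi N))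
  · intro σ y
    simp only [phi_perm]
  · intro y
    have h3 := congrArg Complex.re (h2 y)
    rw [Complex.re_mul_ofReal, Complex.ofReal_re] at h3
    rw [mul_assoc, h3]
    field_simp
  · intro a x ha hx
    have h3 := phi_product l m hlm.le N (sqrtDiag x) (realDiag a)
    rw [sqrtDiag_H, sqrtDiag_sq x hx] at h3
    have hVa : VdmF a ≠ 0 := by
      rw [VdmF_eq_det, Matrix.det_vandermonde_ne_zero_iff]
      exact ha
    have hVa' : (VdmF a : ℂ) ≠ 0 := by exact_mod_cast hVa
    have h4 := h2' a
    have h5 : phi (extN l m N) (realDiag a) = ((c' * PD (hExt l m hlm (hN l N)) a / VdmF a : ℝ) : ℂ) := by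
      rw [Complex.ofReal_div, eq_div_iff hVa']; exact h4
    rw [h5] at h3
    have hIntg : Integrable (fun v : UG m => phi N (GG l m hlm a x (v : Matrix (Fin m) (Fin m) ℂ))) (hU m) := by
      have hcont : Continuous fun v : UG m => GG l m hlm a x (v : Matrix (Fin m) (Fin m) ℂ) :=
        continuous_GG_v l m hlm a x
      exact integrable_UG ((continuous_phi_mat N).comp hcont)
    have h6 : ∫ v : UG m, (phi N (realDiag (eigs (GG l m hlm a x (v : Matrix (Fin m) (Fin m) ℂ))))).re ∂(hU m)
        = (phi N (realDiag x)).re * (c' * PD (hExt l m hlm (hN l N)) a / VdmF a) := by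
      have h7 : ∀ v : UG m, (phi N (realDiag (eigs (GG l m hlm a x (v : Matrix (Fin m) (Fin m) ℂ))))).re =
          RCLike.re (phi N (GG l m hlm a x (v : Matrix (Fin m) (Fin m) ℂ))) := by
        intro v
        rw [← phi_eigs N _ (GG_herm _ _ _ _ _ _)]; rfl
      simp_rw [h7]
      rw [integral_re hIntg, ← Complex.re_mul_ofReal, ← h3]
      rfl
    rw [integral_const_mul, h6, ← h1']
    field_simp

/-- block matrix with fixed rows followed by variable rows -/
def BB (l m : ℕ) (hlm : l ≤ m) (A : Fin m → Fin m → ℝ) (R : Fin l → Fin m → ℝ) :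
    Matrix (Fin m) (Fin m) ℝ := Matrix.of fun b c =>
  if hb : (b : ℕ) < m - l then A b c else R ⟨(b : ℕ) - (m - l), by have := b.isLt; omega⟩ c

/-- splitting of rows -/
def e2 (l m : ℕ) (hlm : l ≤ m) : Fin (m - l) ⊕ Fin l ≃ Fin m :=
  finSumFinEquiv.trans (finCongr (by omega))

theorem BB_inl (l m : ℕ) (hlm : l ≤ m) (A R) (b : Fin (m - l)) (c : Fin m) :
    BB l m hlm A R (e2 l m hlm (Sum.inl b)) c = A (e2 l m hlm (Sum.inl b)) c := by
  simp [BB, e2]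

theorem BB_inr (l m : ℕ) (hlm : l ≤ m) (A R) (d : Fin l) (c : Fin m) :
    BB l m hlm A R (e2 l m hlm (Sum.inr d)) c = R d c := by
  simp [BB, e2]

theorem BB_perm (l m : ℕ) (hlm : l ≤ m) (A R) (σ : Equiv.Perm (Fin l)) :
    (BB l m hlm A (R ∘ σ)).det = (Equiv.Perm.sign σ : ℤ) * (BB l m hlm A R).det := by
  let τ : Equiv.Perm (Fin m) := (e2 l m hlm).permCongr (Equiv.Perm.sumCongr 1 σ)
  have hs : Equiv.Perm.sign τ = Equiv.Perm.sign σ := by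
    simp [τ, Equiv.Perm.sign_permCongr, Equiv.Perm.sign_sumCongr]
  rw [← hs, ← Matrix.det_permute]
  congr 1
  ext b c
  obtain ⟨s, rfl⟩ := (e2 l m hlm).surjective b
  rw [Matrix.submatrix_apply]
  rcases s with b | d
  · have : τ (e2 l m hlm (Sum.inl b)) = e2 l m hlm (Sum.inl b) := by simp [τ, Equiv.permCongr_apply]
    rw [this, BB_inl]; exact (BB_inl _ _ _ _ _ _ _).symm
  · have : τ (e2 l m hlm (Sum.inr d)) = e2 l m hlm (Sum.inr (σ d)) := by simp [τ, Equiv.permCongr_apply]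
    rw [this, BB_inr]; exact (BB_inr l m hlm A R (σ d) c).symm

theorem BB_det (l m : ℕ) (hlm : l ≤ m) (A R) : (BB l m hlm A R).det =
    ∑ σ : Equiv.Perm (Fin m), ((Equiv.Perm.sign σ : ℤ) : ℝ) *
      (∏ b, A (e2 l m hlm (Sum.inl b)) (σ (e2 l m hlm (Sum.inl b)))) *
        ∏ d, R d (σ (e2 l m hlm (Sum.inr d))) := by
  rw [← Matrix.det_transpose, Matrix.det_apply']
  refine Finset.sum_congr rfl fun σ _ => ?_
  rw [← Equiv.prod_comp (e2 l m hlm), Fintype.prod_sum_type, mul_assoc]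
  congr 2
  · refine Finset.prod_congr rfl fun b _ => ?_
    rw [Matrix.transpose_apply, BB_inl]
  · refine Finset.prod_congr rfl fun b _ => ?_
    rw [Matrix.transpose_apply, BB_inr]

theorem BB_det_mul (l m : ℕ) (hlm : l ≤ m) (A R) (g : Fin l → ℝ) :
    (∏ d, g d) * (BB l m hlm A R).det = (BB l m hlm A (fun d c => g d * R d c)).det := by
  rw [BB_det, BB_det, Finset.mul_sum]
  refine Finset.sum_congr rfl fun σ _ => ?_
  rw [Finset.prod_mul_distrib]; ring

theorem BB_integrable (l m : ℕ) (hlm : l ≤ m) (A) (Q : Fin l → Fin m → ℝ → ℝ)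
    (hQ : ∀ d c, Integrable (Q d c)) :
    Integrable (fun t : Fin l → ℝ => (BB l m hlm A (fun d c => Q d c (t d))).det) := by
  simp_rw [BB_det]
  refine integrable_finsetSum _ fun σ _ => ?_
  refine Integrable.const_mul ?_ _
  exact Integrable.fintype_prod (f := fun d => Q d (σ (e2 l m hlm (Sum.inr d)))) (fun d => hQ d _)

theorem BB_integral (l m : ℕ) (hlm : l ≤ m) (A) (Q : Fin l → Fin m → ℝ → ℝ)
    (hQ : ∀ d c, Integrable (Q d c)) :
    ∫ t : Fin l → ℝ, (BB l m hlm A (fun d c => Q d c (t d))).det =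
      (BB l m hlm A (fun d c => ∫ s, Q d c s)).det := by
  simp_rw [BB_det]
  rw [integral_finsetSum]
  · refine Finset.sum_congr rfl fun σ _ => ?_
    rw [integral_const_mul, integral_fintype_prod_volume_eq_prod
      (f := fun d => Q d (σ (e2 l m hlm (Sum.inr d))))]
  · intro σ _
    refine Integrable.const_mul ?_ _
    exact Integrable.fintype_prod (f := fun d => Q d (σ (e2 l m hlm (Sum.inr d)))) (fun d => hQ d _)

/-- generalized Andréief identity -/
theorem andreief (l m : ℕ) (hlm : l ≤ m) (A) (Q : Fin m → ℝ → ℝ) (h : Fin l → ℕ)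
    (hQ : ∀ d c, Integrable (fun s => s ^ h d * Q c s)) :
    ∫ t : Fin l → ℝ, PD h t * (BB l m hlm A (fun d c => Q c (t d))).det =
      (l.factorial : ℝ) * (BB l m hlm A (fun d c => ∫ s, s ^ h d * Q c s)).det := by
  have h1 : ∀ t : Fin l → ℝ, PD h t * (BB l m hlm A (fun d c => Q c (t d))).det =
      ∑ σ : Equiv.Perm (Fin l), ((Equiv.Perm.sign σ : ℤ) : ℝ) *
        (BB l m hlm A (fun d c => t d ^ h (σ d) * Q c (t d))).det := by
    intro t
    rw [PD, Matrix.det_apply', Finset.sum_mul]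
    refine Finset.sum_congr rfl fun σ _ => ?_
    rw [mul_assoc, ← BB_det_mul]
    rfl
  simp_rw [h1]
  have hi : ∀ σ : Equiv.Perm (Fin l), Integrable (fun t : Fin l → ℝ =>
      (BB l m hlm A (fun d c => t d ^ h (σ d) * Q c (t d))).det) := fun σ =>
    BB_integrable l m hlm A (fun d c s => s ^ h (σ d) * Q c s) (fun d c => hQ (σ d) c)
  rw [integral_finsetSum _ fun σ _ => (hi σ).const_mul _]
  have h2 : ∀ σ : Equiv.Perm (Fin l), ∫ t : Fin l → ℝ, ((Equiv.Perm.sign σ : ℤ) : ℝ) *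
      (BB l m hlm A (fun d c => t d ^ h (σ d) * Q c (t d))).det =
      (BB l m hlm A (fun d c => ∫ s, s ^ h d * Q c s)).det := by
    intro σ
    rw [integral_const_mul, BB_integral l m hlm A (fun d c s => s ^ h (σ d) * Q c s) (fun d c => hQ (σ d) c)]
    have := BB_perm l m hlm A (fun d c => ∫ s, s ^ h d * Q c s) σ
    rw [show (fun d c => ∫ s, s ^ h (σ d) * Q c s) = (fun d c => ∫ s, s ^ h d * Q c s) ∘ σ from rfl, this,
      ← mul_assoc]
    rcases Int.units_eq_one_or (Equiv.Perm.sign σ) with h | h <;> simp [h]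
  simp_rw [h2]
  simp [Fintype.card_perm]

theorem VdmF_hN_ext (l : ℕ) (N : Fin l → ℕ) : ∀ (d m : ℕ), m = d + l →
    VdmF (fun i => (hN m (extN l m N) i : ℝ)) * ∏ j, ((hN l N j).factorial : ℝ) =
      (∏ b ∈ Finset.range d, (b.factorial : ℝ)) * (∏ j, ((hN l N j + d).factorial : ℝ)) *
        VdmF (fun i => (hN l N i : ℝ)) := by
  intro d
  induction d with
  | zero =>
    intro m hm
    have : m = l := by omega
    subst this
    have e : extN m m N = N := by ext j; simp [extN]
    simp [e]; ring
  | succ d ih =>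
    intro m hm
    obtain ⟨n, rfl⟩ : ∃ n, m = n + 1 := ⟨d + l, by omega⟩
    have hn : n = d + l := by omega
    have e1 : (fun j : Fin n => extN l (n + 1) N j.castSucc) = extN l n N := by
      ext j; simp [extN]
    have e2' : extN l (n + 1) N (Fin.last n) = 0 := by
      simp [extN]; omega
    have h1 : VdmF (fun i => (hN (n + 1) (extN l (n + 1) N) i : ℝ)) =
        (∏ i, ((hN n (extN l n N) i : ℝ) + 1)) * VdmF (fun i => (hN n (extN l n N) i : ℝ)) := by
      rw [← VdmF_cons _ 0]
      simp only [hN, e1, e2']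
    have h2 : (∏ i, ((hN n (extN l n N) i : ℝ) + 1)) =
        (d.factorial : ℝ) * ∏ j, ((hN l N j : ℝ) + d + 1) := by
      subst hn
      rw [Fin.prod_univ_add]
      congr 1
      · rw [← Finset.prod_range_add_one_eq_factorial, Finset.prod_range]
        push_cast
        refine Finset.prod_congr rfl fun i _ => ?_
        rw [hN_extN l N d _ rfl]
        simp
      · refine Finset.prod_congr rfl fun i _ => ?_
        rw [hN_extN l N d _ rfl]
        simp
    rw [h1, h2, mul_assoc, mul_assoc, ih n hn, Finset.prod_range_succ]
    have h3 : ∏ j, ((hN l N j + (d + 1)).factorial : ℝ) =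
        (∏ j, ((hN l N j : ℝ) + d + 1)) * ∏ j, ((hN l N j + d).factorial : ℝ) := by
      rw [← Finset.prod_mul_distrib]
      refine Finset.prod_congr rfl fun j _ => ?_
      rw [← add_assoc, Nat.factorial_succ]; push_cast; ring
    rw [h3]; ring

theorem VdmF_hExt (l m : ℕ) (hlm : l < m) (h : Fin l → ℕ) (hh : StrictMono h) :
    VdmF (fun i => (hExt l m hlm h i : ℝ)) * ∏ j, ((h j).factorial : ℝ) =
      (∏ b ∈ Finset.range (m - l), (b.factorial : ℝ)) * (∏ j, ((h j + (m - l)).factorial : ℝ)) *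
        VdmF (fun i => (h i : ℝ)) := by
  obtain ⟨N, rfl⟩ := hN_surj l h hh
  have hE : hN m (extN l m N) = hExt l m hlm (hN l N) := by
    ext i
    rw [hN_extN l N (m - l) m (by omega) i, hExt]
  rw [← hE]
  exact VdmF_hN_ext l N (m - l) m (by omega)

theorem VdmF_id (m : ℕ) : VdmF (fun i : Fin m => ((i : ℕ) : ℝ)) =
    ∏ b ∈ Finset.range m, (b.factorial : ℝ) := by
  have h := VdmF_hN_ext 0 (fun _ => 0) m m (by omega)
  have e : extN 0 m (fun _ => 0) = fun _ => 0 := by ext j; simp [extN]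
  simp only [e, hN_zero] at h
  simpa [VdmF] using h

theorem K_const (l m : ℕ) (hlm : l < m) :
    (∏ j ∈ Finset.range l, ((m - (j + 1)).factorial : ℝ) / ((m - l).factorial : ℝ)) *
      ((∏ b ∈ Finset.range (m - l), (b.factorial : ℝ)) * ((m - l).factorial : ℝ) ^ l) =
    ∏ b ∈ Finset.range m, (b.factorial : ℝ) := by
  have h0 : ((m - l).factorial : ℝ) ≠ 0 := by exact_mod_cast Nat.factorial_ne_zero _
  have h1 : ∏ b ∈ Finset.range m, (b.factorial : ℝ) =
      (∏ b ∈ Finset.range (m - l), (b.factorial : ℝ)) * ∏ j ∈ Finset.range l, ((m - (j + 1)).factorial : ℝ) := by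
    have : m = (m - l) + l := by omega
    conv_lhs => rw [this]
    rw [Finset.prod_range_add]
    congr 1
    rw [← Finset.prod_range_reflect]
    refine Finset.prod_congr rfl fun j hj => ?_
    have := Finset.mem_range.1 hj
    congr 2; omega
  rw [h1, Finset.prod_div_distrib, Finset.prod_const, Finset.card_range]
  field_simp

theorem betaJ (k : ℕ) : ∀ D : ℕ, ∫ u in (0:ℝ)..1, u ^ k * (1 - u) ^ D =
    (k.factorial : ℝ) * D.factorial / (k + D + 1).factorial := by
  induction k with
  | zero =>
    intro D
    have := intervalIntegral.integral_comp_sub_left (a := 0) (b := 1) (fun u : ℝ => u ^ D) 1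
    simp only [pow_zero, one_mul, this, sub_self, sub_zero, integral_pow]
    rw [zero_add, Nat.factorial_succ]
    have : (D.factorial : ℝ) ≠ 0 := by positivity
    push_cast
    field_simp
    simp
  | succ k ih =>
    intro D
    have h1 : ∫ u in (0:ℝ)..1, (((k + 1 : ℕ) : ℝ) * u ^ k * (1 - u) ^ (D + 1)
        + u ^ (k + 1) * (((D + 1 : ℕ) : ℝ) * (1 - u) ^ D * (-1))) =
        (1 : ℝ) ^ (k + 1) * (1 - 1) ^ (D + 1) - 0 ^ (k + 1) * (1 - 0) ^ (D + 1) := by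
      refine intervalIntegral.integral_eq_sub_of_hasDerivAt
        (f := fun u : ℝ => u ^ (k + 1) * (1 - u) ^ (D + 1)) (fun u _ => ?_) ?_
      · have a := hasDerivAt_pow (k + 1) u
        have b := ((hasDerivAt_id u).const_sub 1).pow (D + 1)
        have c := a.mul b
        refine c.congr_deriv ?_
        simp
      · exact Continuous.intervalIntegrable (by fun_prop) _ _
    rw [intervalIntegral.integral_add (Continuous.intervalIntegrable (by fun_prop) _ _)
      (Continuous.intervalIntegrable (by fun_prop) _ _)] at h1
    have e1 : ∫ u in (0:ℝ)..1, ((k + 1 : ℕ) : ℝ) * u ^ k * (1 - u) ^ (D + 1) =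
        ((k + 1 : ℕ) : ℝ) * ∫ u in (0:ℝ)..1, u ^ k * (1 - u) ^ (D + 1) := by
      rw [← intervalIntegral.integral_const_mul]; congr 1; ext u; ring
    have e2 : ∫ u in (0:ℝ)..1, u ^ (k + 1) * (((D + 1 : ℕ) : ℝ) * (1 - u) ^ D * (-1)) =
        -((D + 1 : ℕ) : ℝ) * ∫ u in (0:ℝ)..1, u ^ (k + 1) * (1 - u) ^ D := by
      rw [← intervalIntegral.integral_const_mul]; congr 1; ext u; ring
    rw [e1, e2, ih (D + 1)] at h1
    have h2 : ((D + 1 : ℕ) : ℝ) * ∫ u in (0:ℝ)..1, u ^ (k + 1) * (1 - u) ^ D =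
      ((k + 1 : ℕ) : ℝ) * ((k.factorial : ℝ) * (D + 1).factorial / (k + (D + 1) + 1).factorial) := by
      simp at h1 ⊢; linarith
    have h3 : ((D + 1 : ℕ) : ℝ) ≠ 0 := by positivity
    apply mul_left_cancel₀ h3
    rw [h2, show k + (D + 1) + 1 = k + 1 + D + 1 by ring, Nat.factorial_succ k,
      Nat.factorial_succ D]
    push_cast; ring

theorem betaI (k D : ℕ) (hD : 1 ≤ D) : ∫ u in Set.Ioo (0:ℝ) 1, ((D : ℝ) * (1 - u) ^ (D - 1)) * u ^ k =
    (k.factorial : ℝ) * D.factorial / (k + D).factorial := by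
  obtain ⟨D, rfl⟩ := Nat.exists_eq_add_of_le' hD
  rw [← integral_Ioc_eq_integral_Ioo, ← intervalIntegral.integral_of_le zero_le_one]
  have : (fun u : ℝ => (((D + 1 : ℕ) : ℝ) * (1 - u) ^ (D + 1 - 1)) * u ^ k) =
    fun u => ((D + 1 : ℕ) : ℝ) * (u ^ k * (1 - u) ^ D) := by ext u; simp; ring
  rw [this, intervalIntegral.integral_const_mul, betaJ, Nat.factorial_succ D, ← add_assoc]
  push_cast; ring

/-- The kernel of `omegaTildeLt` without the indicator. -/
theorem omegaTilde_eq (m l : ℕ) (ω : ℝ → ℝ) (h0 : ∀ x ≤ 0, ω x = 0) (t av : ℝ) :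
    omegaTildeLt m l ω t av = av ^ (m - l) * ∫ u in Set.Ioo (0 : ℝ) 1,
      (((m - l : ℕ) : ℝ) * (1 - u) ^ (m - l - 1) * ω (t / (av * u))) / (|av| * u) := by
  unfold omegaTildeLt
  split_ifs with h
  · rw [one_mul]
  · have : ∫ u in Set.Ioo (0 : ℝ) 1,
      (((m - l : ℕ) : ℝ) * (1 - u) ^ (m - l - 1) * ω (t / (av * u))) / (|av| * u) = 0 := by
      refine setIntegral_eq_zero_of_forall_eq_zero fun u hu => ?_
      have : t / (av * u) ≤ 0 := by
        rw [← div_div]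
        apply div_nonpos_of_nonpos_of_nonneg _ hu.1.le
        rw [div_eq_mul_inv]
        rcases lt_trichotomy av 0 with ha | ha | ha
        · have : 0 ≤ t := by nlinarith
          exact mul_nonpos_of_nonneg_of_nonpos this (inv_nonpos.2 ha.le)
        · simp [ha]
        · have : t ≤ 0 := by nlinarith
          exact mul_nonpos_of_nonpos_of_nonneg this (inv_nonneg.2 ha.le)
      simp [h0 _ this]
    rw [this]; simp

theorem omegaTilde_ind (m l : ℕ) (ω : ℝ → ℝ) (t av : ℝ) :
    omegaTildeLt m l ω t av = omegaTildeLt m l (Set.indicator (Set.Ioi 0) ω) t av := by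
  unfold omegaTildeLt
  split_ifs with h
  · congr 1
    refine setIntegral_congr_fun measurableSet_Ioo fun u hu => ?_
    have : 0 < t / (av * u) := by
      rw [← div_div]
      apply div_pos _ hu.1
      rcases lt_trichotomy av 0 with ha | ha | ha
      · exact div_pos_of_neg_of_neg (by nlinarith) ha
      · simp [ha] at h
      · exact div_pos (by nlinarith) ha
    simp only [Set.indicator_of_mem (Set.mem_Ioi.2 this)]
  · simp

theorem omegaTilde_main (m l : ℕ) (hlm : l < m) (ω : ℝ → ℝ) (h0 : ∀ x ≤ 0, ω x = 0)
    (hm : Measurable ω) (k : ℕ) (hi : Integrable (fun x => x ^ k * ω x)) (av : ℝ) (ha : av ≠ 0) :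
    Integrable (fun p : ℝ × ℝ => p.1 ^ k * ((((m - l : ℕ) : ℝ) * (1 - p.2) ^ (m - l - 1) *
      ω (p.1 / (av * p.2))) / (|av| * p.2))) (volume.prod (volume.restrict (Set.Ioo (0:ℝ) 1))) ∧
    Integrable (fun t => t ^ k * omegaTildeLt m l ω t av) ∧
    ∫ t, t ^ k * omegaTildeLt m l ω t av = av ^ (k + (m - l)) *
      ((k.factorial : ℝ) * (m - l).factorial / (k + (m - l)).factorial) * ∫ x, x ^ k * ω x := by
  set D := m - l with hDdef
  have hD : 1 ≤ D := by omega
  let F : ℝ × ℝ → ℝ := fun p => p.1 ^ k * (((D : ℝ) * (1 - p.2) ^ (D - 1) *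
      ω (p.1 / (av * p.2))) / (|av| * p.2))
  have hFm : Measurable F := by
    dsimp only [F]; fun_prop
  have hFu : ∀ u ∈ Set.Ioo (0:ℝ) 1, ∀ t, F (t, u) = ((D : ℝ) * (1 - u) ^ (D - 1)) *
      (av * u) ^ k / (|av| * u) * ((fun x => x ^ k * ω x) (t / (av * u))) := by
    intro u hu t
    have h5 : (av * u) ^ k ≠ 0 := pow_ne_zero _ (mul_ne_zero ha hu.1.ne')
    dsimp only [F]
    rw [div_pow]
    generalize (av * u) ^ k = q at *
    field_simp
  have hIntg : ∀ u ∈ Set.Ioo (0:ℝ) 1, Integrable (fun t => F (t, u)) := by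
    intro u hu
    simp_rw [hFu u hu]
    exact (hi.comp_div (mul_ne_zero ha hu.1.ne')).const_mul _
  have hval : ∀ u ∈ Set.Ioo (0:ℝ) 1, ∫ t, F (t, u) =
      (((D : ℝ) * (1 - u) ^ (D - 1)) * u ^ k) * (av ^ k * ∫ x, x ^ k * ω x) := by
    intro u hu
    have h1 : |u| = u := abs_of_pos hu.1
    have h2 : |av| ≠ 0 := abs_ne_zero.2 ha
    have h3 : u ≠ 0 := hu.1.ne'
    simp_rw [hFu u hu]
    rw [integral_const_mul, Measure.integral_comp_div (fun x => x ^ k * ω x), abs_mul, h1, smul_eq_mul, mul_pow]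
    field_simp
  have hval2 : ∀ u ∈ Set.Ioo (0:ℝ) 1, ∫ t, ‖F (t, u)‖ =
      (((D : ℝ) * (1 - u) ^ (D - 1)) * u ^ k) * (|av| ^ k * ∫ x, |x ^ k * ω x|) := by
    intro u hu
    have h1 : |u| = u := abs_of_pos hu.1
    have h2 : |av| ≠ 0 := abs_ne_zero.2 ha
    have h3 : u ≠ 0 := hu.1.ne'
    have h4 : |1 - u| = 1 - u := abs_of_pos (by linarith [hu.2])
    simp_rw [hFu u hu]
    have h6 : ∀ t, ‖((D : ℝ) * (1 - u) ^ (D - 1)) *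
      (av * u) ^ k / (|av| * u) * ((fun x => x ^ k * ω x) (t / (av * u)))‖ =
      ‖((D : ℝ) * (1 - u) ^ (D - 1)) * (av * u) ^ k / (|av| * u)‖ *
        (fun x => ‖x ^ k * ω x‖) (t / (av * u)) := fun t => norm_mul _ _
    simp_rw [h6]
    rw [integral_const_mul, Measure.integral_comp_div (fun x => ‖x ^ k * ω x‖), abs_mul, h1, smul_eq_mul]
    simp only [Real.norm_eq_abs, abs_div, abs_mul, abs_pow, h1, h4, abs_abs, Nat.abs_cast, mul_pow]
    field_simp
  have hbi : Integrable (fun u : ℝ => ((D : ℝ) * (1 - u) ^ (D - 1)) * u ^ k)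
      (volume.restrict (Set.Ioo (0:ℝ) 1)) := by
    have : IntegrableOn (fun u : ℝ => ((D : ℝ) * (1 - u) ^ (D - 1)) * u ^ k) (Set.Icc 0 1) :=
      Continuous.integrableOn_Icc (by fun_prop)
    exact this.mono_set Set.Ioo_subset_Icc_self
  have hF : Integrable F (volume.prod (volume.restrict (Set.Ioo (0:ℝ) 1))) := by
    rw [integrable_prod_iff' hFm.aestronglyMeasurable]
    constructor
    · filter_upwards [ae_restrict_mem measurableSet_Ioo] with u hu using hIntg u hu
    · refine (hbi.mul_const (|av| ^ k * ∫ x, |x ^ k * ω x|)).congr ?_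
      filter_upwards [ae_restrict_mem measurableSet_Ioo] with u hu using (hval2 u hu).symm
  have hE : ∀ t, t ^ k * omegaTildeLt m l ω t av = av ^ D * ∫ u in Set.Ioo (0:ℝ) 1, F (t, u) := by
    intro t
    rw [omegaTilde_eq m l ω h0]
    dsimp only [F]
    rw [integral_const_mul]; ring
  refine ⟨hF, ?_, ?_⟩
  · simp_rw [hE]
    exact hF.integral_prod_left.const_mul _
  · simp_rw [hE]
    rw [integral_const_mul, integral_integral_swap (f := fun t u => F (t, u)) hF]
    rw [setIntegral_congr_fun measurableSet_Ioo hval, integral_mul_const, betaI k D hD, pow_add]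
    ring

/-- nice compactly supported weights -/
def WW (p : ℕ) (w : ℝ → ℝ) : Prop :=
  ContDiff ℝ p w ∧ HasCompactSupport w ∧ tsupport w ⊆ Set.Ioi 0

theorem WW.integrable {p : ℕ} {w : ℝ → ℝ} (h : WW p w) (g : ℝ → ℝ) (hg : Continuous g) :
    Integrable (fun x => g x * w x) := by
  refine Continuous.integrable_of_hasCompactSupport (hg.mul h.1.continuous) ?_
  exact h.2.1.mul_left

theorem WW.zero {p : ℕ} {w : ℝ → ℝ} (h : WW p w) (x : ℝ) (hx : x ≤ 0) : w x = 0 := by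
  by_contra hc
  exact absurd (h.2.2 (subset_tsupport w hc)) (not_lt.2 hx)

theorem WW.negxd {p : ℕ} {w : ℝ → ℝ} (h : WW (p + 1) w) : WW p (negxdOp w) := by
  have hd : ContDiff ℝ p (deriv w) := by
    have := h.1
    push_cast at this
    exact (contDiff_succ_iff_deriv.1 this).2.2
  have hsub : tsupport (negxdOp w) ⊆ tsupport (deriv w) := by
    apply closure_mono
    intro x hx hc
    apply hx
    simp [negxdOp, hc]
  refine ⟨?_, ?_, ?_⟩
  · exact (contDiff_id.mul hd).neg
  · exact IsCompact.of_isClosed_subset h.2.1.deriv (isClosed_tsupport _) hsub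
  · exact hsub.trans (tsupport_deriv_subset.trans h.2.2)

theorem WW.moment {p : ℕ} {w : ℝ → ℝ} (h : WW (p + 1) w) (k : ℕ) :
    ∫ x, x ^ k * negxdOp w x = ((k : ℝ) + 1) * ∫ x, x ^ k * w x := by
  have hw : Differentiable ℝ w := h.1.differentiable (by simp)
  have h1 : ∀ x : ℝ, HasDerivAt (fun x => x ^ (k + 1) * w x)
      (((k : ℝ) + 1) * (x ^ k * w x) - x ^ k * negxdOp w x) x := by
    intro x
    have := (hasDerivAt_pow (k + 1) x).mul (hw x).hasDerivAt
    refine this.congr_deriv ?_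
    simp only [negxdOp, add_tsub_cancel_right]; push_cast; ring
  have i1 := (h.integrable (fun x => x ^ k) (by fun_prop)).const_mul ((k : ℝ) + 1)
  have i2 := h.negxd.integrable (fun x => x ^ k) (by fun_prop)
  have h2 := integral_eq_zero_of_hasDerivAt_of_integrable h1 (i1.sub i2)
    (h.integrable (fun x => x ^ (k + 1)) (by fun_prop))
  rw [integral_sub i1 i2, integral_const_mul] at h2
  linarith

theorem WW.iter {p b : ℕ} : ∀ {w : ℝ → ℝ}, WW (p + b) w → WW p (negxdOp^[b] w) := by
  induction b with
  | zero => intro w h; exact h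
  | succ b ih => intro w h; rw [Function.iterate_succ_apply]; exact ih h.negxd

theorem WW.momentIter {p b : ℕ} (k : ℕ) : ∀ {w : ℝ → ℝ}, WW (p + b) w →
    ∫ x, x ^ k * (negxdOp^[b] w) x = ((k : ℝ) + 1) ^ b * ∫ x, x ^ k * w x := by
  induction b with
  | zero => intro w h; simp
  | succ b ih =>
    intro w h
    rw [Function.iterate_succ_apply, ih h.negxd, WW.moment (p := p + b) h]
    ring

theorem WW.mono {p q : ℕ} (hpq : q ≤ p) {w : ℝ → ℝ} (h : WW p w) : WW q w :=
  ⟨h.1.of_le (by exact_mod_cast hpq), h.2⟩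

theorem WW.iter' {l b : ℕ} (hb : b < l) {w : ℝ → ℝ} (h : WW (l - 1) w) :
    WW 0 (negxdOp^[b] w) := WW.iter (h.mono (by omega))

/-- unnormalized Polya density -/
def Psi (l : ℕ) (w : ℝ → ℝ) (x : Fin l → ℝ) : ℝ :=
  VdmF x * Matrix.det (Matrix.of fun b c : Fin l => (negxdOp^[(b : ℕ)] w) (x c))

/-- the matrix determinant in `projDensity`, as a `BB` -/
def Phi (l m : ℕ) (hlm : l < m) (w : ℝ → ℝ) (a : Fin m → ℝ) (t : Fin l → ℝ) : ℝ :=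
  VdmF t * (BB l m hlm.le (fun b c => a c ^ (b : ℕ)) (fun d c => omegaTildeLt m l w (t d) (a c))).det

theorem PD_def {l : ℕ} (h : Fin l → ℕ) (x : Fin l → ℝ) :
    PD h x = (Matrix.of fun i j => x j ^ h i).det := rfl

theorem Psi_moment (l : ℕ) (w : ℝ → ℝ) (hw : WW (l - 1) w) (h : Fin l → ℕ) :
    ∫ x : Fin l → ℝ, PD h x * Matrix.det (Matrix.of fun b c : Fin l => (negxdOp^[(b : ℕ)] w) (x c))
      = (l.factorial : ℝ) * ((∏ d, ∫ s, s ^ h d * w s) * VdmF (fun i => (h i : ℝ))) := by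
  have e : ∀ (R : Fin l → Fin l → ℝ), (BB l l le_rfl (fun _ _ => 0) R) = Matrix.of R := by
    intro R; ext b c; simp [BB]
  have key := andreief l l le_rfl (fun _ _ => 0) (fun c s => (negxdOp^[(c : ℕ)] w) s) h
    (fun d c => (hw.iter' c.isLt).integrable (fun s => s ^ h d) (by fun_prop))
  simp only [e] at key
  have h1 : ∀ x : Fin l → ℝ, Matrix.det (Matrix.of fun b c : Fin l => (negxdOp^[(b : ℕ)] w) (x c))
      = Matrix.det (Matrix.of fun d c : Fin l => (negxdOp^[(c : ℕ)] w) (x d)) := by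
    intro x; rw [← Matrix.det_transpose]; rfl
  simp_rw [h1]
  rw [key]
  congr 1
  have h2 : (Matrix.of fun d c : Fin l => ∫ s, s ^ h d * (negxdOp^[(c : ℕ)] w) s) =
      Matrix.of fun d c => (∫ s, s ^ h d * w s) * Matrix.vandermonde (fun i => (h i : ℝ) + 1) d c := by
    ext d c
    simp only [Matrix.of_apply, Matrix.vandermonde_apply]
    rw [WW.momentIter (p := 0) (h d) (hw.mono (by have := c.isLt; omega)), mul_comm]
  rw [h2, Matrix.det_mul_column, Matrix.det_vandermonde_add, VdmF_eq_det]

theorem Phi_moment (l m : ℕ) (hlm : l < m) (w : ℝ → ℝ) (h0 : ∀ x ≤ 0, w x = 0)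
    (hm : Measurable w) (h : Fin l → ℕ) (hi : ∀ d, Integrable (fun x => x ^ h d * w x))
    (a : Fin m → ℝ) (ha : ∀ i, a i ≠ 0) :
    ∫ t : Fin l → ℝ, PD h t * (BB l m hlm.le (fun b c => a c ^ (b : ℕ))
      (fun d c => omegaTildeLt m l w (t d) (a c))).det =
    (l.factorial : ℝ) * ((∏ d, (((h d).factorial : ℝ) * (m - l).factorial / (h d + (m - l)).factorial)
      * ∫ s, s ^ h d * w s) * PD (hExt l m hlm h) a) := by
  have key := andreief l m hlm.le (fun b c => a c ^ (b : ℕ)) (fun c s => omegaTildeLt m l w s (a c)) h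
    (fun d c => (omegaTilde_main m l hlm w h0 hm (h d) (hi d) (a c) (ha c)).2.1)
  rw [key]
  congr 1
  have h2 : ∀ (d : Fin l) (c : Fin m), ∫ s, s ^ h d * omegaTildeLt m l w s (a c) =
      ((((h d).factorial : ℝ) * (m - l).factorial / (h d + (m - l)).factorial)
      * ∫ s, s ^ h d * w s) * a c ^ (h d + (m - l)) := by
    intro d c
    rw [(omegaTilde_main m l hlm w h0 hm (h d) (hi d) (a c) (ha c)).2.2]; ring
  simp_rw [h2]
  rw [← BB_det_mul]
  congr 2
  ext b c
  simp only [BB, hExt, Matrix.of_apply]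
  split_ifs with hb <;> rfl

/-- values of the characteristic polynomial -/
def EVm {n : ℕ} (y : Matrix (Fin n) (Fin n) ℂ) : Fin (n + 1) → ℝ := fun k =>
  ((((((k : ℕ) : ℝ)) : ℂ) • (1 : Matrix (Fin n) (Fin n) ℂ) - y).det).re

theorem continuous_EVm {n : ℕ} : Continuous (EVm (n := n)) := by
  unfold EVm
  refine continuous_pi fun k => Complex.continuous_re.comp ?_
  exact Continuous.matrix_det (continuous_const.sub continuous_id)

theorem eigs_symm {n : ℕ} (f : (Fin n → ℝ) → ℝ)
    (hs : ∀ (σ : Equiv.Perm (Fin n)) v, f (v ∘ σ) = f v) (y : Matrix (Fin n) (Fin n) ℂ)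
    (hy : y.IsHermitian) : f (eigs y) = f (RR n (EVm y)) := by
  have h1 : EVm y = EV n (eigs y) := by
    ext k
    simp only [EVm, EV]
    rw [← eigs_det y hy]; rfl
  obtain ⟨σ, h⟩ := RR_EV n (eigs y)
  rw [h1, h, hs]

theorem measurable_feigs (l m : ℕ) (hlm : l < m) (a : Fin m → ℝ) (f : (Fin l → ℝ) → ℝ)
    (hf : Measurable f) (hs : ∀ (σ : Equiv.Perm (Fin l)) v, f (v ∘ σ) = f v) :
    Measurable fun p : (Fin l → ℝ) × Matrix (Fin m) (Fin m) ℂ => f (eigs (GG l m hlm a p.1 p.2)) := by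
  have h : (fun p : (Fin l → ℝ) × Matrix (Fin m) (Fin m) ℂ => f (eigs (GG l m hlm a p.1 p.2))) =
      fun p => f (RR l (EVm (GG l m hlm a p.1 p.2))) := by
    ext p; exact eigs_symm f hs _ (GG_herm _ _ _ _ _ _)
  rw [h]
  refine hf.comp ((measurable_RR l).comp ?_)
  have : BorelSpace ((Fin l → ℝ) × Matrix (Fin m) (Fin m) ℂ) := by
    have : SecondCountableTopology (Matrix (Fin m) (Fin m) ℂ) := matSCT m m
    infer_instance
  exact (continuous_EVm.comp (continuous_GG l m hlm a)).measurable

theorem measurable_feigs' (l m : ℕ) (hlm : l < m) (a : Fin m → ℝ) (f : (Fin l → ℝ) → ℝ)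
    (hf : Measurable f) (hs : ∀ (σ : Equiv.Perm (Fin l)) v, f (v ∘ σ) = f v) :
    Measurable fun p : (Fin l → ℝ) × UG m =>
      f (eigs (GG l m hlm a p.1 (p.2 : Matrix (Fin m) (Fin m) ℂ))) := by
  have h1 : Measurable fun p : (Fin l → ℝ) × UG m => (p.1, (p.2 : Matrix (Fin m) (Fin m) ℂ)) :=
    Measurable.prodMk measurable_fst (Measurable.comp measurable_subtype_coe measurable_snd)
  have h2 := Measurable.comp (measurable_feigs l m hlm a f hf hs) h1
  simpa only [Function.comp_def] using h2

theorem eigs_sq {n : ℕ} (y : Matrix (Fin n) (Fin n) ℂ) (hy : y.IsHermitian) :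
    ∑ i, eigs y i ^ 2 = (y * y).trace.re := by
  obtain ⟨k, hk⟩ := eigs_spectral y hy
  have hkk : (k : Matrix (Fin n) (Fin n) ℂ)ᴴ * (k : Matrix (Fin n) (Fin n) ℂ) = 1 := by
    have := k.2
    rw [Matrix.mem_unitaryGroup_iff'] at this
    exact this
  have h : y * y = (k : Matrix (Fin n) (Fin n) ℂ) * (realDiag (eigs y) * realDiag (eigs y) *
      (k : Matrix (Fin n) (Fin n) ℂ)ᴴ) := by
    conv_lhs => rw [hk]
    generalize realDiag (eigs y) = r
    calc _ = (k : Matrix (Fin n) (Fin n) ℂ) * r * ((k : Matrix (Fin n) (Fin n) ℂ)ᴴ *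
        (k : Matrix (Fin n) (Fin n) ℂ)) * r * (k : Matrix (Fin n) (Fin n) ℂ)ᴴ := by
          simp only [Matrix.mul_assoc]
      _ = _ := by rw [hkk]; simp only [Matrix.mul_assoc, Matrix.mul_one]
  rw [h, Matrix.trace_mul_comm, Matrix.mul_assoc, hkk, Matrix.mul_one]
  unfold realDiag
  rw [Matrix.diagonal_mul_diagonal, Matrix.trace_diagonal]
  rw [Complex.re_sum]
  refine Finset.sum_congr rfl fun i _ => ?_
  rw [← Complex.ofReal_mul, Complex.ofReal_re]; ring

theorem eigs_bound (l m : ℕ) (hlm : l < m) (a : Fin m → ℝ) (K : Set (Fin l → ℝ)) (hK : IsCompact K) :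
    ∃ R : ℝ, ∀ x ∈ K, ∀ v : UG m, ∀ i,
      |eigs (GG l m hlm a x (v : Matrix (Fin m) (Fin m) ℂ)) i| ≤ R := by
  have hc : IsCompact (K ×ˢ (Set.univ : Set (UG m))) := hK.prod isCompact_univ
  have hcont : Continuous fun p : (Fin l → ℝ) × UG m =>
      ((GG l m hlm a p.1 (p.2 : Matrix (Fin m) (Fin m) ℂ) *
        GG l m hlm a p.1 (p.2 : Matrix (Fin m) (Fin m) ℂ)).trace).re := by
    have h1 : Continuous fun p : (Fin l → ℝ) × UG m => GG l m hlm a p.1 (p.2 : Matrix (Fin m) (Fin m) ℂ) := by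
      have h3 : Continuous fun p : (Fin l → ℝ) × UG m => (p.1, (p.2 : Matrix (Fin m) (Fin m) ℂ)) :=
        Continuous.prodMk continuous_fst (Continuous.comp continuous_subtype_val continuous_snd)
      have h2 := Continuous.comp (continuous_GG l m hlm a) h3
      simpa only [Function.comp_def] using h2
    exact Complex.continuous_re.comp (Continuous.matrix_trace (h1.mul h1))
  obtain ⟨C, hC⟩ := hc.exists_bound_of_continuousOn hcont.continuousOn
  refine ⟨Real.sqrt C, fun x hx v i => ?_⟩
  have h1 := hC (x, v) ⟨hx, Set.mem_univ _⟩
  rw [← eigs_sq _ (GG_herm _ _ _ _ _ _)] at h1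
  apply Real.abs_le_sqrt
  calc _ ≤ ∑ i, eigs (GG l m hlm a x (v : Matrix (Fin m) (Fin m) ℂ)) i ^ 2 :=
        Finset.single_le_sum (f := fun i => eigs (GG l m hlm a x (v : Matrix (Fin m) (Fin m) ℂ)) i ^ 2)
          (fun j _ => sq_nonneg _) (Finset.mem_univ i)
    _ ≤ _ := (le_abs_self _).trans h1

/-- symmetrized monomials -/
def symMon {l : ℕ} (α : Fin l → ℕ) (y : Fin l → ℝ) : ℝ :=
  ∑ σ : Equiv.Perm (Fin l), ∏ i, y (σ i) ^ α i

theorem continuous_symMon {l : ℕ} (α : Fin l → ℕ) : Continuous (symMon α) := by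
  unfold symMon; fun_prop

theorem symMon_symm {l : ℕ} (α : Fin l → ℕ) (τ : Equiv.Perm (Fin l)) (y : Fin l → ℝ) :
    symMon α (y ∘ τ) = symMon α y := by
  unfold symMon
  conv_rhs => rw [← Equiv.sum_comp (Equiv.mulLeft τ)]
  rfl

theorem poly_approx {l : ℕ} (R : ℝ) (f : (Fin l → ℝ) → ℝ) (hf : Continuous f) (ε : ℝ) (hε : 0 < ε) :
    ∃ p : MvPolynomial (Fin l) ℝ, ∀ x : Fin l → ℝ, (∀ i, |x i| ≤ R) →
      |f x - MvPolynomial.eval x p| < ε := by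
  let K : Set (Fin l → ℝ) := Set.Icc (fun _ => -R) (fun _ => R)
  let co : Fin l → C(K, ℝ) := fun i => ⟨fun x => x.1 i, (continuous_apply i).comp continuous_subtype_val⟩
  let A : Subalgebra ℝ C(K, ℝ) := (MvPolynomial.aeval (R := ℝ) co).range
  have hco : ∀ i, co i ∈ A := fun i => ⟨MvPolynomial.X i, by simp⟩
  have hsep : A.SeparatesPoints := by
    intro x y hxy
    have : x.1 ≠ y.1 := fun h => hxy (Subtype.ext h)
    obtain ⟨i, hi⟩ := Function.ne_iff.1 this
    exact ⟨co i, ⟨co i, hco i, rfl⟩, hi⟩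
  have htop := ContinuousMap.subalgebra_topologicalClosure_eq_top_of_separatesPoints A hsep
  let F : C(K, ℝ) := ⟨fun x => f x.1, by fun_prop⟩
  have hF : F ∈ A.topologicalClosure := by rw [htop]; trivial
  have hF' : F ∈ closure (A : Set C(K, ℝ)) := hF
  obtain ⟨g, ⟨p, rfl⟩, hg⟩ := Metric.mem_closure_iff.1 hF' ε hε
  refine ⟨p, fun x hx => ?_⟩
  have hxK : x ∈ K := ⟨fun i => (abs_le.1 (hx i)).1, fun i => (abs_le.1 (hx i)).2⟩
  have h1 := (ContinuousMap.dist_apply_le_dist (f := F) (g := (MvPolynomial.aeval (R := ℝ) co) p) ⟨x, hxK⟩).trans_lt hg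
  have h2 : ((MvPolynomial.aeval (R := ℝ) co) p) ⟨x, hxK⟩ = MvPolynomial.eval x p := by
    have h3 := MvPolynomial.comp_aeval_apply (R := ℝ) co (ContinuousMap.evalAlgHom ℝ ℝ (⟨x, hxK⟩ : K)) p
    exact h3.trans (by rw [← MvPolynomial.aeval_eq_eval]; rfl)
  rw [Real.dist_eq] at h1
  rw [← h2]
  exact h1

theorem sw_integrable {l : ℕ} {X : Type*} [MeasurableSpace X] (μ : Measure X)
    (E : X → Fin l → ℝ) (ψ : X → ℝ) (hψ : Integrable ψ μ) (R : ℝ)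
    (hR : ∀ x, ψ x ≠ 0 → ∀ i, |E x i| ≤ R) (g : (Fin l → ℝ) → ℝ) (hg : Continuous g)
    (hm : AEStronglyMeasurable (fun x => g (E x)) μ) : Integrable (fun x => g (E x) * ψ x) μ := by
  have hK : IsCompact (Set.Icc (fun _ : Fin l => -R) (fun _ => R)) := isCompact_Icc
  obtain ⟨C, hC⟩ := hK.exists_bound_of_continuousOn hg.continuousOn
  refine (hψ.norm.const_mul C).mono' (hm.mul hψ.1) (Eventually.of_forall fun x => ?_)
  rw [norm_mul]
  by_cases h : ψ x = 0
  · simp [h]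
  · exact mul_le_mul_of_nonneg_right (hC _ ⟨fun i => (abs_le.1 (hR x h i)).1,
      fun i => (abs_le.1 (hR x h i)).2⟩) (norm_nonneg _)

theorem sw_bound {l : ℕ} {X : Type*} [MeasurableSpace X] (μ : Measure X)
    (E : X → Fin l → ℝ) (ψ : X → ℝ) (hψ : Integrable ψ μ) (R : ℝ)
    (hR : ∀ x, ψ x ≠ 0 → ∀ i, |E x i| ≤ R) (g : (Fin l → ℝ) → ℝ) (C : ℝ)
    (hC : ∀ y : Fin l → ℝ, (∀ i, |y i| ≤ R) → |g y| ≤ C) :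
    |∫ x, g (E x) * ψ x ∂μ| ≤ C * ∫ x, |ψ x| ∂μ := by
  rw [← integral_const_mul, ← Real.norm_eq_abs]
  refine norm_integral_le_of_norm_le (hψ.abs.const_mul C) (Eventually.of_forall fun x => ?_)
  rw [norm_mul]
  by_cases h : ψ x = 0
  · simp [h]
  · exact mul_le_mul_of_nonneg_right (hC _ (hR x h)) (abs_nonneg _)

theorem sw_ext {l : ℕ} {X Y : Type*} [MeasurableSpace X] [MeasurableSpace Y] (μ : Measure X)
    (ν : Measure Y) (E : X → Fin l → ℝ) (F : Y → Fin l → ℝ) (ψ : X → ℝ) (φ : Y → ℝ)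
    (hψ : Integrable ψ μ) (hφ : Integrable φ ν) (R : ℝ)
    (hR : ∀ x, ψ x ≠ 0 → ∀ i, |E x i| ≤ R) (hR' : ∀ y, φ y ≠ 0 → ∀ i, |F y i| ≤ R)
    (hE : ∀ g : (Fin l → ℝ) → ℝ, Continuous g → (∀ (σ : Equiv.Perm (Fin l)) v, g (v ∘ σ) = g v) →
      AEStronglyMeasurable (fun x => g (E x)) μ)
    (hF : ∀ g : (Fin l → ℝ) → ℝ, Continuous g → (∀ (σ : Equiv.Perm (Fin l)) v, g (v ∘ σ) = g v) →
      AEStronglyMeasurable (fun x => g (F x)) ν)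
    (hP : ∀ α : Fin l → ℕ, ∫ x, symMon α (E x) * ψ x ∂μ = ∫ y, symMon α (F y) * φ y ∂ν)
    (f : (Fin l → ℝ) → ℝ) (hf : Continuous f)
    (hs : ∀ (σ : Equiv.Perm (Fin l)) v, f (v ∘ σ) = f v) :
    ∫ x, f (E x) * ψ x ∂μ = ∫ y, f (F y) * φ y ∂ν := by
  have main : ∀ ε > 0, |(l.factorial : ℝ) * (∫ x, f (E x) * ψ x ∂μ - ∫ y, f (F y) * φ y ∂ν)| ≤
      ε * (l.factorial * (∫ x, |ψ x| ∂μ + ∫ y, |φ y| ∂ν)) := by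
    intro ε hε
    obtain ⟨p, hp⟩ := poly_approx R f hf ε hε
    let q : (Fin l → ℝ) → ℝ := fun y => ∑ d ∈ p.support, p.coeff d * symMon (fun i => d i) y
    have hqc : Continuous q := by
      have := fun α : Fin l → ℕ => continuous_symMon α
      dsimp only [q]; fun_prop
    have hqs : ∀ (σ : Equiv.Perm (Fin l)) v, q (v ∘ σ) = q v := by
      intro σ v; simp only [q, symMon_symm]
    have hqe : ∀ y, q y = ∑ σ : Equiv.Perm (Fin l), MvPolynomial.eval (y ∘ σ) p := by
      intro y
      simp only [q, MvPolynomial.eval_eq', symMon, Finset.mul_sum]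
      rw [Finset.sum_comm]; rfl
    have hb : ∀ y : Fin l → ℝ, (∀ i, |y i| ≤ R) → |l.factorial * f y - q y| ≤ l.factorial * ε := by
      intro y hy
      have h1 : l.factorial * f y - q y =
          ∑ σ : Equiv.Perm (Fin l), (f (y ∘ σ) - MvPolynomial.eval (y ∘ σ) p) := by
        rw [hqe, Finset.sum_sub_distrib]
        simp [hs, Finset.sum_const, Finset.card_univ, Fintype.card_perm]
      rw [h1]
      refine (Finset.abs_sum_le_sum_abs _ _).trans ?_
      calc _ ≤ ∑ σ : Equiv.Perm (Fin l), ε :=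
            Finset.sum_le_sum fun σ _ => (hp (y ∘ σ) (fun i => hy _)).le
        _ = _ := by simp [Finset.sum_const, Finset.card_univ, Fintype.card_perm]
    have hq : ∫ x, q (E x) * ψ x ∂μ = ∫ y, q (F y) * φ y ∂ν := by
      simp only [q, Finset.sum_mul]
      rw [integral_finsetSum, integral_finsetSum]
      · refine Finset.sum_congr rfl fun d _ => ?_
        simp only [mul_assoc]
        rw [integral_const_mul, integral_const_mul, hP]
      · intro d _
        simp only [mul_assoc]
        exact (sw_integrable ν F φ hφ R hR' _ (continuous_symMon _)
          (hF _ (continuous_symMon _) (symMon_symm _))).const_mul _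
      · intro d _
        simp only [mul_assoc]
        exact (sw_integrable μ E ψ hψ R hR _ (continuous_symMon _)
          (hE _ (continuous_symMon _) (symMon_symm _))).const_mul _
    have i1 := sw_integrable μ E ψ hψ R hR f hf (hE f hf hs)
    have i2 := sw_integrable ν F φ hφ R hR' f hf (hF f hf hs)
    have j1 := sw_integrable μ E ψ hψ R hR q hqc (hE q hqc hqs)
    have j2 := sw_integrable ν F φ hφ R hR' q hqc (hF q hqc hqs)
    have b1 := sw_bound μ E ψ hψ R hR (fun y => l.factorial * f y - q y) _ hb
    have b2 := sw_bound ν F φ hφ R hR' (fun y => l.factorial * f y - q y) _ hb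
    simp only [sub_mul, mul_assoc] at b1 b2
    rw [integral_sub (i1.const_mul _) j1, integral_const_mul] at b1
    rw [integral_sub (i2.const_mul _) j2, integral_const_mul] at b2
    rw [hq] at b1
    rw [abs_le] at *
    constructor <;> nlinarith
  set T := l.factorial * (∫ x, |ψ x| ∂μ + ∫ y, |φ y| ∂ν) with hT
  have hT0 : 0 ≤ T := by
    have h1 : 0 ≤ ∫ x, |ψ x| ∂μ := integral_nonneg fun _ => abs_nonneg _
    have h2 : 0 ≤ ∫ x, |φ x| ∂ν := integral_nonneg fun _ => abs_nonneg _
    positivity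
  have h0 : (l.factorial : ℝ) * (∫ x, f (E x) * ψ x ∂μ - ∫ y, f (F y) * φ y ∂ν) = 0 := by
    rw [← abs_nonpos_iff]
    refine le_of_forall_pos_le_add fun δ hδ => ?_
    refine (main (δ / (T + 1)) (by positivity)).trans ?_
    rw [zero_add, div_mul_eq_mul_div, div_le_iff₀ (by positivity)]
    nlinarith
  have hl : (l.factorial : ℝ) ≠ 0 := by positivity
  have := (mul_eq_zero.1 h0).resolve_left hl
  linarith

theorem PD_mul_BB_integrable (l m : ℕ) (hlm : l ≤ m) (A) (Q : Fin m → ℝ → ℝ) (h : Fin l → ℕ)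
    (hQ : ∀ d c, Integrable (fun s => s ^ h d * Q c s)) :
    Integrable fun t : Fin l → ℝ => PD h t * (BB l m hlm A (fun d c => Q c (t d))).det := by
  have h1 : ∀ t : Fin l → ℝ, PD h t * (BB l m hlm A (fun d c => Q c (t d))).det =
      ∑ σ : Equiv.Perm (Fin l), ((Equiv.Perm.sign σ : ℤ) : ℝ) *
        (BB l m hlm A (fun d c => t d ^ h (σ d) * Q c (t d))).det := by
    intro t
    rw [PD, Matrix.det_apply', Finset.sum_mul]
    refine Finset.sum_congr rfl fun σ _ => ?_
    rw [mul_assoc, ← BB_det_mul]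
    rfl
  simp_rw [h1]
  exact integrable_finsetSum _ fun σ _ =>
    (BB_integrable l m hlm A (fun d c s => s ^ h (σ d) * Q c s) (fun d c => hQ (σ d) c)).const_mul _

theorem VdmF_eq_PD {n : ℕ} (x : Fin n → ℝ) : VdmF x = PD (fun i : Fin n => (i : ℕ)) x := by
  rw [VdmF_eq_det, ← Matrix.det_transpose]; rfl

theorem continuous_VdmF {n : ℕ} : Continuous (VdmF (n := n)) := by
  unfold VdmF; fun_prop

theorem Phi_integrable (l m : ℕ) (hlm : l < m) (w : ℝ → ℝ) (h0 : ∀ x ≤ 0, w x = 0)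
    (hm : Measurable w) (hi : ∀ k < l, Integrable (fun x => x ^ k * w x))
    (a : Fin m → ℝ) (ha : ∀ i, a i ≠ 0) : Integrable (Phi l m hlm w a) := by
  have := PD_mul_BB_integrable l m hlm.le (fun b c => a c ^ (b : ℕ))
    (fun c s => omegaTildeLt m l w s (a c)) (fun i : Fin l => (i : ℕ))
    (fun d c => (omegaTilde_main m l hlm w h0 hm (d : ℕ) (hi d d.isLt) (a c) (ha c)).2.1)
  refine this.congr (Eventually.of_forall fun t => ?_)
  simp only [Phi, VdmF_eq_PD]

theorem PD_row_perm {n : ℕ} (h : Fin n → ℕ) (x : Fin n → ℝ) (σ : Equiv.Perm (Fin n)) :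
    PD (h ∘ σ) x = (Equiv.Perm.sign σ : ℤ) * PD h x := by
  unfold PD
  rw [← Matrix.det_permute]
  congr 1

theorem symMon_VdmF {l : ℕ} (α : Fin l → ℕ) (y : Fin l → ℝ) :
    symMon α y * VdmF y = ∑ τ : Equiv.Perm (Fin l), ((Equiv.Perm.sign τ : ℤ) : ℝ) *
      PD (fun i => α i + (τ i : ℕ)) y := by
  have h1 : ∀ τ : Equiv.Perm (Fin l), PD (fun i => α i + (τ i : ℕ)) y =
      ∑ σ : Equiv.Perm (Fin l), ((Equiv.Perm.sign σ : ℤ) : ℝ) *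
        ((∏ i, y (σ i) ^ α i) * ∏ i, y (σ i) ^ (τ i : ℕ)) := by
    intro τ
    rw [PD, ← Matrix.det_transpose, Matrix.det_apply']
    refine Finset.sum_congr rfl fun σ _ => ?_
    rw [← Finset.prod_mul_distrib]
    congr 1
    refine Finset.prod_congr rfl fun i _ => ?_
    simp [pow_add]
  have h2 : ∀ σ : Equiv.Perm (Fin l), ∑ τ : Equiv.Perm (Fin l), ((Equiv.Perm.sign τ : ℤ) : ℝ) *
      ∏ i, y (σ i) ^ (τ i : ℕ) = ((Equiv.Perm.sign σ : ℤ) : ℝ) * VdmF y := by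
    intro σ
    rw [← VdmF_perm, VdmF_eq_det, ← Matrix.det_transpose, Matrix.det_apply']
    rfl
  simp_rw [h1, Finset.mul_sum]
  rw [Finset.sum_comm, symMon, Finset.sum_mul]
  refine Finset.sum_congr rfl fun σ _ => ?_
  have h3 : ∑ τ : Equiv.Perm (Fin l), ((Equiv.Perm.sign τ : ℤ) : ℝ) * (((Equiv.Perm.sign σ : ℤ) : ℝ) *
        ((∏ i, y (σ i) ^ α i) * ∏ i, y (σ i) ^ (τ i : ℕ))) =
      ((Equiv.Perm.sign σ : ℤ) : ℝ) * (∏ i, y (σ i) ^ α i) *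
        ∑ τ : Equiv.Perm (Fin l), ((Equiv.Perm.sign τ : ℤ) : ℝ) * ∏ i, y (σ i) ^ (τ i : ℕ) := by
    rw [Finset.mul_sum]
    refine Finset.sum_congr rfl fun τ _ => ?_
    ring
  rw [h3, h2]
  rcases Int.units_eq_one_or (Equiv.Perm.sign σ) with h | h <;> simp [h]

/-- Two continuous functions that agree after multiplication by the Vandermonde agree. -/
theorem eq_of_mul_VdmF {l : ℕ} (f g : (Fin l → ℝ) → ℝ) (hf : Continuous f) (hg : Continuous g)
    (h : ∀ y, f y * VdmF y = g y * VdmF y) (y : Fin l → ℝ) : f y = g y := by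
  let c : ℝ → Fin l → ℝ := fun ε i => y i + ε * (i : ℕ)
  have hc : Continuous c := by dsimp only [c]; fun_prop
  have hc0 : c 0 = y := by ext i; simp [c]
  have hne : ∀ᶠ ε in nhdsWithin (0 : ℝ) (Set.Ioi 0), VdmF (c ε) ≠ 0 := by
    have hP : ∀ i j : Fin l, j ≠ i → ∀ᶠ ε in nhdsWithin (0 : ℝ) (Set.Ioi 0), c ε i - c ε j ≠ 0 := by
      intro i j hij
      by_cases hy : y i = y j
      · filter_upwards [self_mem_nhdsWithin] with ε hε
        have : c ε i - c ε j = ε * (((i : ℕ) : ℝ) - ((j : ℕ) : ℝ)) := by simp [c, hy]; ring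
        rw [this]
        refine mul_ne_zero (ne_of_gt hε) (sub_ne_zero.2 ?_)
        intro hh
        exact hij (Fin.ext (by exact_mod_cast hh.symm))
      · have h1 : Continuous fun ε => c ε i - c ε j := by fun_prop
        have h2 : (fun ε => c ε i - c ε j) 0 ≠ 0 := by
          simp only [hc0]; exact sub_ne_zero.2 hy
        exact nhdsWithin_le_nhds (h1.continuousAt.eventually_ne h2)
    have hall : ∀ᶠ ε in nhdsWithin (0 : ℝ) (Set.Ioi 0), ∀ i j : Fin l, j ≠ i → c ε i - c ε j ≠ 0 := by
      rw [eventually_all]; intro i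
      rw [eventually_all]; intro j
      by_cases hij : j ≠ i
      · filter_upwards [hP i j hij] with ε hε _ using hε
      · exact Eventually.of_forall fun ε h => absurd h hij
    filter_upwards [hall] with ε hε
    exact Finset.prod_ne_zero_iff.2 fun i _ => Finset.prod_ne_zero_iff.2 fun j hj =>
      hε i j (ne_of_lt (Finset.mem_Iio.1 hj))
  have t1 : Tendsto (fun ε => f (c ε)) (nhdsWithin (0 : ℝ) (Set.Ioi 0)) (nhds (f y)) := by
    have := (hf.comp hc).tendsto 0
    simp only [Function.comp, hc0] at this
    exact this.mono_left nhdsWithin_le_nhds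
  have t2 : Tendsto (fun ε => g (c ε)) (nhdsWithin (0 : ℝ) (Set.Ioi 0)) (nhds (g y)) := by
    have := (hg.comp hc).tendsto 0
    simp only [Function.comp, hc0] at this
    exact this.mono_left nhdsWithin_le_nhds
  refine tendsto_nhds_unique (t1.congr' ?_) t2
  filter_upwards [hne] with ε hε
  exact mul_right_cancel₀ hε (h _)

theorem tsupport_negxd (w : ℝ → ℝ) (b : ℕ) : tsupport (negxdOp^[b] w) ⊆ tsupport w := by
  induction b generalizing w with
  | zero => exact subset_rfl
  | succ b ih =>
    rw [Function.iterate_succ_apply]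
    refine (ih _).trans ?_
    have hsub : tsupport (negxdOp w) ⊆ tsupport (deriv w) := by
      apply closure_mono
      intro x hx hc
      apply hx
      simp [negxdOp, hc]
    exact hsub.trans tsupport_deriv_subset

theorem Psi_support (l : ℕ) (w : ℝ → ℝ) (x : Fin l → ℝ) (hx : Psi l w x ≠ 0) :
    x ∈ Set.pi Set.univ (fun _ : Fin l => tsupport w) := by
  intro c _
  by_contra hc
  apply hx
  unfold Psi
  rw [Matrix.det_eq_zero_of_column_eq_zero c, mul_zero]
  intro b
  by_contra h
  exact hc (tsupport_negxd w b (subset_tsupport _ h))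

theorem Psi_continuous (l : ℕ) (w : ℝ → ℝ) (hw : WW (l - 1) w) : Continuous (Psi l w) := by
  refine continuous_VdmF.mul (Continuous.matrix_det ?_)
  refine continuous_matrix fun b c => ?_
  exact (hw.iter' b.isLt).1.continuous.comp (continuous_apply c)

theorem Psi_integrable (l : ℕ) (w : ℝ → ℝ) (hw : WW (l - 1) w) : Integrable (Psi l w) := by
  refine (Psi_continuous l w hw).integrable_of_hasCompactSupport ?_
  refine HasCompactSupport.intro (isCompact_univ_pi fun _ : Fin l => hw.2.1) fun x hx => ?_
  by_contra h
  exact hx (Psi_support l w x h)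

theorem Phi_support (l m : ℕ) (hlm : l < m) (w : ℝ → ℝ) (R : ℝ)
    (hR : ∀ x, w x ≠ 0 → |x| ≤ R) (hR0 : 0 ≤ R) (a : Fin m → ℝ) (ha : ∀ i, a i ≠ 0) (t : Fin l → ℝ)
    (ht : Phi l m hlm w a t ≠ 0) (d : Fin l) : |t d| ≤ (∑ c, |a c|) * R := by
  by_contra hc
  push Not at hc
  apply ht
  unfold Phi
  rw [Matrix.det_eq_zero_of_row_eq_zero (e2 l m hlm.le (Sum.inr d)), mul_zero]
  intro c
  rw [BB_inr]
  unfold omegaTildeLt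
  rw [setIntegral_eq_zero_of_forall_eq_zero, mul_zero]
  intro u hu
  have : w (t d / (a c * u)) = 0 := by
    by_contra h
    have h1 := hR _ h
    rw [abs_div, abs_mul, abs_of_pos hu.1, div_le_iff₀ (mul_pos (abs_pos.2 (ha c)) hu.1)] at h1
    have h2 : |a c| ≤ ∑ c, |a c| :=
      Finset.single_le_sum (f := fun c => |a c|) (fun _ _ => abs_nonneg _) (Finset.mem_univ c)
    have h3 : |a c| * u ≤ ∑ c, |a c| := by
      have := abs_nonneg (a c)
      nlinarith [hu.2, hu.1]
    nlinarith
  rw [this]; simp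

/-- the constant -/
def Kc (l m : ℕ) : ℝ := ∏ j ∈ Finset.range l, ((m - (j + 1)).factorial : ℝ) / ((m - l).factorial : ℝ)

theorem E_integrable (l m : ℕ) (hlm : l < m) (a : Fin m → ℝ) (w : ℝ → ℝ) (hw : WW (l - 1) w)
    (f : (Fin l → ℝ) → ℝ) (hf : Continuous f) (hs : ∀ (σ : Equiv.Perm (Fin l)) v, f (v ∘ σ) = f v) :
    Integrable (fun p : (Fin l → ℝ) × UG m =>
      f (eigs (GG l m hlm a p.1 (p.2 : Matrix (Fin m) (Fin m) ℂ))) * Psi l w p.1)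
      (volume.prod (hU m)) := by
  obtain ⟨R, hR⟩ := eigs_bound l m hlm a _ (isCompact_univ_pi fun _ : Fin l => hw.2.1)
  exact sw_integrable (volume.prod (hU m))
    (fun p : (Fin l → ℝ) × UG m => eigs (GG l m hlm a p.1 (p.2 : Matrix (Fin m) (Fin m) ℂ)))
    (fun p => Psi l w p.1) ((Psi_integrable l w hw).comp_fst _) R
    (fun p hp i => hR p.1 (Psi_support l w p.1 hp) p.2 i) f hf
    (measurable_feigs' l m hlm a f hf.measurable hs).aestronglyMeasurable

theorem schur_case (l m : ℕ) (hlm : l < m) (a : Fin m → ℝ) (ha0 : ∀ i, a i ≠ 0)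
    (ha : Function.Injective a) (w : ℝ → ℝ) (hw : WW (l - 1) w) (h : Fin l → ℕ) (hh : StrictMono h) :
    ∃ S : (Fin l → ℝ) → ℝ, Continuous S ∧ (∀ (σ : Equiv.Perm (Fin l)) y, S (y ∘ σ) = S y) ∧
      (∀ y, S y * VdmF y = PD h y) ∧
      ∫ p : (Fin l → ℝ) × UG m, S (eigs (GG l m hlm a p.1 (p.2 : Matrix (Fin m) (Fin m) ℂ))) *
        (VdmF a * Psi l w p.1) ∂(volume.prod (hU m)) =
      ∫ t, S t * (Kc l m * Phi l m hlm w a t) := by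
  obtain ⟨S, hS, hsym, hV, hA⟩ := schur_avg l m hlm h hh
  refine ⟨S, hS, hsym, hV, ?_⟩
  have hVh : 0 < VdmF (fun i => (h i : ℝ)) := VdmF_pos _ fun i j hij => by
    exact_mod_cast hh hij
  have hE := VdmF_hExt l m hlm h hh
  have hVE : VdmF (fun i => (hExt l m hlm h i : ℝ)) ≠ 0 := by
    intro h0
    rw [h0, zero_mul] at hE
    have : 0 < (∏ b ∈ Finset.range (m - l), (b.factorial : ℝ)) * (∏ j, ((h j + (m - l)).factorial : ℝ)) *
        VdmF (fun i => (h i : ℝ)) := by positivity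
    linarith
  have hIntg := E_integrable l m hlm a w hw S hS hsym
  have L1 : ∫ p : (Fin l → ℝ) × UG m, S (eigs (GG l m hlm a p.1 (p.2 : Matrix (Fin m) (Fin m) ℂ))) *
        Psi l w p.1 ∂(volume.prod (hU m)) = ∫ x, (∫ v : UG m,
          S (eigs (GG l m hlm a x (v : Matrix (Fin m) (Fin m) ℂ))) ∂(hU m)) * Psi l w x := by
    rw [integral_prod _ hIntg]
    refine integral_congr_ae (Eventually.of_forall fun x => ?_)
    exact integral_mul_const (μ := hU m) (Psi l w x) (fun v : UG m => S (eigs (GG l m hlm a x (v : Matrix (Fin m) (Fin m) ℂ))))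
  have L2 : (∫ x, (∫ v : UG m,
          S (eigs (GG l m hlm a x (v : Matrix (Fin m) (Fin m) ℂ))) ∂(hU m)) * Psi l w x) *
        (VdmF a * VdmF (fun i => (hExt l m hlm h i : ℝ))) =
      (VdmF (fun i : Fin m => ((i : ℕ) : ℝ)) * PD (hExt l m hlm h) a) *
        ((l.factorial : ℝ) * ((∏ d, ∫ s, s ^ h d * w s) * VdmF (fun i => (h i : ℝ)))) := by
    rw [← Psi_moment l w hw h, ← integral_mul_const, ← integral_const_mul]
    refine integral_congr_ae (Eventually.of_forall fun x => ?_)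
    by_cases hx : ∀ i, 0 ≤ x i
    · have := hA a x ha hx
      simp only [Psi]
      linear_combination (VdmF x * Matrix.det (Matrix.of fun b c : Fin l => (negxdOp^[(b : ℕ)] w) (x c))) * this
        + (VdmF (fun i : Fin m => ((i : ℕ) : ℝ)) * PD (hExt l m hlm h) a *
          Matrix.det (Matrix.of fun b c : Fin l => (negxdOp^[(b : ℕ)] w) (x c))) * hV x
    · have hdet : Matrix.det (Matrix.of fun b c : Fin l => (negxdOp^[(b : ℕ)] w) (x c)) = 0 := by
        push Not at hx
        obtain ⟨i, hi⟩ := hx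
        apply Matrix.det_eq_zero_of_column_eq_zero i
        intro b
        exact (hw.iter' b.isLt).zero _ hi.le
      simp only [Psi, hdet, mul_zero, zero_mul]
  have R1 : ∫ t, S t * (Kc l m * Phi l m hlm w a t) = Kc l m * ((l.factorial : ℝ) * ((∏ d, (((h d).factorial : ℝ) * (m - l).factorial / (h d + (m - l)).factorial)
      * ∫ s, s ^ h d * w s) * PD (hExt l m hlm h) a)) := by
    rw [← Phi_moment l m hlm w (fun x hx => hw.zero x hx) hw.1.continuous.measurable h
      (fun d => hw.integrable (fun x => x ^ h d) (by fun_prop)) a ha0, ← integral_const_mul]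
    refine integral_congr_ae (Eventually.of_forall fun t => ?_)
    simp only [Phi]
    rw [← hV t]; ring
  have hprod : (∏ d, (((h d).factorial : ℝ) * (m - l).factorial / (h d + (m - l)).factorial)
      * ∫ s, s ^ h d * w s) * (∏ j, ((h j + (m - l)).factorial : ℝ)) =
      (∏ d, ((h d).factorial : ℝ)) * ((m - l).factorial : ℝ) ^ l * ∏ d, ∫ s, s ^ h d * w s := by
    have : ((m - l).factorial : ℝ) ^ l = ∏ d : Fin l, ((m - l).factorial : ℝ) := by simp
    rw [this, ← Finset.prod_mul_distrib, ← Finset.prod_mul_distrib, ← Finset.prod_mul_distrib]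
    refine Finset.prod_congr rfl fun d _ => ?_
    have : ((h d + (m - l)).factorial : ℝ) ≠ 0 := by positivity
    field_simp
  have hK := K_const l m hlm
  rw [← VdmF_id m] at hK
  have e0 : (fun p : (Fin l → ℝ) × UG m => S (eigs (GG l m hlm a p.1 (p.2 : Matrix (Fin m) (Fin m) ℂ))) *
        (VdmF a * Psi l w p.1)) = fun p => VdmF a * (S (eigs (GG l m hlm a p.1 (p.2 : Matrix (Fin m) (Fin m) ℂ))) *
        Psi l w p.1) := by ext p; ring
  rw [e0, integral_const_mul, R1, L1]
  apply mul_right_cancel₀ hVE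
  have hP1 : (∏ j, ((h j + (m - l)).factorial : ℝ)) ≠ 0 := by positivity
  have hP2 : (∏ j, ((h j).factorial : ℝ)) ≠ 0 := by positivity
  apply mul_right_cancel₀ hP1
  apply mul_right_cancel₀ hP2
  change Kc l m * _ = _ at hK
  generalize (∏ j, ((h j + (m - l)).factorial : ℝ)) = P1 at *
  generalize (∏ j, ((h j).factorial : ℝ)) = P2 at *
  generalize (∫ x, (∫ v : UG m,
          S (eigs (GG l m hlm a x (v : Matrix (Fin m) (Fin m) ℂ))) ∂(hU m)) * Psi l w x) = I at *
  generalize (∏ d, (((h d).factorial : ℝ) * (m - l).factorial / (h d + (m - l)).factorial)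
      * ∫ s, s ^ h d * w s) = Q at *
  generalize (∏ d, ∫ s, s ^ h d * w s) = Mo at *
  generalize VdmF (fun i => (hExt l m hlm h i : ℝ)) = VE at *
  generalize VdmF (fun i => (h i : ℝ)) = Vh at *
  generalize VdmF (fun i : Fin m => ((i : ℕ) : ℝ)) = Vi at *
  generalize PD (hExt l m hlm h) a = Pa at *
  generalize (l.factorial : ℝ) = lf at *
  generalize ((m - l).factorial : ℝ) ^ l = ml at *
  generalize (∏ b ∈ Finset.range (m - l), (b.factorial : ℝ)) = Bm at *
  generalize Kc l m = KK at *
  linear_combination P1 * P2 * L2 - Pa * lf * Mo * Vh * P1 * P2 * hK - KK * lf * Pa * VE * P2 * hprod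
    - KK * lf * Pa * P2 * ml * Mo * hE

theorem gen_case (l m : ℕ) (hlm : l < m) (a : Fin m → ℝ) (ha0 : ∀ i, a i ≠ 0)
    (ha : Function.Injective a) (w : ℝ → ℝ) (hw : WW (l - 1) w) (h : Fin l → ℕ) :
    ∃ S : (Fin l → ℝ) → ℝ, Continuous S ∧ (∀ (σ : Equiv.Perm (Fin l)) y, S (y ∘ σ) = S y) ∧
      (∀ y, S y * VdmF y = PD h y) ∧
      ∫ p : (Fin l → ℝ) × UG m, S (eigs (GG l m hlm a p.1 (p.2 : Matrix (Fin m) (Fin m) ℂ))) *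
        (VdmF a * Psi l w p.1) ∂(volume.prod (hU m)) =
      ∫ t, S t * (Kc l m * Phi l m hlm w a t) := by
  by_cases hi : Function.Injective h
  · have hmono : StrictMono (h ∘ Tuple.sort h) :=
      (Tuple.monotone_sort h).strictMono_of_injective (hi.comp (Tuple.sort h).injective)
    obtain ⟨S, hS, hsym, hV, hE⟩ := schur_case l m hlm a ha0 ha w hw _ hmono
    refine ⟨fun y => ((Equiv.Perm.sign (Tuple.sort h) : ℤ) : ℝ) * S y, hS.const_mul _, ?_, ?_, ?_⟩
    · intro σ y; simp only [hsym]
    · intro y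
      rw [mul_assoc, hV, PD_row_perm, ← mul_assoc]
      rcases Int.units_eq_one_or (Equiv.Perm.sign (Tuple.sort h)) with h | h <;> simp [h]
    · simp only [mul_assoc]
      rw [integral_const_mul, integral_const_mul, hE]
  · refine ⟨fun _ => 0, continuous_const, fun _ _ => rfl, fun y => ?_, by simp⟩
    rw [zero_mul]
    simp only [Function.Injective] at hi
    push Not at hi
    obtain ⟨i, j, hij, hne⟩ := hi
    symm
    exact Matrix.det_zero_of_row_eq hne (by ext c; simp [hij])

theorem compact_case (l m : ℕ) (hlm : l < m) (a : Fin m → ℝ) (ha0 : ∀ i, a i ≠ 0)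
    (ha : Function.Injective a) (w : ℝ → ℝ) (hw : WW (l - 1) w) (f : (Fin l → ℝ) → ℝ)
    (hf : Continuous f) (hs : ∀ (σ : Equiv.Perm (Fin l)) v, f (v ∘ σ) = f v) :
    ∫ p : (Fin l → ℝ) × UG m, f (eigs (GG l m hlm a p.1 (p.2 : Matrix (Fin m) (Fin m) ℂ))) *
        (VdmF a * Psi l w p.1) ∂(volume.prod (hU m)) =
      ∫ t, f t * (Kc l m * Phi l m hlm w a t) := by
  obtain ⟨R, hR⟩ := eigs_bound l m hlm a _ (isCompact_univ_pi fun _ : Fin l => hw.2.1)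
  obtain ⟨R2, hR2⟩ := hw.2.1.isBounded.exists_norm_le
  have hPhi : Integrable (Phi l m hlm w a) := Phi_integrable l m hlm w (fun x hx => hw.zero x hx)
    hw.1.continuous.measurable (fun k _ => hw.integrable (fun x => x ^ k) (by fun_prop)) a ha0
  let R' := max R ((∑ c, |a c|) * max R2 0)
  have B1 : ∀ p : (Fin l → ℝ) × UG m, VdmF a * Psi l w p.1 ≠ 0 → ∀ i,
      |eigs (GG l m hlm a p.1 (p.2 : Matrix (Fin m) (Fin m) ℂ)) i| ≤ R' := fun p hp i =>
    (hR p.1 (Psi_support l w p.1 (right_ne_zero_of_mul hp)) p.2 i).trans (le_max_left _ _)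
  have B2 : ∀ t : Fin l → ℝ, Kc l m * Phi l m hlm w a t ≠ 0 → ∀ i, |t i| ≤ R' := fun t ht i =>
    (Phi_support l m hlm w (max R2 0) (fun x hx => (hR2 x (subset_tsupport _ hx)).trans (le_max_left _ _))
      (le_max_right _ _) a ha0 t (right_ne_zero_of_mul ht) i).trans (le_max_right _ _)
  have I1 : Integrable (fun p : (Fin l → ℝ) × UG m => VdmF a * Psi l w p.1) (volume.prod (hU m)) :=
    ((Psi_integrable l w hw).comp_fst _).const_mul _
  have I2 : Integrable (fun t => Kc l m * Phi l m hlm w a t) := hPhi.const_mul _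
  have M1 : ∀ g : (Fin l → ℝ) → ℝ, Continuous g → (∀ (σ : Equiv.Perm (Fin l)) v, g (v ∘ σ) = g v) →
      AEStronglyMeasurable (fun p : (Fin l → ℝ) × UG m =>
        g (eigs (GG l m hlm a p.1 (p.2 : Matrix (Fin m) (Fin m) ℂ)))) (volume.prod (hU m)) :=
    fun g hg hs => (measurable_feigs' l m hlm a g hg.measurable hs).aestronglyMeasurable
  refine sw_ext (volume.prod (hU m)) volume
    (fun p : (Fin l → ℝ) × UG m => eigs (GG l m hlm a p.1 (p.2 : Matrix (Fin m) (Fin m) ℂ)))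
    (fun t => t) (fun p => VdmF a * Psi l w p.1) (fun t => Kc l m * Phi l m hlm w a t) I1 I2 R' B1 B2
    M1 (fun g hg _ => hg.aestronglyMeasurable) (fun α => ?_) f hf hs
  choose S hSc hSs hSV hSE using gen_case l m hlm a ha0 ha w hw
  have key : ∀ y, symMon α y = ∑ τ : Equiv.Perm (Fin l), ((Equiv.Perm.sign τ : ℤ) : ℝ) *
      S (fun i => α i + (τ i : ℕ)) y := by
    refine eq_of_mul_VdmF _ _ (continuous_symMon α) ?_ ?_
    · exact continuous_finsetSum _ fun τ _ => (hSc _).const_mul _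
    · intro y
      rw [symMon_VdmF, Finset.sum_mul]
      refine Finset.sum_congr rfl fun τ _ => ?_
      rw [mul_assoc, hSV]
  simp only [key, Finset.sum_mul, mul_assoc]
  rw [integral_finsetSum, integral_finsetSum]
  · refine Finset.sum_congr rfl fun τ _ => ?_
    rw [integral_const_mul, integral_const_mul, hSE]
  · intro τ _
    exact (sw_integrable volume (fun t : Fin l → ℝ => t) _ I2 R' B2 _ (hSc _)
      (hSc _).aestronglyMeasurable).const_mul _
  · intro τ _
    exact (sw_integrable (volume.prod (hU m)) 
      (fun p : (Fin l → ℝ) × UG m => eigs (GG l m hlm a p.1 (p.2 : Matrix (Fin m) (Fin m) ℂ))) _ I1 R' B1 _ (hSc _)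
      (M1 _ (hSc _) (hSs _))).const_mul _

theorem negxd_eq (j : ℕ) (f : ℝ → ℝ) : negxdOp^[j] f = fun x => (-1) ^ j * (xdOp^[j] f) x := by
  induction j with
  | zero => ext x; simp
  | succ j ih =>
    ext x
    rw [Function.iterate_succ_apply', Function.iterate_succ_apply', ih]
    simp only [negxdOp, xdOp]
    rw [deriv_const_mul_field]
    ring

theorem xdOp_log (j : ℕ) : ∀ (f : ℝ → ℝ), ContDiffOn ℝ j f (Set.Ioi 0) → ∀ s,
    (xdOp^[j] f) (Real.exp s) = iteratedDeriv j (fun s => f (Real.exp s)) s := by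
  induction j with
  | zero => intro f _ s; simp
  | succ j ih =>
    intro f hf s
    have hopen : IsOpen (Set.Ioi (0:ℝ)) := isOpen_Ioi
    have h2 := (contDiffOn_succ_iff_deriv_of_isOpen (n := (j : WithTop ℕ∞)) hopen).1
      (by simpa using hf)
    have hx : ContDiffOn ℝ j (xdOp f) (Set.Ioi 0) := contDiffOn_id.mul h2.2.2
    rw [Function.iterate_succ_apply, ih _ hx, iteratedDeriv_succ']
    congr 1
    ext s
    have hd : HasDerivAt f (deriv f (Real.exp s)) (Real.exp s) :=
      ((h2.1 _ (Real.exp_pos s)).differentiableAt (hopen.mem_nhds (Real.exp_pos s))).hasDerivAt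
    have := hd.comp s (Real.hasDerivAt_exp s)
    rw [show (fun s => f (Real.exp s)) = f ∘ Real.exp from rfl, this.deriv, xdOp, mul_comm]

/-- the bump -/
def bmp : ContDiffBump (0 : ℝ) := ⟨1, 2, one_pos, one_lt_two⟩

/-- cutoff weights -/
def wc (ω : ℝ → ℝ) (n : ℕ) : ℝ → ℝ :=
  Set.indicator (Set.Ioi 0) fun x => ω x * bmp (((n : ℝ) + 1)⁻¹ * Real.log x)

theorem wc_zero (ω : ℝ → ℝ) (n : ℕ) (x : ℝ) (hx : x ≤ 0) : wc ω n x = 0 :=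
  Set.indicator_of_notMem (by simpa using hx) _

theorem wc_exp (ω : ℝ → ℝ) (n : ℕ) (s : ℝ) :
    wc ω n (Real.exp s) = ω (Real.exp s) * bmp (((n : ℝ) + 1)⁻¹ * s) := by
  unfold wc
  rw [Set.indicator_of_mem (Set.mem_Ioi.2 (Real.exp_pos s)), Real.log_exp]

theorem wc_support (ω : ℝ → ℝ) (n : ℕ) : Function.support (wc ω n) ⊆
    Set.Icc (Real.exp (-(2 * ((n : ℝ) + 1)))) (Real.exp (2 * ((n : ℝ) + 1))) := by
  intro x hx
  have hx0 : 0 < x := by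
    by_contra h
    exact hx (wc_zero ω n x (not_lt.1 h))
  have hb : bmp (((n : ℝ) + 1)⁻¹ * Real.log x) ≠ 0 := by
    intro h
    apply hx
    simp [wc, h]
  have h1 : (((n : ℝ) + 1)⁻¹ * Real.log x) ∈ Function.support bmp := hb
  rw [ContDiffBump.support_eq, Metric.mem_ball, dist_zero_right, norm_mul, Real.norm_eq_abs,
    Real.norm_eq_abs, abs_of_pos (by positivity : (0:ℝ) < ((n : ℝ) + 1)⁻¹)] at h1
  have h2 : |Real.log x| < 2 * ((n : ℝ) + 1) := by
    rw [inv_mul_lt_iff₀ (by positivity)] at h1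
    have : bmp.rOut = 2 := rfl
    rw [this] at h1; linarith
  rw [abs_lt] at h2
  constructor
  · rw [← Real.le_log_iff_exp_le hx0]; linarith
  · rw [← Real.log_le_iff_le_exp hx0]; linarith

theorem wc_tsupport (ω : ℝ → ℝ) (n : ℕ) : tsupport (wc ω n) ⊆
    Set.Icc (Real.exp (-(2 * ((n : ℝ) + 1)))) (Real.exp (2 * ((n : ℝ) + 1))) :=
  closure_minimal (wc_support ω n) isClosed_Icc

theorem wc_contDiffAt (p : ℕ) (ω : ℝ → ℝ) (hω : ContDiffOn ℝ p ω (Set.Ioi 0)) (n : ℕ) (x : ℝ)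
    (hx : 0 < x) : ContDiffAt ℝ p (wc ω n) x := by
  have h1 : ContDiffAt ℝ p (fun x => ω x * bmp (((n : ℝ) + 1)⁻¹ * Real.log x)) x := by
    refine (hω.contDiffAt (Ioi_mem_nhds hx)).mul ?_
    have : ContDiffAt ℝ p (fun x => ((n : ℝ) + 1)⁻¹ * Real.log x) x :=
      contDiffAt_const.mul (Real.contDiffAt_log.2 hx.ne')
    exact (bmp.contDiff.contDiffAt).comp x this
  refine h1.congr_of_eventuallyEq ?_
  filter_upwards [Ioi_mem_nhds hx] with y hy
  exact Set.indicator_of_mem hy _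

theorem wc_WW (p : ℕ) (ω : ℝ → ℝ) (hω : ContDiffOn ℝ p ω (Set.Ioi 0)) (n : ℕ) : WW p (wc ω n) := by
  refine ⟨?_, ?_, ?_⟩
  · rw [contDiff_iff_contDiffAt]
    intro x
    by_cases hx : 0 < x
    · exact wc_contDiffAt p ω hω n x hx
    · have : wc ω n =ᶠ[nhds x] fun _ => 0 := by
        have h1 : x < Real.exp (-(2 * ((n : ℝ) + 1))) := lt_of_le_of_lt (not_lt.1 hx) (Real.exp_pos _)
        filter_upwards [Iio_mem_nhds h1] with y hy
        by_contra h
        exact absurd (wc_support ω n h).1 (not_le.2 hy)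
      exact contDiffAt_const.congr_of_eventuallyEq this
  · exact IsCompact.of_isClosed_subset isCompact_Icc (isClosed_tsupport _) (wc_tsupport ω n)
  · exact (wc_tsupport ω n).trans fun x hx => lt_of_lt_of_le (Real.exp_pos _) hx.1

theorem bmp_bound (l : ℕ) : ∃ C : ℝ, 0 ≤ C ∧ ∀ k < l, ∀ s, |iteratedDeriv k bmp s| ≤ C := by
  have h1 : ∀ k, ∃ C : ℝ, ∀ s, |iteratedDeriv k bmp s| ≤ C := by
    intro k
    have hc : Continuous (iteratedFDeriv ℝ k bmp) :=
      ContDiff.continuous_iteratedFDeriv (n := k) (le_refl _) bmp.contDiff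
    obtain ⟨C, hC⟩ := hc.bounded_above_of_compact_support (bmp.hasCompactSupport.iteratedFDeriv k)
    refine ⟨C, fun s => ?_⟩
    have := hC s
    rwa [norm_iteratedFDeriv_eq_norm_iteratedDeriv] at this
  choose C hC using h1
  refine ⟨∑ k ∈ Finset.range l, |C k|, by positivity, fun k hk s => ?_⟩
  refine ((hC k s).trans (le_abs_self _)).trans ?_
  exact Finset.single_le_sum (f := fun k => |C k|) (fun _ _ => abs_nonneg _) (Finset.mem_range.2 hk)

theorem wc_bound (l : ℕ) (ω : ℝ → ℝ) (hω : ContDiffOn ℝ (l - 1 : ℕ) ω (Set.Ioi 0)) :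
    ∃ C : ℝ, 0 ≤ C ∧ ∀ n, ∀ j < l, ∀ x, 0 < x → |(negxdOp^[j] (wc ω n)) x| ≤
      C * ∑ i ∈ Finset.range l, |(xdOp^[i] ω) x| := by
  obtain ⟨C, hC0, hC⟩ := bmp_bound l
  refine ⟨2 ^ l * C, by positivity, fun n j hj x hx => ?_⟩
  obtain ⟨s, rfl⟩ : ∃ s, x = Real.exp s := ⟨Real.log x, (Real.exp_log hx).symm⟩
  have hle : ((j : ℕ) : WithTop ℕ∞) ≤ ((l - 1 : ℕ) : WithTop ℕ∞) := by
    exact_mod_cast (by omega : j ≤ l - 1)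
  have hle' : ∀ i ≤ j, ((i : ℕ) : WithTop ℕ∞) ≤ ((l - 1 : ℕ) : WithTop ℕ∞) := fun i hi => by
    exact_mod_cast (by omega : i ≤ l - 1)
  have hwj : ContDiffOn ℝ j (wc ω n) (Set.Ioi 0) := ((wc_WW _ ω hω n).1.of_le hle).contDiffOn
  have hg : ContDiff ℝ j (fun s => ω (Real.exp s)) := by
    have : ContDiffOn ℝ j (ω ∘ Real.exp) Set.univ :=
      (hω.of_le hle).comp Real.contDiff_exp.contDiffOn fun s _ => Real.exp_pos s
    exact contDiffOn_univ.1 this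
  have hb : ContDiff ℝ j (fun s => bmp (((n : ℝ) + 1)⁻¹ * s)) :=
    bmp.contDiff.comp (contDiff_const.mul contDiff_id)
  rw [negxd_eq]
  simp only [abs_mul, abs_pow, abs_neg, abs_one, one_pow, one_mul]
  rw [xdOp_log j _ hwj]
  simp_rw [wc_exp]
  have hmul := iteratedDeriv_mul (n := j) (x := s) hg.contDiffAt hb.contDiffAt
  rw [show (fun s => ω (Real.exp s) * bmp (((n : ℝ) + 1)⁻¹ * s)) =
    (fun s => ω (Real.exp s)) * (fun s => bmp (((n : ℝ) + 1)⁻¹ * s)) from rfl, hmul]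
  refine (Finset.abs_sum_le_sum_abs _ _).trans ?_
  rw [Finset.mul_sum]
  have hn1 : |((n : ℝ) + 1)⁻¹| ≤ 1 := by
    rw [abs_of_pos (by positivity)]
    exact inv_le_one_of_one_le₀ (by linarith [Nat.cast_nonneg (α := ℝ) n])
  calc _ ≤ ∑ i ∈ Finset.range (j + 1), 2 ^ l * C * |(xdOp^[i] ω) (Real.exp s)| := by
        refine Finset.sum_le_sum fun i hi => ?_
        have hi' : i ≤ j := by simpa [Nat.lt_succ_iff] using hi
        rw [xdOp_log i ω (hω.of_le (hle' i hi'))]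
        have e1 : |iteratedDeriv (j - i) (fun s => bmp (((n : ℝ) + 1)⁻¹ * s)) s| ≤ C := by
          rw [iteratedDeriv_comp_const_mul (f := bmp) bmp.contDiff, abs_mul, abs_pow]
          calc _ ≤ 1 * C := mul_le_mul (pow_le_one₀ (abs_nonneg _) hn1) (hC _ (by omega) _)
                (abs_nonneg _) zero_le_one
            _ = C := one_mul _
        have e2 : ((j.choose i : ℕ) : ℝ) ≤ 2 ^ l := by
          have h1 : j.choose i ≤ 2 ^ j := Nat.choose_le_two_pow _ _
          have h2 : 2 ^ j ≤ 2 ^ l := Nat.pow_le_pow_right (by norm_num) hj.le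
          exact_mod_cast h1.trans h2
        rw [abs_mul, abs_mul, Nat.abs_cast]
        have e3 := abs_nonneg (iteratedDeriv i (fun s => ω (Real.exp s)) s)
        calc _ ≤ 2 ^ l * |iteratedDeriv i (fun s => ω (Real.exp s)) s| * C := by gcongr
          _ = _ := by ring
    _ ≤ _ := by
        refine Finset.sum_le_sum_of_subset_of_nonneg ?_ fun i _ _ => by positivity
        intro i hi; simp at hi ⊢; omega

/-- the extension by zero -/
def om0 (ω : ℝ → ℝ) : ℝ → ℝ := Set.indicator (Set.Ioi 0) ω

theorem negxd_nonpos (f : ℝ → ℝ) (hf : ∀ x ≤ 0, f x = 0) (j : ℕ) : ∀ x ≤ 0, (negxdOp^[j] f) x = 0 := by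
  induction j with
  | zero => exact hf
  | succ j ih =>
    intro x hx
    rw [Function.iterate_succ_apply']
    rcases hx.lt_or_eq with h | h
    · have : (negxdOp^[j] f) =ᶠ[nhds x] fun _ => 0 := by
        filter_upwards [Iio_mem_nhds h] with y hy using ih y (le_of_lt hy)
      simp [negxdOp, this.deriv_eq]
    · simp [negxdOp, h]

theorem xd_congr (f g : ℝ → ℝ) (U : Set ℝ) (hU : IsOpen U) (h : ∀ x ∈ U, f x = g x) (j : ℕ) :
    ∀ x ∈ U, (negxdOp^[j] f) x = (negxdOp^[j] g) x := by
  induction j with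
  | zero => exact h
  | succ j ih =>
    intro x hx
    rw [Function.iterate_succ_apply', Function.iterate_succ_apply']
    have : (negxdOp^[j] f) =ᶠ[nhds x] (negxdOp^[j] g) := by
      filter_upwards [hU.mem_nhds hx] with y hy using ih y hy
    simp only [negxdOp, this.deriv_eq]

theorem om0_zero (ω : ℝ → ℝ) (x : ℝ) (hx : x ≤ 0) : om0 ω x = 0 :=
  Set.indicator_of_notMem (by simpa using hx) _

theorem wc_eventually (ω : ℝ → ℝ) (j : ℕ) (x : ℝ) :
    ∀ᶠ n in atTop, (negxdOp^[j] (wc ω n)) x = (negxdOp^[j] (om0 ω)) x := by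
  by_cases hx : 0 < x
  · obtain ⟨N, hN⟩ := exists_nat_gt |Real.log x|
    filter_upwards [eventually_ge_atTop N] with n hn
    have hnN : (N : ℝ) ≤ n := by exact_mod_cast hn
    have hlog : |Real.log x| < (n : ℝ) + 1 := by linarith
    let U : Set ℝ := Set.Ioo (Real.exp (-((n : ℝ) + 1))) (Real.exp ((n : ℝ) + 1))
    refine xd_congr _ _ U isOpen_Ioo (fun y hy => ?_) j x ?_
    · have hy0 : 0 < y := (Real.exp_pos _).trans hy.1
      have h1 : |Real.log y| < (n : ℝ) + 1 := by
        rw [abs_lt]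
        exact ⟨(Real.lt_log_iff_exp_lt hy0).2 hy.1, (Real.log_lt_iff_lt_exp hy0).2 hy.2⟩
      have h2 : bmp (((n : ℝ) + 1)⁻¹ * Real.log y) = 1 := by
        apply bmp.one_of_mem_closedBall
        rw [Metric.mem_closedBall, dist_zero_right, norm_mul, Real.norm_eq_abs, Real.norm_eq_abs,
          abs_of_pos (by positivity : (0:ℝ) < ((n : ℝ) + 1)⁻¹), inv_mul_le_iff₀ (by positivity)]
        have : bmp.rIn = 1 := rfl
        rw [this]; linarith
      simp [wc, om0, Set.indicator_of_mem (Set.mem_Ioi.2 hy0), h2]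
    · rw [abs_lt] at hlog
      exact ⟨(Real.lt_log_iff_exp_lt hx).1 hlog.1, (Real.log_lt_iff_lt_exp hx).1 hlog.2⟩
  · refine Eventually.of_forall fun n => ?_
    rw [negxd_nonpos _ (wc_zero ω n) j x (not_lt.1 hx), negxd_nonpos _ (om0_zero ω) j x (not_lt.1 hx)]

theorem abs_PD_le {n : ℕ} (h : Fin n → ℕ) (x : Fin n → ℝ) :
    |PD h x| ≤ ∑ σ : Equiv.Perm (Fin n), ∏ c, |x c| ^ h (σ c) := by
  rw [PD, Matrix.det_apply']
  refine (Finset.abs_sum_le_sum_abs _ _).trans (Finset.sum_le_sum fun σ _ => ?_)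
  rw [abs_mul, Finset.abs_prod]
  have : |((Equiv.Perm.sign σ : ℤ) : ℝ)| = 1 := by
    rcases Int.units_eq_one_or (Equiv.Perm.sign σ) with h | h <;> simp [h]
  rw [this, one_mul]
  refine (Finset.prod_congr rfl fun c _ => ?_).le
  simp [abs_pow]

theorem abs_det_le {n : ℕ} (M : Matrix (Fin n) (Fin n) ℝ) (g : Fin n → ℝ)
    (h : ∀ b c, |M b c| ≤ g c) : |M.det| ≤ (n.factorial : ℝ) * ∏ c, g c := by
  rw [Matrix.det_apply']
  refine (Finset.abs_sum_le_sum_abs _ _).trans ?_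
  have : ∀ σ ∈ (Finset.univ : Finset (Equiv.Perm (Fin n))),
      |((Equiv.Perm.sign σ : ℤ) : ℝ) * ∏ i, M (σ i) i| ≤ ∏ c, g c := by
    intro σ _
    have h1 : |((Equiv.Perm.sign σ : ℤ) : ℝ)| = 1 := by
      rcases Int.units_eq_one_or (Equiv.Perm.sign σ) with h | h <;> simp [h]
    rw [abs_mul, Finset.abs_prod, h1, one_mul]
    exact Finset.prod_le_prod (fun _ _ => abs_nonneg _) fun c _ => h _ _
  refine (Finset.sum_le_sum this).trans ?_
  rw [Finset.sum_const, Finset.card_univ, Fintype.card_perm, Fintype.card_fin, nsmul_eq_mul]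

def Gd (l : ℕ) (ω : ℝ → ℝ) (C : ℝ) : ℝ → ℝ :=
  Set.indicator (Set.Ioi 0) fun x => C * ∑ i ∈ range l, |(xdOp^[i] ω) x|

theorem Gd_int (l : ℕ) (ω : ℝ → ℝ) (hω : IsPolyaWeight l ω) (C : ℝ) (k : ℕ) (hk : k < l) :
    Integrable fun s => |s| ^ k * Gd l ω C s := by
  have h1 : IntegrableOn (fun x : ℝ => C * ∑ i ∈ range l, x ^ k * |(xdOp^[i] ω) x|) (Set.Ioi 0) := by
    refine Integrable.const_mul (integrable_finsetSum _ fun i hi => ?_) _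
    exact hω.2.2.2.1 i (Finset.mem_range.1 hi) (k + 1) (by omega) (by omega)
  rw [← integrable_indicator_iff measurableSet_Ioi] at h1
  refine h1.congr (Eventually.of_forall fun s => ?_)
  by_cases hs : s ∈ Set.Ioi (0 : ℝ)
  · simp only [Gd, Set.indicator_of_mem hs]
    rw [abs_of_pos hs, ← Finset.mul_sum]; ring
  · simp [Gd, Set.indicator_of_notMem hs]

def PsiB (l : ℕ) (G : ℝ → ℝ) (x : Fin l → ℝ) : ℝ :=
  ∑ σ : Equiv.Perm (Fin l), (l.factorial : ℝ) * ∏ c, (|x c| ^ (σ c : ℕ) * G (x c))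

theorem PsiB_int (l : ℕ) (G : ℝ → ℝ) (h : ∀ k < l, Integrable fun s => |s| ^ k * G s) :
    Integrable (PsiB l G) := by
  unfold PsiB
  refine integrable_finsetSum _ fun σ _ => Integrable.const_mul ?_ _
  exact Integrable.fintype_prod (f := fun (c : Fin l) s => |s| ^ (σ c : ℕ) * G s)
    (fun c => h _ (σ c).isLt)

theorem Psi_le (l : ℕ) (w G : ℝ → ℝ) (h : ∀ j < l, ∀ x, |(negxdOp^[j] w) x| ≤ G x) (x) :
    |Psi l w x| ≤ PsiB l G x := by
  unfold Psi PsiB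
  rw [abs_mul, VdmF_eq_PD]
  have h1 := abs_PD_le (fun i : Fin l => (i : ℕ)) x
  have h2 := abs_det_le (Matrix.of fun b c : Fin l => (negxdOp^[(b : ℕ)] w) (x c)) (fun c => G (x c))
    (fun b c => h b b.isLt _)
  refine (mul_le_mul h1 h2 (abs_nonneg _) (Finset.sum_nonneg fun σ _ =>
    Finset.prod_nonneg fun c _ => by positivity)).trans_eq ?_
  rw [Finset.sum_mul]
  refine Finset.sum_congr rfl fun σ _ => ?_
  rw [Finset.prod_mul_distrib]; ring

theorem Psi_wc_lim (l : ℕ) (ω : ℝ → ℝ) (x : Fin l → ℝ) :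
    ∀ᶠ n in atTop, Psi l (wc ω n) x = Psi l (om0 ω) x := by
  have : ∀ᶠ n in atTop, ∀ b c : Fin l, (negxdOp^[(b : ℕ)] (wc ω n)) (x c) =
      (negxdOp^[(b : ℕ)] (om0 ω)) (x c) := by
    rw [eventually_all]; intro b
    rw [eventually_all]; intro c
    exact wc_eventually ω b (x c)
  filter_upwards [this] with n hn
  unfold Psi
  congr 2
  ext b c
  exact hn b c

theorem Psi_dom (l : ℕ) (ω : ℝ → ℝ) (hω : IsPolyaWeight l ω) :
    ∃ H : (Fin l → ℝ) → ℝ, Integrable H ∧ ∀ n x, |Psi l (wc ω n) x| ≤ H x := by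
  obtain ⟨C, hC0, hC⟩ := wc_bound l ω hω.2.1
  refine ⟨PsiB l (Gd l ω C), PsiB_int l _ fun k hk => Gd_int l ω hω C k hk, fun n x => ?_⟩
  refine Psi_le l _ _ (fun j hj s => ?_) x
  by_cases hs : s ∈ Set.Ioi (0 : ℝ)
  · rw [Gd, Set.indicator_of_mem hs]
    exact hC n j hj s hs
  · rw [Gd, Set.indicator_of_notMem hs, negxd_nonpos _ (wc_zero ω n) j s (by simpa using hs), abs_zero]

theorem Psi_om0_int (l : ℕ) (ω : ℝ → ℝ) (hω : IsPolyaWeight l ω) : Integrable (Psi l (om0 ω)) := by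
  obtain ⟨H, hH, hb⟩ := Psi_dom l ω hω
  have hm : ∀ n, AEStronglyMeasurable (Psi l (wc ω n)) volume := fun n =>
    (Psi_continuous l _ (wc_WW (l - 1) ω hω.2.1 n)).aestronglyMeasurable
  have ht : ∀ x, Tendsto (fun n => Psi l (wc ω n) x) atTop (nhds (Psi l (om0 ω) x)) := fun x =>
    tendsto_const_nhds.congr' ((Psi_wc_lim l ω x).mono fun n h => h.symm)
  refine hH.mono' (aestronglyMeasurable_of_tendsto_ae _ hm (Eventually.of_forall ht))
    (Eventually.of_forall fun x => ?_)
  obtain ⟨n, hn⟩ := (Psi_wc_lim l ω x).exists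
  rw [← hn]
  exact hb n x

theorem lhs_lim (l m : ℕ) (ω : ℝ → ℝ) (hω : IsPolyaWeight l ω) (F : (Fin l → ℝ) × UG m → ℝ)
    (hF : Measurable F) (C : ℝ) (hC : ∀ p, |F p| ≤ C) (κ : ℝ) :
    Tendsto (fun n => ∫ p : (Fin l → ℝ) × UG m, F p * (κ * Psi l (wc ω n) p.1) ∂(volume.prod (hU m)))
      atTop (nhds (∫ p : (Fin l → ℝ) × UG m, F p * (κ * Psi l (om0 ω) p.1) ∂(volume.prod (hU m)))) := by
  obtain ⟨H, hH, hb⟩ := Psi_dom l ω hω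
  refine tendsto_integral_of_dominated_convergence (fun p => C * (|κ| * H p.1)) ?_ ?_ ?_ ?_
  · intro n
    refine hF.aestronglyMeasurable.mul (AEStronglyMeasurable.const_mul ?_ _)
    exact ((Psi_continuous l _ (wc_WW (l - 1) ω hω.2.1 n)).measurable.comp
      measurable_fst).aestronglyMeasurable
  · exact (((hH.const_mul _).const_mul _).comp_fst (hU m))
  · intro n
    refine Eventually.of_forall fun p => ?_
    rw [Real.norm_eq_abs, abs_mul, abs_mul]
    have h0 := hC p
    have := hb n p.1
    have h1 : 0 ≤ C := (abs_nonneg _).trans h0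
    gcongr
  · refine Eventually.of_forall fun p => ?_
    refine tendsto_const_nhds.congr' ((Psi_wc_lim l ω p.1).mono fun n h => ?_)
    dsimp only
    rw [h]

theorem om0_meas (ω : ℝ → ℝ) (hω : ContinuousOn ω (Set.Ioi 0)) : Measurable (om0 ω) := by
  have := ContinuousOn.measurable_piecewise (f := ω) (g := fun _ => (0 : ℝ)) hω
    continuousOn_const measurableSet_Ioi
  exact this

theorem om0_int (l : ℕ) (ω : ℝ → ℝ) (hω : IsPolyaWeight l ω) (k : ℕ) (hk : k < l) :
    Integrable fun x => x ^ k * om0 ω x := by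
  have h1 := hω.2.2.2.1 0 (by omega) (k + 1) (by omega) (by omega)
  rw [← integrable_indicator_iff measurableSet_Ioi] at h1
  refine h1.congr (Eventually.of_forall fun s => ?_)
  by_cases hs : s ∈ Set.Ioi (0 : ℝ)
  · simp only [om0, Set.indicator_of_mem hs, Function.iterate_zero, id, Nat.add_sub_cancel]
    rw [abs_of_nonneg (hω.1 s hs)]
  · simp [om0, Set.indicator_of_notMem hs]

theorem om0_nonneg (l : ℕ) (ω : ℝ → ℝ) (hω : IsPolyaWeight l ω) (x : ℝ) : 0 ≤ om0 ω x :=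
  Set.indicator_nonneg (fun x hx => hω.1 x hx) x

theorem abs_wc_le (l : ℕ) (ω : ℝ → ℝ) (hω : IsPolyaWeight l ω) (n : ℕ) (x : ℝ) :
    |wc ω n x| ≤ om0 ω x := by
  by_cases hs : x ∈ Set.Ioi (0 : ℝ)
  · simp only [om0, wc, Set.indicator_of_mem hs]
    rw [abs_mul, abs_of_nonneg (hω.1 x hs), abs_of_nonneg bmp.nonneg]
    exact mul_le_of_le_one_right (hω.1 x hs) bmp.le_one
  · simp [om0, wc, Set.indicator_of_notMem hs]

/-- the kernel -/
def kerU (D : ℕ) (w : ℝ → ℝ) (t av u : ℝ) : ℝ :=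
  ((D : ℝ) * (1 - u) ^ (D - 1) * w (t / (av * u))) / (|av| * u)

theorem good_ae (l m : ℕ) (hl : 1 ≤ l) (hlm : l < m) (ω : ℝ → ℝ) (hω : IsPolyaWeight l ω)
    (av : ℝ) (ha : av ≠ 0) : ∀ᵐ t : ℝ,
      IntegrableOn (kerU (m - l) (om0 ω) t av) (Set.Ioo 0 1) := by
  have h := (omegaTilde_main m l hlm (om0 ω) (om0_zero ω) (om0_meas ω hω.2.1.continuousOn) 0
    (om0_int l ω hω 0 hl) av ha).1.prod_right_ae
  filter_upwards [h] with t ht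
  simp only [pow_zero, one_mul] at ht
  exact ht

theorem kerU_le (l D : ℕ) (ω : ℝ → ℝ) (hω : IsPolyaWeight l ω) (n : ℕ) (t av u : ℝ)
    (hu : u ∈ Set.Ioo (0 : ℝ) 1) :
    |kerU D (wc ω n) t av u| ≤ kerU D (om0 ω) t av u := by
  unfold kerU
  have h1 : 0 ≤ 1 - u := by linarith [hu.2]
  have h2 : 0 ≤ u := hu.1.le
  rw [abs_div, abs_mul, abs_of_nonneg (by positivity : 0 ≤ |av| * u),
    abs_of_nonneg (by positivity : 0 ≤ (D : ℝ) * (1 - u) ^ (D - 1))]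
  have := abs_wc_le l ω hω n (t / (av * u))
  gcongr

theorem wc_meas (l : ℕ) (ω : ℝ → ℝ) (hω : IsPolyaWeight l ω) (n : ℕ) : Measurable (wc ω n) :=
  (wc_WW (l - 1) ω hω.2.1 n).1.continuous.measurable

theorem tilde_lim (l m : ℕ) (ω : ℝ → ℝ) (hω : IsPolyaWeight l ω)
    (av t : ℝ) (hg : IntegrableOn (kerU (m - l) (om0 ω) t av) (Set.Ioo 0 1)) :
    Tendsto (fun n => omegaTildeLt m l (wc ω n) t av) atTop (nhds (omegaTildeLt m l (om0 ω) t av)) ∧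
    ∀ n, |omegaTildeLt m l (wc ω n) t av| ≤ |omegaTildeLt m l (om0 ω) t av| := by
  have hE : ∀ n, omegaTildeLt m l (wc ω n) t av = av ^ (m - l) *
      ∫ u in Set.Ioo (0 : ℝ) 1, kerU (m - l) (wc ω n) t av u := fun n =>
    omegaTilde_eq m l _ (wc_zero ω n) t av
  have hE0 : omegaTildeLt m l (om0 ω) t av = av ^ (m - l) *
      ∫ u in Set.Ioo (0 : ℝ) 1, kerU (m - l) (om0 ω) t av u :=
    omegaTilde_eq m l _ (om0_zero ω) t av
  have hle : ∀ n, ∀ᵐ u ∂(volume.restrict (Set.Ioo (0 : ℝ) 1)),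
      ‖kerU (m - l) (wc ω n) t av u‖ ≤ kerU (m - l) (om0 ω) t av u := fun n =>
    (ae_restrict_mem measurableSet_Ioo).mono fun u hu => kerU_le l _ ω hω n t av u hu
  simp_rw [hE, hE0]
  constructor
  · refine Tendsto.const_mul _ ?_
    refine tendsto_integral_of_dominated_convergence _ ?_ hg hle ?_
    · intro n
      have := wc_meas l ω hω n
      refine Measurable.aestronglyMeasurable ?_
      unfold kerU; fun_prop
    · refine Eventually.of_forall fun u => ?_
      refine tendsto_const_nhds.congr' ((wc_eventually ω 0 (t / (av * u))).mono fun n h => ?_)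
      simp only [Function.iterate_zero, id] at h
      simp only [kerU, h]
  · intro n
    rw [abs_mul, abs_mul]
    refine mul_le_mul_of_nonneg_left ?_ (abs_nonneg _)
    refine (norm_integral_le_of_norm_le hg (hle n)).trans (le_abs_self _)

def PhiB (l m : ℕ) (hlm : l ≤ m) (A : Fin m → Fin m → ℝ) (Q : Fin m → ℝ → ℝ) (t : Fin l → ℝ) : ℝ :=
  ∑ τ : Equiv.Perm (Fin l), ∑ σ : Equiv.Perm (Fin m),
    |∏ b, A (e2 l m hlm (Sum.inl b)) (σ (e2 l m hlm (Sum.inl b)))| *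
      ∏ d, (|t d| ^ (τ d : ℕ) * |Q (σ (e2 l m hlm (Sum.inr d))) (t d)|)

theorem PhiB_int (l m : ℕ) (hlm : l ≤ m) (A : Fin m → Fin m → ℝ) (Q : Fin m → ℝ → ℝ)
    (hQ : ∀ k < l, ∀ c, Integrable fun s => s ^ k * Q c s) : Integrable (PhiB l m hlm A Q) := by
  unfold PhiB
  refine integrable_finsetSum _ fun τ _ => integrable_finsetSum _ fun σ _ => Integrable.const_mul ?_ _
  refine Integrable.fintype_prod
    (f := fun (d : Fin l) s => |s| ^ (τ d : ℕ) * |Q (σ (e2 l m hlm (Sum.inr d))) s|) (fun d => ?_)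
  refine (hQ (τ d) (τ d).isLt (σ (e2 l m hlm (Sum.inr d)))).abs.congr (Eventually.of_forall fun s => ?_)
  simp only [abs_mul, abs_pow]

theorem Phi_le (l m : ℕ) (hlm : l ≤ m) (A : Fin m → Fin m → ℝ) (R : Fin l → Fin m → ℝ)
    (Q : Fin m → ℝ → ℝ) (t : Fin l → ℝ) (h : ∀ d c, |R d c| ≤ |Q c (t d)|) :
    |VdmF t * (BB l m hlm A R).det| ≤ PhiB l m hlm A Q t := by
  unfold PhiB
  rw [abs_mul, VdmF_eq_PD]
  have h1 := abs_PD_le (fun i : Fin l => (i : ℕ)) t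
  have h2 : |(BB l m hlm A R).det| ≤ ∑ σ : Equiv.Perm (Fin m),
      |∏ b, A (e2 l m hlm (Sum.inl b)) (σ (e2 l m hlm (Sum.inl b)))| *
        ∏ d, |Q (σ (e2 l m hlm (Sum.inr d))) (t d)| := by
    rw [BB_det]
    refine (Finset.abs_sum_le_sum_abs _ _).trans (Finset.sum_le_sum fun σ _ => ?_)
    have h1 : |((Equiv.Perm.sign σ : ℤ) : ℝ)| = 1 := by
      rcases Int.units_eq_one_or (Equiv.Perm.sign σ) with h | h <;> simp [h]
    rw [abs_mul, abs_mul, h1, one_mul]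
    refine mul_le_mul_of_nonneg_left ?_ (abs_nonneg _)
    rw [Finset.abs_prod]
    exact Finset.prod_le_prod (fun _ _ => abs_nonneg _) fun d _ => h _ _
  refine (mul_le_mul h1 h2 (abs_nonneg _) (Finset.sum_nonneg fun σ _ =>
    Finset.prod_nonneg fun c _ => by positivity)).trans_eq ?_
  rw [Finset.sum_mul]
  refine Finset.sum_congr rfl fun τ _ => ?_
  rw [Finset.mul_sum]
  refine Finset.sum_congr rfl fun σ _ => ?_
  rw [Finset.prod_mul_distrib]; ring

theorem Phi_om0_int (l m : ℕ) (hlm : l < m) (ω : ℝ → ℝ) (hω : IsPolyaWeight l ω)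
    (a : Fin m → ℝ) (ha : ∀ i, a i ≠ 0) : Integrable (Phi l m hlm (om0 ω) a) :=
  Phi_integrable l m hlm _ (om0_zero ω) (om0_meas ω hω.2.1.continuousOn) (om0_int l ω hω) a ha

theorem wc_int (l : ℕ) (ω : ℝ → ℝ) (hω : IsPolyaWeight l ω) (n : ℕ) (k : ℕ) (hk : k < l) :
    Integrable fun x => x ^ k * wc ω n x := by
  have hm := wc_meas l ω hω n
  refine (om0_int l ω hω k hk).abs.mono' (by fun_prop) (Eventually.of_forall fun x => ?_)
  rw [Real.norm_eq_abs, abs_mul, abs_mul, abs_of_nonneg (om0_nonneg l ω hω x)]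
  exact mul_le_mul_of_nonneg_left (abs_wc_le l ω hω n x) (abs_nonneg _)

theorem rhs_lim (l m : ℕ) (hl : 1 ≤ l) (hlm : l < m) (ω : ℝ → ℝ) (hω : IsPolyaWeight l ω)
    (a : Fin m → ℝ) (ha : ∀ i, a i ≠ 0) (F : (Fin l → ℝ) → ℝ)
    (hF : Measurable F) (C : ℝ) (hC : ∀ p, |F p| ≤ C) (κ : ℝ) :
    Tendsto (fun n => ∫ t, F t * (κ * Phi l m hlm (wc ω n) a t))
      atTop (nhds (∫ t, F t * (κ * Phi l m hlm (om0 ω) a t))) := by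
  let Q : Fin m → ℝ → ℝ := fun c s => omegaTildeLt m l (om0 ω) s (a c)
  let A : Fin m → Fin m → ℝ := fun b c => a c ^ (b : ℕ)
  have hgood : ∀ᵐ t : Fin l → ℝ, ∀ (d : Fin l) (c : Fin m),
      IntegrableOn (kerU (m - l) (om0 ω) (t d) (a c)) (Set.Ioo 0 1) := by
    rw [ae_all_iff]; intro d
    rw [ae_all_iff]; intro c
    exact (Measure.quasiMeasurePreserving_eval (fun _ : Fin l => (volume : Measure ℝ)) d).ae
      (good_ae l m hl hlm ω hω (a c) (ha c))
  have hI : Integrable (PhiB l m hlm.le A Q) := PhiB_int l m hlm.le A Q fun k hk c =>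
    (omegaTilde_main m l hlm (om0 ω) (om0_zero ω) (om0_meas ω hω.2.1.continuousOn) k
      (om0_int l ω hω k hk) (a c) (ha c)).2.1
  refine tendsto_integral_of_dominated_convergence (fun t => C * (|κ| * PhiB l m hlm.le A Q t))
    ?_ ((hI.const_mul _).const_mul _) ?_ ?_
  · intro n
    exact hF.aestronglyMeasurable.mul ((Phi_integrable l m hlm _ (wc_zero ω n) (wc_meas l ω hω n)
      (wc_int l ω hω n) a ha).const_mul _).1
  · intro n
    filter_upwards [hgood] with t ht
    have h1 : |Phi l m hlm (wc ω n) a t| ≤ PhiB l m hlm.le A Q t :=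
      Phi_le l m hlm.le A _ Q t fun d c => (tilde_lim l m ω hω (a c) (t d) (ht d c)).2 n
    rw [Real.norm_eq_abs, abs_mul, abs_mul]
    have h0 := hC t
    have h2 : 0 ≤ C := (abs_nonneg _).trans h0
    gcongr
  · filter_upwards [hgood] with t ht
    refine Tendsto.const_mul _ (Tendsto.const_mul _ ?_)
    unfold Phi
    simp only [BB_det]
    refine Tendsto.const_mul _ (tendsto_finsetSum _ fun σ _ => Tendsto.const_mul _ ?_)
    exact tendsto_finsetProd _ fun d _ => (tilde_lim l m ω hω _ (t d) (ht d _)).1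

theorem cont_case (l m : ℕ) (hl : 1 ≤ l) (hlm : l < m) (ω : ℝ → ℝ) (hω : IsPolyaWeight l ω)
    (a : Fin m → ℝ) (ha0 : ∀ i, a i ≠ 0) (ha : Function.Injective a)
    (f : (Fin l → ℝ) → ℝ) (hf : Continuous f) (hs : ∀ (σ : Equiv.Perm (Fin l)) v, f (v ∘ σ) = f v)
    (C : ℝ) (hC : ∀ v, |f v| ≤ C) :
    ∫ p : (Fin l → ℝ) × UG m, f (eigs (GG l m hlm a p.1 (p.2 : Matrix (Fin m) (Fin m) ℂ))) *
      (VdmF a * Psi l (om0 ω) p.1) ∂(volume.prod (hU m)) =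
    ∫ t, f t * (Kc l m * Phi l m hlm (om0 ω) a t) := by
  have h1 := lhs_lim l m ω hω _ (measurable_feigs' l m hlm a f hf.measurable hs) C
    (fun p => hC _) (VdmF a)
  have h2 := rhs_lim l m hl hlm ω hω a ha0 f hf.measurable C hC (Kc l m)
  refine tendsto_nhds_unique (h1.congr fun n => ?_) h2
  exact compact_case l m hlm a ha0 ha _ (wc_WW (l - 1) ω hω.2.1 n) f hf hs

theorem wd_int {X Z : Type*} [MeasurableSpace X] [MeasurableSpace Z] (μ : Measure X) (e : X → Z)
    (he : Measurable e) (ψ : X → ℝ) (hψ : Integrable ψ μ) (h : Z → ℝ) (hh : Measurable h) (C : ℝ)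
    (hC : ∀ z, |h z| ≤ C) :
    Integrable (fun x => h (e x) * max (ψ x) 0) μ ∧
    IsFiniteMeasure ((μ.withDensity fun x => ENNReal.ofReal (ψ x)).map e) ∧
    ∫ z, h z ∂((μ.withDensity fun x => ENNReal.ofReal (ψ x)).map e) = ∫ x, h (e x) * max (ψ x) 0 ∂μ := by
  have hfin : IsFiniteMeasure (μ.withDensity fun x => ENNReal.ofReal (ψ x)) :=
    isFiniteMeasure_withDensity_ofReal hψ.2
  refine ⟨?_, inferInstance, ?_⟩
  · exact hψ.pos_part.bdd_mul (hh.comp he).aestronglyMeasurable (Eventually.of_forall fun x => hC (e x))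
  · rw [integral_map he.aemeasurable hh.aestronglyMeasurable]
    have := integral_withDensity_eq_integral_smul₀ (μ := μ) (f := fun x => (ψ x).toNNReal)
      (hψ.1.aemeasurable.real_toNNReal) (fun x => h (e x))
    refine Eq.trans this ?_
    refine integral_congr_ae (Eventually.of_forall fun x => ?_)
    simp only [NNReal.smul_def, smul_eq_mul, Real.coe_toNNReal']
    ring

theorem meas_ext {X Y Z : Type*} [MeasurableSpace X] [MeasurableSpace Y] [MeasurableSpace Z]
    [TopologicalSpace Z] [HasOuterApproxClosed Z] [BorelSpace Z]
    (μ : Measure X) (ν : Measure Y) (e1 : X → Z) (e2 : Y → Z) (h1 : Measurable e1)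
    (h2 : Measurable e2) (ψ : X → ℝ) (φ : Y → ℝ) (hψ : Integrable ψ μ) (hφ : Integrable φ ν)
    (H : ∀ g : Z → ℝ, Continuous g → ∀ C, (∀ z, |g z| ≤ C) →
      ∫ x, g (e1 x) * ψ x ∂μ = ∫ y, g (e2 y) * φ y ∂ν)
    (h : Z → ℝ) (hh : Measurable h) (C : ℝ) (hC : ∀ z, |h z| ≤ C) :
    ∫ x, h (e1 x) * ψ x ∂μ = ∫ y, h (e2 y) * φ y ∂ν := by
  let A1 := (μ.withDensity fun x => ENNReal.ofReal (ψ x)).map e1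
  let A2 := (μ.withDensity fun x => ENNReal.ofReal (-ψ x)).map e1
  let B1 := (ν.withDensity fun x => ENNReal.ofReal (φ x)).map e2
  let B2 := (ν.withDensity fun x => ENNReal.ofReal (-φ x)).map e2
  have fA1 : IsFiniteMeasure A1 := (wd_int μ e1 h1 ψ hψ h hh C hC).2.1
  have fA2 : IsFiniteMeasure A2 := (wd_int μ e1 h1 _ hψ.neg h hh C hC).2.1
  have fB1 : IsFiniteMeasure B1 := (wd_int ν e2 h2 φ hφ h hh C hC).2.1
  have fB2 : IsFiniteMeasure B2 := (wd_int ν e2 h2 _ hφ.neg h hh C hC).2.1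
  have key : ∀ h : Z → ℝ, Measurable h → ∀ C, (∀ z, |h z| ≤ C) →
      (∫ z, h z ∂(A1 + B2) = ∫ z, h z ∂(A2 + B1) ↔
        ∫ x, h (e1 x) * ψ x ∂μ = ∫ y, h (e2 y) * φ y ∂ν) := by
    intro h hh C hC
    obtain ⟨i1, -, j1⟩ := wd_int μ e1 h1 ψ hψ h hh C hC
    obtain ⟨i2, -, j2⟩ := wd_int μ e1 h1 _ hψ.neg h hh C hC
    obtain ⟨i3, -, j3⟩ := wd_int ν e2 h2 φ hφ h hh C hC
    obtain ⟨i4, -, j4⟩ := wd_int ν e2 h2 _ hφ.neg h hh C hC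
    have hIntg : ∀ (M : Measure Z) [IsFiniteMeasure M], Integrable h M := fun M _ =>
      Integrable.of_bound hh.aestronglyMeasurable C (Eventually.of_forall hC)
    rw [integral_add_measure (hIntg A1) (hIntg B2), integral_add_measure (hIntg A2) (hIntg B1)]
    have e1' : ∫ x, h (e1 x) * ψ x ∂μ = ∫ z, h z ∂A1 - ∫ z, h z ∂A2 := by
      rw [show ∫ z, h z ∂A1 = _ from j1, show ∫ z, h z ∂A2 = _ from j2, ← integral_sub i1 i2]
      refine integral_congr_ae (Eventually.of_forall fun x => ?_)
      simp only [Pi.neg_apply]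
      rw [← mul_sub]
      congr 1
      rcases le_total (ψ x) 0 with hx | hx
      · rw [max_eq_right hx, max_eq_left (by linarith)]; ring
      · rw [max_eq_left hx, max_eq_right (by linarith)]; ring
    have e2' : ∫ x, h (e2 x) * φ x ∂ν = ∫ z, h z ∂B1 - ∫ z, h z ∂B2 := by
      rw [show ∫ z, h z ∂B1 = _ from j3, show ∫ z, h z ∂B2 = _ from j4, ← integral_sub i3 i4]
      refine integral_congr_ae (Eventually.of_forall fun x => ?_)
      simp only [Pi.neg_apply]
      rw [← mul_sub]
      congr 1
      rcases le_total (φ x) 0 with hx | hx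
      · rw [max_eq_right hx, max_eq_left (by linarith)]; ring
      · rw [max_eq_left hx, max_eq_right (by linarith)]; ring
    rw [e1', e2']
    constructor <;> intro h <;> linarith
  have hM : A1 + B2 = A2 + B1 := by
    refine ext_of_forall_integral_eq_of_IsFiniteMeasure fun g => ?_
    have hg : ∀ z, |g z| ≤ ‖g‖ := fun z => g.norm_coe_le_norm z
    exact (key g g.continuous.measurable _ hg).2 (H g g.continuous _ hg)
  exact (key h hh C hC).1 (by rw [hM])

theorem EVm_eq {n : ℕ} (y : Matrix (Fin n) (Fin n) ℂ) (hy : y.IsHermitian) :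
    EVm y = EV n (eigs y) := by
  ext k
  simp only [EVm, EV]
  rw [← eigs_det y hy]; rfl

theorem EV_symm {n : ℕ} (x : Fin n → ℝ) (σ : Equiv.Perm (Fin n)) : EV n (x ∘ σ) = EV n x := by
  ext k
  simp only [EV, Function.comp]
  exact Equiv.prod_comp σ fun j => ((k : ℕ) : ℝ) - x j

theorem meas_case (l m : ℕ) (hl : 1 ≤ l) (hlm : l < m) (ω : ℝ → ℝ) (hω : IsPolyaWeight l ω)
    (a : Fin m → ℝ) (ha0 : ∀ i, a i ≠ 0) (ha : Function.Injective a)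
    (f : (Fin l → ℝ) → ℝ) (hf : Measurable f) (hs : ∀ (σ : Equiv.Perm (Fin l)) v, f (v ∘ σ) = f v)
    (C : ℝ) (hC : ∀ v, |f v| ≤ C) :
    ∫ p : (Fin l → ℝ) × UG m, f (eigs (GG l m hlm a p.1 (p.2 : Matrix (Fin m) (Fin m) ℂ))) *
      (VdmF a * Psi l (om0 ω) p.1) ∂(volume.prod (hU m)) =
    ∫ t, f t * (Kc l m * Phi l m hlm (om0 ω) a t) := by
  have hmE : Measurable fun p : (Fin l → ℝ) × UG m =>
      EVm (GG l m hlm a p.1 (p.2 : Matrix (Fin m) (Fin m) ℂ)) := by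
    have h1 : Measurable fun p : (Fin l → ℝ) × UG m => (p.1, (p.2 : Matrix (Fin m) (Fin m) ℂ)) :=
      Measurable.prodMk measurable_fst (Measurable.comp measurable_subtype_coe measurable_snd)
    have h3 : Measurable fun p : (Fin l → ℝ) × Matrix (Fin m) (Fin m) ℂ =>
        EVm (GG l m hlm a p.1 p.2) := by
      have : BorelSpace ((Fin l → ℝ) × Matrix (Fin m) (Fin m) ℂ) := by
        have : SecondCountableTopology (Matrix (Fin m) (Fin m) ℂ) := matSCT m m
        infer_instance
      exact (continuous_EVm.comp (continuous_GG l m hlm a)).measurable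
    have h2 := Measurable.comp h3 h1
    simpa only [Function.comp_def] using h2
  have hR : ∀ t, f t = f (RR l (EV l t)) := by
    intro t
    obtain ⟨σ, h⟩ := RR_EV l t
    rw [h, hs]
  have hL : ∀ p : (Fin l → ℝ) × UG m, f (eigs (GG l m hlm a p.1 (p.2 : Matrix (Fin m) (Fin m) ℂ))) =
      f (RR l (EVm (GG l m hlm a p.1 (p.2 : Matrix (Fin m) (Fin m) ℂ)))) := fun p =>
    eigs_symm f hs _ (GG_herm _ _ _ _ _ _)
  have key := meas_ext (volume.prod (hU m)) volume
    (fun p : (Fin l → ℝ) × UG m => EVm (GG l m hlm a p.1 (p.2 : Matrix (Fin m) (Fin m) ℂ)))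
    (EV l) hmE (continuous_EV l).measurable (fun p => VdmF a * Psi l (om0 ω) p.1)
    (fun t => Kc l m * Phi l m hlm (om0 ω) a t)
    (((Psi_om0_int l ω hω).const_mul _).comp_fst (hU m))
    ((Phi_om0_int l m hlm ω hω a ha0).const_mul _) ?_ (fun z => f (RR l z))
    (hf.comp (measurable_RR l)) C (fun z => hC _)
  · simp_rw [hL]
    rw [key]
    simp_rw [← hR]
  · intro g hg D hD
    have h := cont_case l m hl hlm ω hω a ha0 ha (fun t => g (EV l t)) (hg.comp (continuous_EV l))
      (fun σ v => by rw [EV_symm]) D (fun v => hD _)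
    refine Eq.trans ?_ h
    refine integral_congr_ae (Eventually.of_forall fun p => ?_)
    simp only []
    rw [EVm_eq _ (GG_herm _ _ _ _ _ _)]

def Dn (l : ℕ) (ω : ℝ → ℝ) : ℝ :=
  ∏ j ∈ Finset.range l, ((Nat.factorial (j + 1) : ℝ) * MellinNat ω (j + 1))

theorem const_eq (l m : ℕ) (ω : ℝ → ℝ) :
    (1 / (Nat.factorial l : ℝ)) *
    (∏ j ∈ Finset.range l,
      (Nat.factorial (m - (j + 1)) : ℝ) /
        ((Nat.factorial (m - l) : ℝ) * (Nat.factorial (l - (j + 1)) : ℝ) *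
          MellinNat ω (l - j))) = Kc l m / Dn l ω := by
  have h1 : ∏ j ∈ Finset.range l, (Nat.factorial (m - (j + 1)) : ℝ) /
        ((Nat.factorial (m - l) : ℝ) * (Nat.factorial (l - (j + 1)) : ℝ) *
          MellinNat ω (l - j)) = Kc l m /
      ∏ j ∈ Finset.range l, ((Nat.factorial (l - (j + 1)) : ℝ) * MellinNat ω (l - j)) := by
    rw [Kc, ← Finset.prod_div_distrib]
    refine Finset.prod_congr rfl fun j _ => ?_
    rw [div_div, mul_assoc]
  have h2 : ∏ j ∈ Finset.range l, ((Nat.factorial (l - (j + 1)) : ℝ) * MellinNat ω (l - j)) =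
      ∏ j ∈ Finset.range l, ((Nat.factorial j : ℝ) * MellinNat ω (j + 1)) := by
    rw [← Finset.prod_range_reflect (fun j => (Nat.factorial j : ℝ) * MellinNat ω (j + 1))]
    refine Finset.prod_congr rfl fun j hj => ?_
    have := Finset.mem_range.1 hj
    rw [show l - (j + 1) = l - 1 - j by omega, show l - j = l - 1 - j + 1 by omega]
  have h3 : Dn l ω = (l.factorial : ℝ) *
      ∏ j ∈ Finset.range l, ((Nat.factorial j : ℝ) * MellinNat ω (j + 1)) := by
    rw [← Finset.prod_range_add_one_eq_factorial, Nat.cast_prod, ← Finset.prod_mul_distrib, Dn]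
    refine Finset.prod_congr rfl fun j _ => ?_
    rw [Nat.factorial_succ]; push_cast; ring
  rw [h1, h2, h3, one_div, mul_comm, ← div_eq_mul_inv, div_div, mul_comm (l.factorial : ℝ)]

theorem proj_eq (l m : ℕ) (hlm : l < m) (ω : ℝ → ℝ) (a : Fin m → ℝ) (t : Fin l → ℝ) :
    projDensity l m hlm ω a t = (Dn l ω * VdmF a)⁻¹ * (Kc l m * Phi l m hlm (om0 ω) a t) := by
  unfold projDensity
  rw [const_eq]
  have : (Matrix.of fun b c : Fin m =>
      if hb : (b : ℕ) < m - l then a c ^ (b : ℕ)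
      else omegaTildeLt m l ω (t ⟨(b : ℕ) - (m - l), by have h2 := b.isLt; omega⟩) (a c)) =
      BB l m hlm.le (fun b c => a c ^ (b : ℕ)) (fun d c => omegaTildeLt m l (om0 ω) (t d) (a c)) := by
    ext b c
    simp only [BB, Matrix.of_apply]
    split_ifs
    · rfl
    · exact omegaTilde_ind m l ω _ _
  rw [this, Phi, mul_inv]
  ring

theorem polya_eq (l : ℕ) (ω : ℝ → ℝ) (x : Fin l → ℝ) :
    (Set.pi Set.univ (fun _ : Fin l => Set.Ioi (0 : ℝ))).indicator (polyaDensity l ω) x =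
      (Dn l ω)⁻¹ * Psi l (om0 ω) x := by
  by_cases hx : x ∈ Set.pi Set.univ (fun _ : Fin l => Set.Ioi (0 : ℝ))
  · rw [Set.indicator_of_mem hx]
    unfold polyaDensity Psi
    rw [div_eq_inv_mul]
    congr 3
    ext b c
    exact xd_congr ω (om0 ω) (Set.Ioi 0) isOpen_Ioi
      (fun y hy => (Set.indicator_of_mem hy ω).symm) b (x c) (hx c (Set.mem_univ c))
  · rw [Set.indicator_of_notMem hx]
    simp only [Set.mem_pi, not_forall] at hx
    obtain ⟨c, -, hc⟩ := hx
    unfold Psi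
    rw [Matrix.det_eq_zero_of_column_eq_zero c, mul_zero, mul_zero]
    intro b
    exact negxd_nonpos _ (om0_zero ω) b (x c) (by simpa using hc)

/-- Eigenvalue distribution of `D·B(v)·D`, where `B(v)` is the top-left
`l × l` block of `v diag(a) v*`, `v` Haar unitary on `U(m)`, and `D = diag(√a')` with `a'`
drawn from the Pólya ensemble density `p_ω` of order `l`. -/
theorem statement12 (l m : ℕ) (hl : 1 ≤ l) (hlm : l < m)
    (ω : ℝ → ℝ) (hω : IsPolyaWeight l ω)
    (a : Fin m → ℝ) (ha0 : ∀ i, a i ≠ 0) (hadist : Function.Injective a)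
    (μ : Measure (Matrix (Fin m) (Fin m) ℂ)) (hμ : IsHaarUnitary m μ)
    (f : (Fin l → ℝ) → ℝ) (hfmeas : Measurable f) (hfbdd : ∃ C, ∀ v, |f v| ≤ C)
    (hfsymm : ∀ (σ : Equiv.Perm (Fin l)) (v : Fin l → ℝ), f (v ∘ σ) = f v) :
    (∫ v, (∫ a' in Set.pi Set.univ (fun _ : Fin l => Set.Ioi (0 : ℝ)),
        f (eigs (sqrtDiag a' * blockLL l m hlm.le (v * realDiag a * vᴴ) * sqrtDiag a')) *
          polyaDensity l ω a')
      ∂μ) =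
    ∫ t : Fin l → ℝ, f t * projDensity l m hlm ω a t := by
  obtain ⟨C, hC⟩ := hfbdd
  have hemb : MeasurableEmbedding (fun v : UG m => (v : Matrix (Fin m) (Fin m) ℂ)) :=
    MeasurableEmbedding.subtype_coe (isClosed_UG m).measurableSet
  have hV : VdmF a ≠ 0 := by
    unfold VdmF
    refine Finset.prod_ne_zero_iff.2 fun i _ => Finset.prod_ne_zero_iff.2 fun j hj => ?_
    exact sub_ne_zero.2 fun h => (ne_of_lt (Finset.mem_Iio.1 hj)) (hadist h).symm
  have hin : ∀ v : Matrix (Fin m) (Fin m) ℂ,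
      (∫ a' in Set.pi Set.univ (fun _ : Fin l => Set.Ioi (0 : ℝ)),
        f (eigs (sqrtDiag a' * blockLL l m hlm.le (v * realDiag a * vᴴ) * sqrtDiag a')) *
          polyaDensity l ω a') =
      ∫ x : Fin l → ℝ, (Dn l ω * VdmF a)⁻¹ * (f (eigs (GG l m hlm a x v)) *
        (VdmF a * Psi l (om0 ω) x)) := by
    intro v
    rw [← integral_indicator (MeasurableSet.univ_pi fun _ => measurableSet_Ioi)]
    refine integral_congr_ae (Eventually.of_forall fun x => ?_)
    have h1 : (Set.pi Set.univ (fun _ : Fin l => Set.Ioi (0 : ℝ))).indicator (fun a' =>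
        f (eigs (sqrtDiag a' * blockLL l m hlm.le (v * realDiag a * vᴴ) * sqrtDiag a')) *
          polyaDensity l ω a') x = f (eigs (GG l m hlm a x v)) *
        (Set.pi Set.univ (fun _ : Fin l => Set.Ioi (0 : ℝ))).indicator (polyaDensity l ω) x := by
      by_cases hx : x ∈ Set.pi Set.univ (fun _ : Fin l => Set.Ioi (0 : ℝ))
      · rw [Set.indicator_of_mem hx, Set.indicator_of_mem hx]; rfl
      · rw [Set.indicator_of_notMem hx, Set.indicator_of_notMem hx, mul_zero]
    simp only []
    rw [h1, polya_eq, mul_inv]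
    generalize f (eigs (GG l m hlm a x v)) = y
    calc y * ((Dn l ω)⁻¹ * Psi l (om0 ω) x) =
        (Dn l ω)⁻¹ * (VdmF a)⁻¹ * VdmF a * y * Psi l (om0 ω) x := by
          rw [inv_mul_cancel_right₀ hV]; ring
      _ = _ := by ring
  simp_rw [hin]
  rw [haar_eq μ hμ, hemb.integral_map]
  have hFm := measurable_feigs' l m hlm a f hfmeas hfsymm
  have hIntg : Integrable (fun p : (Fin l → ℝ) × UG m => (Dn l ω * VdmF a)⁻¹ *
      (f (eigs (GG l m hlm a p.1 (p.2 : Matrix (Fin m) (Fin m) ℂ))) *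
        (VdmF a * Psi l (om0 ω) p.1))) (volume.prod (hU m)) := by
    refine Integrable.const_mul ?_ _
    exact (((Psi_om0_int l ω hω).const_mul _).comp_fst (hU m)).bdd_mul hFm.aestronglyMeasurable
      (Eventually.of_forall fun p => hC _)
  refine (integral_prod_symm _ hIntg).symm.trans ?_
  rw [integral_const_mul, meas_case l m hl hlm ω hω a ha0 hadist f hfmeas hfsymm C hC,
    ← integral_const_mul]
  refine integral_congr_ae (Eventually.of_forall fun t => ?_)
  simp only [proj_eq]
  ring

end RMT
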